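/- Let 𝔸, 𝔹 be generalized algebraic theories, h ≥ 0, and suppose the pair (𝔸,𝔹) is h-derivable. Let X = (x₁:X₁,…,x_m:X_m) and Y = (y₁:Y₁,…,yₙ:Yₙ) be contexts of 𝔸, 𝔹. (1) If X ⊢ u ≡ v : U is derivable in 𝔸 with ht(X ⊢ u ≡ v:U) · ht(Y) ≤ h then, with X' = (X, x':U) for x' not in X, the morphism equality (x₁,…,x_m,u^U) ⊗ Y ≡ (x₁,…,x_m,v^U) ⊗ Y : X⊗Y → X'⊗Y is derivable in 𝔸⊗𝔹. (2) Symmetrically, if Y ⊢ u ≡ v : V is derivable in 𝔹 with ht(X) · ht(Y ⊢ u ≡ v:V) ≤ h then, with Y' = (Y, y':V) for y' not in Y, the morphism equality X ⊗ (y₁,…,yₙ,u) ≡ X ⊗ (y₁,…,yₙ,v) : X⊗Y → X⊗Y' is derivable in 𝔸⊗𝔹. -/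

import Mathlib

set_option linter.unusedVariables false

/-! # Syntax of generalized algebraic theories (following Cartmell / the paper's appendix) -/

namespace GATPaper

/-- A sort-and-term alphabet: a countably infinite set of variables, a set of sort
symbols and a set of term symbols. -/
structure Alphabet : Type 1 where
  Var : Type
  SortSym : Type
  TermSym : Type
  var_infinite : Infinite Var
  var_countable : Countable Var

attribute [instance] Alphabet.var_infinite Alphabet.var_countable

variable {A B : Alphabet}

/-- Term expressions over an alphabet. -/
inductive Expr (A : Alphabet) : Type where
  | var : A.Var → Expr A
  | app : A.TermSym → List (Expr A) → Expr A

/-- Sort expressions: a sort symbol applied to a list of term expressions. -/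
structure SortE (A : Alphabet) : Type where
  head : A.SortSym
  args : List (Expr A)

/-- Occurrence of a variable in a term expression. -/
inductive Occurs (x : A.Var) : Expr A → Prop where
  | var : Occurs x (Expr.var x)
  | app {t : A.TermSym} {es : List (Expr A)} {e : Expr A} :
      e ∈ es → Occurs x e → Occurs x (Expr.app t es)

/-- Occurrence of a variable in a sort expression. -/
def SOccurs (x : A.Var) (U : SortE A) : Prop := ∃ e ∈ U.args, Occurs x e

/-- Simultaneous substitution along a function on variables. -/
def Expr.subst (σ : A.Var → Expr A) : Expr A → Expr A
  | .var x => σ x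
  | .app t es => .app t (es.attach.map fun e => Expr.subst σ e.1)
termination_by e => sizeOf e
decreasing_by
  have := List.sizeOf_lt_of_mem e.2
  simp only [Expr.app.sizeOf_spec]
  omega

def SortE.subst (σ : A.Var → Expr A) (U : SortE A) : SortE A :=
  ⟨U.head, U.args.map (Expr.subst σ)⟩

open Classical in
/-- The function on variables determined by a finite list of substitution pairs
`(zᵢ, uᵢ)` (substituting `uᵢ` for `zᵢ`, first matching pair winning, all other
variables unchanged). -/
noncomputable def lookupV : List (A.Var × Expr A) → A.Var → Expr A
  | [], x => .var x
  | p :: ps, x => if p.1 = x then p.2 else lookupV ps x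

/-- The simultaneous substitution `e[u₁ | z₁, …, u_k | z_k]` where
`ps = [(z₁,u₁),…,(z_k,u_k)]`. -/
noncomputable def Expr.substL (e : Expr A) (ps : List (A.Var × Expr A)) : Expr A :=
  e.subst (lookupV ps)

noncomputable def SortE.substL (U : SortE A) (ps : List (A.Var × Expr A)) : SortE A :=
  U.subst (lookupV ps)

/-- A (pre)context is a finite list of (variable, sort expression) pairs. -/
abbrev PreCtx (A : Alphabet) := List (A.Var × SortE A)

/-- The list of variables of a precontext, as term expressions. -/
def ctxVars (X : PreCtx A) : List (Expr A) := X.map fun p => Expr.var p.1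

/-- The scoping condition of a precontext: the `i`-th sort expression only contains
variables among the first `i` variables. -/
def IsPreCtx (X : PreCtx A) : Prop :=
  ∀ i (hi : i < X.length) (v : A.Var),
    SOccurs v (X[i]'hi).2 → v ∈ (X.take i).map Prod.fst

/-- Substitution pairs sending the variables of `X` to the entries of `f`. -/
def mkSub (X : PreCtx A) (f : List (Expr A)) : List (A.Var × Expr A) :=
  (X.map Prod.fst).zip f

/-- `Xᵢ[f₁ | x₁, …, f_{i-1} | x_{i-1}]` (0-based: the `i`-th sort of `X`
substituted along the first `i` entries of `f`). -/
noncomputable def subPre (X : PreCtx A) (f : List (Expr A)) (i : ℕ) (hi : i < X.length) :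
    SortE A :=
  ((X[i]'hi).2).substL (mkSub (X.take i) (f.take i))

/-- Judgments: context judgments and the four kinds of standard judgments. -/
inductive Judg (A : Alphabet) : Type where
  | ctx (X : PreCtx A)
  | sort (X : PreCtx A) (U : SortE A)
  | term (X : PreCtx A) (u : Expr A) (U : SortE A)
  | sortEq (X : PreCtx A) (U V : SortE A)
  | termEq (X : PreCtx A) (u v : Expr A) (U : SortE A)

/-- The context of a judgment. -/
def Judg.ctxOf : Judg A → PreCtx A
  | .ctx X => X
  | .sort X _ => X
  | .term X _ _ => X
  | .sortEq X _ _ => X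
  | .termEq X _ _ _ => X

/-- The judgment introducing a sort symbol over the context `X`. -/
def introSort (X : PreCtx A) (S : A.SortSym) : Judg A := .sort X ⟨S, ctxVars X⟩

/-- The judgment introducing a term symbol over the context `X`, with sort `U`. -/
def introTerm (X : PreCtx A) (t : A.TermSym) (U : SortE A) : Judg A :=
  .term X (.app t (ctxVars X)) U

/-- A set of axioms is a pretheory if: no axiom is a context judgment, every
axiom's context is a precontext, every sort symbol has a unique introducing sort
axiom and there are no other sort axioms, and likewise for term symbols. -/
structure IsPretheory (Ax : Set (Judg A)) : Prop where
  no_ctx : ∀ X : PreCtx A, Judg.ctx X ∉ Ax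
  wf_ctx : ∀ J ∈ Ax, IsPreCtx J.ctxOf
  sort_intro : ∀ S : A.SortSym, ∃! X : PreCtx A, introSort X S ∈ Ax
  sort_shape : ∀ (X : PreCtx A) (U : SortE A), Judg.sort X U ∈ Ax → U.args = ctxVars X
  term_intro : ∀ t : A.TermSym, ∃! p : PreCtx A × SortE A, introTerm p.1 t p.2 ∈ Ax
  term_shape : ∀ (X : PreCtx A) (u : Expr A) (U : SortE A), Judg.term X u U ∈ Ax →
      ∃ t : A.TermSym, u = Expr.app t (ctxVars X)

/-- One inference step of the paper's system: `Step Ax D J` holds when `J` is the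
conclusion of an instance of one of the sixteen rules all of whose premises
satisfy `D`. -/
inductive Step (Ax : Set (Judg A)) (D : Judg A → Prop) : Judg A → Prop where
  | ctx_nil : Step Ax D (.ctx [])
  | ctx_cons {X : PreCtx A} {U : SortE A} {x : A.Var}
      (hs : D (.sort X U)) (hfresh : ∀ p ∈ X, p.1 ≠ x)
      (hpre : IsPreCtx (X ++ [(x, U)])) :
      Step Ax D (.ctx (X ++ [(x, U)]))
  | s1 {X : PreCtx A} {U : SortE A} (h : D (.sort X U)) : Step Ax D (.sortEq X U U)
  | s2 {X : PreCtx A} {U V : SortE A} (h : D (.sortEq X U V)) : Step Ax D (.sortEq X V U)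
  | s3 {X : PreCtx A} {U V W : SortE A}
      (h1 : D (.sortEq X U V)) (h2 : D (.sortEq X V W)) : Step Ax D (.sortEq X U W)
  | t1 {X : PreCtx A} {u : Expr A} {U : SortE A}
      (h : D (.term X u U)) : Step Ax D (.termEq X u u U)
  | t2 {X : PreCtx A} {u v : Expr A} {U : SortE A}
      (h : D (.termEq X u v U)) : Step Ax D (.termEq X v u U)
  | t3 {X : PreCtx A} {u v w : Expr A} {U : SortE A}
      (h1 : D (.termEq X u v U)) (h2 : D (.termEq X v w U)) : Step Ax D (.termEq X u w U)
  | seqt {X : PreCtx A} {U U' : SortE A} {u : Expr A}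
      (h1 : D (.sortEq X U U')) (h2 : D (.term X u U)) : Step Ax D (.term X u U')
  | seqteq {X : PreCtx A} {U U' : SortE A} {u u' : Expr A}
      (h1 : D (.sortEq X U U')) (h2 : D (.termEq X u u' U))
      (h3 : D (.term X u U')) (h4 : D (.term X u' U')) : Step Ax D (.termEq X u u' U')
  | var {X : PreCtx A} {i : ℕ} (hi : i < X.length)
      (h : D (.sort X (X[i]'hi).2)) :
      Step Ax D (.term X (.var (X[i]'hi).1) (X[i]'hi).2)
  | sA {X : PreCtx A} {U : SortE A} (hax : Judg.sort X U ∈ Ax) (h : D (.ctx X))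
      (hv : ∀ i (hi : i < X.length), D (.term X (.var (X[i]'hi).1) (X[i]'hi).2)) :
      Step Ax D (.sort X U)
  | tA {X : PreCtx A} {u : Expr A} {U : SortE A} (hax : Judg.term X u U ∈ Ax)
      (h : D (.sort X U))
      (hv : ∀ i (hi : i < X.length), D (.term X (.var (X[i]'hi).1) (X[i]'hi).2)) :
      Step Ax D (.term X u U)
  | seqA {X : PreCtx A} {U U' : SortE A} (hax : Judg.sortEq X U U' ∈ Ax)
      (h1 : D (.sort X U)) (h2 : D (.sort X U')) : Step Ax D (.sortEq X U U')
  | teqA {X : PreCtx A} {u u' : Expr A} {U : SortE A} (hax : Judg.termEq X u u' U ∈ Ax)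
      (h1 : D (.term X u U)) (h2 : D (.term X u' U)) : Step Ax D (.termEq X u u' U)
  | sSub {X : PreCtx A} {S : A.SortSym} (hax : introSort X S ∈ Ax)
      {Y : PreCtx A} (hY : IsPreCtx Y) {f : List (Expr A)} (hlen : f.length = X.length)
      (hJ : D (introSort X S)) (hYc : D (.ctx Y))
      (hargs : ∀ i (hi : i < X.length) (hif : i < f.length),
        D (.term Y (f[i]'hif) (subPre X f i hi))) :
      Step Ax D (.sort Y ⟨S, f⟩)
  | tSub {X : PreCtx A} {t : A.TermSym} {U : SortE A} (hax : introTerm X t U ∈ Ax)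
      {Y : PreCtx A} (hY : IsPreCtx Y) {f : List (Expr A)} (hlen : f.length = X.length)
      (hJ : D (introTerm X t U))
      (hU : D (.sort Y (U.substL (mkSub X f))))
      (hargs : ∀ i (hi : i < X.length) (hif : i < f.length),
        D (.term Y (f[i]'hif) (subPre X f i hi))) :
      Step Ax D (.term Y (.app t f) (U.substL (mkSub X f)))
  | seqSub1 {X : PreCtx A} {U U' : SortE A} (hax : Judg.sortEq X U U' ∈ Ax)
      {Y : PreCtx A} (hY : IsPreCtx Y) {f : List (Expr A)} (hlen : f.length = X.length)
      (hJ : D (.sortEq X U U'))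
      (h1 : D (.sort Y (U.substL (mkSub X f)))) (h2 : D (.sort Y (U'.substL (mkSub X f))))
      (hargs : ∀ i (hi : i < X.length) (hif : i < f.length),
        D (.term Y (f[i]'hif) (subPre X f i hi))) :
      Step Ax D (.sortEq Y (U.substL (mkSub X f)) (U'.substL (mkSub X f)))
  | seqSub2 {X : PreCtx A} {S : A.SortSym} (hax : introSort X S ∈ Ax)
      {Y : PreCtx A} (hY : IsPreCtx Y) {f g : List (Expr A)}
      (hlf : f.length = X.length) (hlg : g.length = X.length)
      (hJ : D (introSort X S))
      (h1 : D (.sort Y ⟨S, f⟩)) (h2 : D (.sort Y ⟨S, g⟩))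
      (hargs : ∀ i (hi : i < X.length) (hif : i < f.length) (hig : i < g.length),
        D (.termEq Y (f[i]'hif) (g[i]'hig) (subPre X f i hi))) :
      Step Ax D (.sortEq Y ⟨S, f⟩ ⟨S, g⟩)
  | teqSub1 {X : PreCtx A} {u u' : Expr A} {U : SortE A}
      (hax : Judg.termEq X u u' U ∈ Ax)
      {Y : PreCtx A} (hY : IsPreCtx Y) {f : List (Expr A)} (hlen : f.length = X.length)
      (hJ : D (.termEq X u u' U))
      (h1 : D (.term Y (u.substL (mkSub X f)) (U.substL (mkSub X f))))
      (h2 : D (.term Y (u'.substL (mkSub X f)) (U.substL (mkSub X f))))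
      (hargs : ∀ i (hi : i < X.length) (hif : i < f.length),
        D (.term Y (f[i]'hif) (subPre X f i hi))) :
      Step Ax D (.termEq Y (u.substL (mkSub X f)) (u'.substL (mkSub X f))
        (U.substL (mkSub X f)))
  | teqSub2 {X : PreCtx A} {t : A.TermSym} {U : SortE A} (hax : introTerm X t U ∈ Ax)
      {Y : PreCtx A} (hY : IsPreCtx Y) {f g : List (Expr A)}
      (hlf : f.length = X.length) (hlg : g.length = X.length)
      (hJ : D (introTerm X t U))
      (h1 : D (.term Y (.app t f) (U.substL (mkSub X f))))
      (h2 : D (.term Y (.app t g) (U.substL (mkSub X f))))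
      (hargs : ∀ i (hi : i < X.length) (hif : i < f.length) (hig : i < g.length),
        D (.termEq Y (f[i]'hif) (g[i]'hig) (subPre X f i hi))) :
      Step Ax D (.termEq Y (.app t f) (.app t g) (U.substL (mkSub X f)))

/-- `DerAt Ax n J`: `J` is the conclusion of an inference step in the `n`-th stage
`𝒟ₙ` of the recursive construction of the derivable judgments. -/
def DerAt (Ax : Set (Judg A)) : ℕ → Judg A → Prop
  | 0, _ => False
  | n + 1, J => DerAt Ax n J ∨ Step Ax (DerAt Ax n) J

/-- A judgment is derivable if it is the conclusion of a step of some stage. -/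
def Derivable (Ax : Set (Judg A)) (J : Judg A) : Prop := ∃ n, DerAt Ax n J

/-- The height of a (derivable) judgment: the least stage at which it appears. -/
noncomputable def ht (Ax : Set (Judg A)) (J : Judg A) : ℕ := sInf {n | DerAt Ax n J}

/-- The height of a context: `0` for the empty context, and the height of
`∂X ⊢ Xₙ sort` otherwise. -/
noncomputable def htCtx (Ax : Set (Judg A)) (X : PreCtx A) : ℕ :=
  match X with
  | [] => 0
  | p :: X' =>
      ht Ax (.sort ((p :: X').dropLast) (((p :: X').getLast (List.cons_ne_nil p X')).2))

/-- A generalized algebraic theory: a pretheory all of whose axioms are derivable. -/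
def IsGAT (Ax : Set (Judg A)) : Prop := IsPretheory Ax ∧ ∀ J ∈ Ax, Derivable Ax J

/-- The partial term judgment `X ⊢ u term` is derivable. -/
def DerTerm (Ax : Set (Judg A)) (X : PreCtx A) (u : Expr A) : Prop :=
  ∃ U, Derivable Ax (.term X u U)

/-- The partial term equality judgment `X ⊢ u ≡ v term` is derivable. -/
def DerTermEq (Ax : Set (Judg A)) (X : PreCtx A) (u v : Expr A) : Prop :=
  ∃ U, Derivable Ax (.termEq X u v U)

/-- Height of a derivable partial term judgment: the minimum of the heights of
`X ⊢ u : U` over all `U`. -/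
noncomputable def htTerm (Ax : Set (Judg A)) (X : PreCtx A) (u : Expr A) : ℕ :=
  sInf {n | ∃ U, DerAt Ax n (.term X u U)}

/-- `f` is a context morphism from `X` to `Y`. -/
def IsMor (Ax : Set (Judg A)) (X Y : PreCtx A) (f : List (Expr A)) : Prop :=
  Derivable Ax (.ctx X) ∧ Derivable Ax (.ctx Y) ∧ f.length = Y.length ∧
  ∀ i (hi : i < Y.length) (hif : i < f.length),
    Derivable Ax (.term X (f[i]'hif) (subPre Y f i hi))

/-- The morphism equality `f ≡ g : X → Y` is derivable. -/
def MorEq (Ax : Set (Judg A)) (X Y : PreCtx A) (f g : List (Expr A)) : Prop :=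
  IsMor Ax X Y f ∧ IsMor Ax X Y g ∧
  ∀ i (hi : i < Y.length) (hif : i < f.length) (hig : i < g.length),
    Derivable Ax (.termEq X (f[i]'hif) (g[i]'hig) (subPre Y f i hi))

/-- The context equality `X ≡ Y ctx` is derivable. -/
def CtxEq (Ax : Set (Judg A)) (X Y : PreCtx A) : Prop :=
  X.length = Y.length ∧ Derivable Ax (.ctx X) ∧ Derivable Ax (.ctx Y) ∧
  ∀ i (hX : i < X.length) (hY : i < Y.length),
    Derivable Ax (.sortEq (X.take i) (X[i]'hX).2
      (((Y[i]'hY).2).substL (mkSub (Y.take i) (ctxVars (X.take i)))))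

/-- Height of a context morphism. -/
noncomputable def htMor (Ax : Set (Judg A)) (X Y : PreCtx A) (f : List (Expr A)) : ℕ :=
  max (htCtx Ax X) (max (htCtx Ax Y)
    ((Finset.range Y.length).sup fun i =>
      if h : i < Y.length ∧ i < f.length then
        ht Ax (.term X (f[i]'h.2) (subPre Y f i h.1))
      else 0))

/-- Height of a morphism equality. -/
noncomputable def htMorEq (Ax : Set (Judg A)) (X Y : PreCtx A) (f g : List (Expr A)) : ℕ :=
  max (htMor Ax X Y f) (max (htMor Ax X Y g)
    ((Finset.range Y.length).sup fun i =>
      if h : i < Y.length ∧ i < f.length ∧ i < g.length then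
        ht Ax (.termEq X (f[i]'h.2.1) (g[i]'h.2.2) (subPre Y f i h.1))
      else 0))

/-- The composite `g ∘ f` of tuples of term expressions, where `f : X → Y` and
`g : Y → Z`: the `i`-th entry is `gᵢ[f]`. -/
noncomputable def compMor (Y : PreCtx A) (f g : List (Expr A)) : List (Expr A) :=
  g.map fun e => e.substL (mkSub Y f)

/-- The canonical sort `𝒮(u)` of a term in a context (as a relation). -/
inductive CanonSort (Ax : Set (Judg A)) (X : PreCtx A) : Expr A → SortE A → Prop where
  | var {i : ℕ} (hi : i < X.length) : CanonSort Ax X (.var (X[i]'hi).1) (X[i]'hi).2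
  | app {t : A.TermSym} {f : List (Expr A)} {Xa : PreCtx A} {V : SortE A}
      (hax : introTerm Xa t V ∈ Ax) :
      CanonSort Ax X (.app t f) (V.substL (mkSub Xa f))


/-! ## The tensor product of generalized algebraic theories (§2 of the paper) -/

/-- The tensor product of two sort-and-term alphabets. -/
abbrev Alphabet.tensor (A B : Alphabet) : Alphabet :=
  { Var := A.Var × B.Var
    SortSym := A.SortSym × B.SortSym
    TermSym := (A.SortSym × B.TermSym) ⊕ (A.TermSym × B.SortSym)
    var_infinite := inferInstance
    var_countable := inferInstance }

/-- An input for the tensor term operations `⊗_t`, `●_t`: a derivable term judgment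
`X ⊢ u : U` (notation `u^U`), or an augmented derivable sort judgment
`(X ⊢ U sort, x)` (notation `x^U`), represented with `tm = var x`. -/
structure TArg (A : Alphabet) : Type where
  ctx : PreCtx A
  tm : Expr A
  srt : SortE A

/-- `L` is the lexicographically ordered `m × n` grid whose `(i,j)` entry is `M i j`. -/
def IsGrid {γ : Type} (m n : ℕ) (M : ℕ → ℕ → γ) (L : List γ) : Prop :=
  L.length = m * n ∧
  ∀ i j (hi : i < m) (hj : j < n) (h : i * n + j < L.length), L[i * n + j]'h = M i j

/-- Substitution pairs `[g 1 | x y₁, …, g n | x yₙ]` where the `yⱼ` are the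
variables of `Y`. -/
def pairsR (x : A.Var) (Y : PreCtx B) (g : ℕ → Expr (A.tensor B)) :
    List ((A.tensor B).Var × Expr (A.tensor B)) :=
  (List.finRange Y.length).map fun j => ((x, (Y.get j).1), g j.1)

/-- Substitution pairs `[g 1 | x₁ y, …, g m | x_m y]` where the `xᵢ` are the
variables of `X`. -/
def pairsL (X : PreCtx A) (y : B.Var) (g : ℕ → Expr (A.tensor B)) :
    List ((A.tensor B).Var × Expr (A.tensor B)) :=
  (List.finRange X.length).map fun i => (((X.get i).1, y), g i.1)

variable {A B : Alphabet}

/-- The graph of the tensor term operation on pairs of (augmented sort / term)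
judgments: `TTg TA TB false a b e` means `e = a ⊗_t b` and
`TTg TA TB true a b e` means `e = a ⊗*_t b` (the variant of §8 in which the two
defining substitution formulas for non-variable terms are interchanged). -/
inductive TTg (TA : Set (Judg A)) (TB : Set (Judg B)) :
    Bool → TArg A → TArg B → Expr (A.tensor B) → Prop where
  | varvar {b : Bool} {X : PreCtx A} {U : SortE A} {x : A.Var}
      {Y : PreCtx B} {V : SortE B} {y : B.Var} :
      TTg TA TB b ⟨X, .var x, U⟩ ⟨Y, .var y, V⟩ (.var (x, y))
  | varapp {b : Bool} {X : PreCtx A} {x : A.Var} {S : A.SortSym} {ss : List (Expr A)}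
      {Y : PreCtx B} {t : B.TermSym} {ts : List (Expr B)} {V : SortE B}
      (SS : ℕ → SortE A) (TSf : ℕ → SortE B)
      (hSS : ∀ i (hi : i < ss.length), CanonSort TA X (ss[i]'hi) (SS i))
      (hTS : ∀ j (hj : j < ts.length), CanonSort TB Y (ts[j]'hj) (TSf j))
      (M : ℕ → ℕ → Expr (A.tensor B)) (out : List (Expr (A.tensor B)))
      (hM : ∀ i (hi : i < ss.length), ∀ j (hj : j < ts.length),
          TTg TA TB b ⟨X, ss[i]'hi, SS i⟩ ⟨Y, ts[j]'hj, TSf j⟩ (M i j))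
      (hMx : ∀ j (hj : j < ts.length),
          TTg TA TB b ⟨X, .var x, ⟨S, ss⟩⟩ ⟨Y, ts[j]'hj, TSf j⟩ (M ss.length j))
      (hout : IsGrid (ss.length + 1) ts.length M out) :
      TTg TA TB b ⟨X, .var x, ⟨S, ss⟩⟩ ⟨Y, .app t ts, V⟩ (.app (Sum.inl (S, t)) out)
  | appvar {b : Bool} {X : PreCtx A} {s : A.TermSym} {ss : List (Expr A)} {U : SortE A}
      {Y : PreCtx B} {y : B.Var} {T : B.SortSym} {ts : List (Expr B)}
      (SS : ℕ → SortE A) (TSf : ℕ → SortE B)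
      (hSS : ∀ i (hi : i < ss.length), CanonSort TA X (ss[i]'hi) (SS i))
      (hTS : ∀ j (hj : j < ts.length), CanonSort TB Y (ts[j]'hj) (TSf j))
      (M : ℕ → ℕ → Expr (A.tensor B)) (out : List (Expr (A.tensor B)))
      (hM : ∀ i (hi : i < ss.length), ∀ j (hj : j < ts.length),
          TTg TA TB b ⟨X, ss[i]'hi, SS i⟩ ⟨Y, ts[j]'hj, TSf j⟩ (M i j))
      (hMy : ∀ i (hi : i < ss.length),
          TTg TA TB b ⟨X, ss[i]'hi, SS i⟩ ⟨Y, .var y, ⟨T, ts⟩⟩ (M i ts.length))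
      (hout : IsGrid ss.length (ts.length + 1) M out) :
      TTg TA TB b ⟨X, .app s ss, U⟩ ⟨Y, .var y, ⟨T, ts⟩⟩ (.app (Sum.inr (s, T)) out)
  | appapp_base {X : PreCtx A} {s : A.TermSym} {ss : List (Expr A)} {U : SortE A}
      {Y : PreCtx B} {t : B.TermSym} {ts : List (Expr B)} {V : SortE B} {x : A.Var}
      (hx : ∀ p ∈ X, p.1 ≠ x)
      (e0 : Expr (A.tensor B))
      (h0 : TTg TA TB false ⟨X, .var x, U⟩ ⟨Y, .app t ts, V⟩ e0)
      (g : ℕ → Expr (A.tensor B))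
      (hg : ∀ j (hj : j < Y.length),
          TTg TA TB false ⟨X, .app s ss, U⟩
            ⟨Y.take j, .var (Y[j]'hj).1, (Y[j]'hj).2⟩ (g j)) :
      TTg TA TB false ⟨X, .app s ss, U⟩ ⟨Y, .app t ts, V⟩ (e0.substL (pairsR x Y g))
  | appapp_star {X : PreCtx A} {s : A.TermSym} {ss : List (Expr A)} {U : SortE A}
      {Y : PreCtx B} {t : B.TermSym} {ts : List (Expr B)} {V : SortE B} {y : B.Var}
      (hy : ∀ p ∈ Y, p.1 ≠ y)
      (e0 : Expr (A.tensor B))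
      (h0 : TTg TA TB true ⟨X, .app s ss, U⟩ ⟨Y, .var y, V⟩ e0)
      (g : ℕ → Expr (A.tensor B))
      (hg : ∀ i (hi : i < X.length),
          TTg TA TB true ⟨X.take i, .var (X[i]'hi).1, (X[i]'hi).2⟩
            ⟨Y, .app t ts, V⟩ (g i)) :
      TTg TA TB true ⟨X, .app s ss, U⟩ ⟨Y, .app t ts, V⟩ (e0.substL (pairsL X y g))

/-- The graph of the operation `●_t` (flag `false`), resp. of `●*_t` (flag `true`). -/
inductive TTd (TA : Set (Judg A)) (TB : Set (Judg B)) :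
    Bool → TArg A → TArg B → Expr (A.tensor B) → Prop where
  | varL {b : Bool} {X : PreCtx A} {x : A.Var} {U : SortE A} {bArg : TArg B}
      {e : Expr (A.tensor B)}
      (h : TTg TA TB b ⟨X, .var x, U⟩ bArg e) : TTd TA TB b ⟨X, .var x, U⟩ bArg e
  | varR {b : Bool} {aArg : TArg A} {Y : PreCtx B} {y : B.Var} {V : SortE B}
      {e : Expr (A.tensor B)}
      (h : TTg TA TB b aArg ⟨Y, .var y, V⟩ e) : TTd TA TB b aArg ⟨Y, .var y, V⟩ e
  | appapp_base {X : PreCtx A} {s : A.TermSym} {ss : List (Expr A)} {U : SortE A}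
      {Y : PreCtx B} {t : B.TermSym} {ts : List (Expr B)} {V : SortE B} {y : B.Var}
      (hy : ∀ p ∈ Y, p.1 ≠ y)
      (e0 : Expr (A.tensor B))
      (h0 : TTg TA TB false ⟨X, .app s ss, U⟩ ⟨Y, .var y, V⟩ e0)
      (g : ℕ → Expr (A.tensor B))
      (hg : ∀ i (hi : i < X.length),
          TTg TA TB false ⟨X.take i, .var (X[i]'hi).1, (X[i]'hi).2⟩
            ⟨Y, .app t ts, V⟩ (g i)) :
      TTd TA TB false ⟨X, .app s ss, U⟩ ⟨Y, .app t ts, V⟩ (e0.substL (pairsL X y g))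
  | appapp_star {X : PreCtx A} {s : A.TermSym} {ss : List (Expr A)} {U : SortE A}
      {Y : PreCtx B} {t : B.TermSym} {ts : List (Expr B)} {V : SortE B} {x : A.Var}
      (hx : ∀ p ∈ X, p.1 ≠ x)
      (e0 : Expr (A.tensor B))
      (h0 : TTg TA TB true ⟨X, .var x, U⟩ ⟨Y, .app t ts, V⟩ e0)
      (g : ℕ → Expr (A.tensor B))
      (hg : ∀ j (hj : j < Y.length),
          TTg TA TB true ⟨X, .app s ss, U⟩
            ⟨Y.take j, .var (Y[j]'hj).1, (Y[j]'hj).2⟩ (g j)) :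
      TTd TA TB true ⟨X, .app s ss, U⟩ ⟨Y, .app t ts, V⟩ (e0.substL (pairsR x Y g))

/-- The graph of the tensor sort operation `⊗_s` (resp. `⊗*_s` for flag `true`):
`TSo TA TB b X x U Y y V W` means `W = U^x ⊗ V^y`. -/
inductive TSo (TA : Set (Judg A)) (TB : Set (Judg B)) :
    Bool → PreCtx A → A.Var → SortE A → PreCtx B → B.Var → SortE B →
    SortE (A.tensor B) → Prop where
  | mk {b : Bool} {X : PreCtx A} {x : A.Var} {S : A.SortSym} {ss : List (Expr A)}
      {Y : PreCtx B} {y : B.Var} {T : B.SortSym} {ts : List (Expr B)}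
      (hx : ∀ p ∈ X, p.1 ≠ x) (hy : ∀ p ∈ Y, p.1 ≠ y)
      (SS : ℕ → SortE A) (TSf : ℕ → SortE B)
      (hSS : ∀ i (hi : i < ss.length), CanonSort TA X (ss[i]'hi) (SS i))
      (hTS : ∀ j (hj : j < ts.length), CanonSort TB Y (ts[j]'hj) (TSf j))
      (M : ℕ → ℕ → Expr (A.tensor B)) (out : List (Expr (A.tensor B)))
      (hM : ∀ i (hi : i < ss.length), ∀ j (hj : j < ts.length),
          TTg TA TB b ⟨X, ss[i]'hi, SS i⟩ ⟨Y, ts[j]'hj, TSf j⟩ (M i j))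
      (hMx : ∀ j (hj : j < ts.length),
          TTg TA TB b ⟨X, .var x, ⟨S, ss⟩⟩ ⟨Y, ts[j]'hj, TSf j⟩ (M ss.length j))
      (hMy : ∀ i (hi : i < ss.length),
          TTg TA TB b ⟨X, ss[i]'hi, SS i⟩ ⟨Y, .var y, ⟨T, ts⟩⟩ (M i ts.length))
      (hout : IsGrid (ss.length + 1) (ts.length + 1) M out) :
      TSo TA TB b X x ⟨S, ss⟩ Y y ⟨T, ts⟩ ⟨(S, T), out.dropLast⟩

/-- The tensor precontext `Z = X ⊗ Y`, with entries `xᵢyⱼ : Xᵢ ⊗ Yⱼ` ordered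
lexicographically. -/
def TCtx (TA : Set (Judg A)) (TB : Set (Judg B)) (b : Bool)
    (X : PreCtx A) (Y : PreCtx B) (Z : PreCtx (A.tensor B)) : Prop :=
  Z.length = X.length * Y.length ∧
  ∀ i j (hi : i < X.length) (hj : j < Y.length) (h : i * Y.length + j < Z.length),
    (Z[i * Y.length + j]'h).1 = ((X[i]'hi).1, (Y[j]'hj).1) ∧
    TSo TA TB b (X.take i) (X[i]'hi).1 (X[i]'hi).2
      (Y.take j) (Y[j]'hj).1 (Y[j]'hj).2 (Z[i * Y.length + j]'h).2

/-- The graph of the tensor operation `⊙` on pairs of judgments of the admissible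
kinds of Table 1 (flag `false`), resp. of the interchanged operation `⊙*` of §8
(flag `true`).  `chA` and `chB` are the functions choosing, for each context, a
variable not occurring in it. -/
inductive TJudg (TA : Set (Judg A)) (TB : Set (Judg B))
    (chA : PreCtx A → A.Var) (chB : PreCtx B → B.Var) :
    Bool → Judg A → Judg B → Judg (A.tensor B) → Prop where
  /- sort ⊙ sort -/
  | ss {b : Bool} {X : PreCtx A} {U : SortE A} {Y : PreCtx B} {V : SortE B}
      {Z : PreCtx (A.tensor B)} {W : SortE (A.tensor B)}
      (hZ : TCtx TA TB b (X ++ [(chA X, U)]) (Y ++ [(chB Y, V)]) Z)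
      (hW : TSo TA TB b X (chA X) U Y (chB Y) V W) :
      TJudg TA TB chA chB b (.sort X U) (.sort Y V) (.sort Z.dropLast W)
  /- sort ⊙ term -/
  | st {b : Bool} {X : PreCtx A} {U : SortE A} {Y : PreCtx B} {v : Expr B} {V : SortE B}
      {Z : PreCtx (A.tensor B)} {e : Expr (A.tensor B)} {W : SortE (A.tensor B)}
      {g : ℕ → Expr (A.tensor B)}
      (hZ : TCtx TA TB b (X ++ [(chA X, U)]) Y Z)
      (he : TTg TA TB b ⟨X, .var (chA X), U⟩ ⟨Y, v, V⟩ e)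
      (hW : TSo TA TB b X (chA X) U Y (chB Y) V W)
      (hg : ∀ i (hi : i < X.length),
          TTg TA TB b ⟨X.take i, .var (X[i]'hi).1, (X[i]'hi).2⟩ ⟨Y, v, V⟩ (g i)) :
      TJudg TA TB chA chB b (.sort X U) (.term Y v V)
        (.term Z e (W.substL (pairsL X (chB Y) g)))
  /- term ⊙ sort -/
  | ts {b : Bool} {X : PreCtx A} {u : Expr A} {U : SortE A} {Y : PreCtx B} {V : SortE B}
      {Z : PreCtx (A.tensor B)} {e : Expr (A.tensor B)} {W : SortE (A.tensor B)}
      {g : ℕ → Expr (A.tensor B)}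
      (hZ : TCtx TA TB b X (Y ++ [(chB Y, V)]) Z)
      (he : TTg TA TB b ⟨X, u, U⟩ ⟨Y, .var (chB Y), V⟩ e)
      (hW : TSo TA TB b X (chA X) U Y (chB Y) V W)
      (hg : ∀ j (hj : j < Y.length),
          TTg TA TB b ⟨X, u, U⟩ ⟨Y.take j, .var (Y[j]'hj).1, (Y[j]'hj).2⟩ (g j)) :
      TJudg TA TB chA chB b (.term X u U) (.sort Y V)
        (.term Z e (W.substL (pairsR (chA X) Y g)))
  /- term ⊙ term -/
  | tt {b : Bool} {X : PreCtx A} {u : Expr A} {U : SortE A}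
      {Y : PreCtx B} {v : Expr B} {V : SortE B}
      {Z : PreCtx (A.tensor B)} {e1 e2 : Expr (A.tensor B)} {W : SortE (A.tensor B)}
      {gx gy : ℕ → Expr (A.tensor B)}
      (hZ : TCtx TA TB b X Y Z)
      (he1 : TTg TA TB b ⟨X, u, U⟩ ⟨Y, v, V⟩ e1)
      (he2 : TTd TA TB b ⟨X, u, U⟩ ⟨Y, v, V⟩ e2)
      (hW : TSo TA TB b X (chA X) U Y (chB Y) V W)
      (hgx : ∀ i (hi : i < X.length),
          TTg TA TB b ⟨X.take i, .var (X[i]'hi).1, (X[i]'hi).2⟩ ⟨Y, v, V⟩ (gx i))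
      (hgy : ∀ j (hj : j < Y.length),
          TTg TA TB b ⟨X, u, U⟩ ⟨Y.take j, .var (Y[j]'hj).1, (Y[j]'hj).2⟩ (gy j)) :
      TJudg TA TB chA chB b (.term X u U) (.term Y v V)
        (.termEq Z e1 e2 (W.substL (pairsL X (chB Y) gx ++ pairsR (chA X) Y gy)))
  /- sort ⊙ sort equality -/
  | sseq {b : Bool} {X : PreCtx A} {U : SortE A} {Y : PreCtx B} {V V' : SortE B}
      {Z : PreCtx (A.tensor B)} {W W' : SortE (A.tensor B)}
      (hZ : TCtx TA TB b (X ++ [(chA X, U)]) (Y ++ [(chB Y, V)]) Z)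
      (hW : TSo TA TB b X (chA X) U Y (chB Y) V W)
      (hW' : TSo TA TB b X (chA X) U Y (chB Y) V' W') :
      TJudg TA TB chA chB b (.sort X U) (.sortEq Y V V') (.sortEq Z.dropLast W W')
  /- sort equality ⊙ sort -/
  | seqs {b : Bool} {X : PreCtx A} {U U' : SortE A} {Y : PreCtx B} {V : SortE B}
      {Z : PreCtx (A.tensor B)} {W W' : SortE (A.tensor B)}
      (hZ : TCtx TA TB b (X ++ [(chA X, U)]) (Y ++ [(chB Y, V)]) Z)
      (hW : TSo TA TB b X (chA X) U Y (chB Y) V W)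
      (hW' : TSo TA TB b X (chA X) U' Y (chB Y) V W') :
      TJudg TA TB chA chB b (.sortEq X U U') (.sort Y V) (.sortEq Z.dropLast W W')
  /- sort ⊙ term equality -/
  | steq {b : Bool} {X : PreCtx A} {U : SortE A} {Y : PreCtx B} {v v' : Expr B}
      {V : SortE B} {Z : PreCtx (A.tensor B)} {e e' : Expr (A.tensor B)}
      {W : SortE (A.tensor B)} {g : ℕ → Expr (A.tensor B)}
      (hZ : TCtx TA TB b (X ++ [(chA X, U)]) Y Z)
      (he : TTg TA TB b ⟨X, .var (chA X), U⟩ ⟨Y, v, V⟩ e)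
      (he' : TTg TA TB b ⟨X, .var (chA X), U⟩ ⟨Y, v', V⟩ e')
      (hW : TSo TA TB b X (chA X) U Y (chB Y) V W)
      (hg : ∀ i (hi : i < X.length),
          TTg TA TB b ⟨X.take i, .var (X[i]'hi).1, (X[i]'hi).2⟩ ⟨Y, v, V⟩ (g i)) :
      TJudg TA TB chA chB b (.sort X U) (.termEq Y v v' V)
        (.termEq Z e e' (W.substL (pairsL X (chB Y) g)))
  /- term equality ⊙ sort -/
  | teqs {b : Bool} {X : PreCtx A} {u u' : Expr A} {U : SortE A} {Y : PreCtx B}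
      {V : SortE B} {Z : PreCtx (A.tensor B)} {e e' : Expr (A.tensor B)}
      {W : SortE (A.tensor B)} {g : ℕ → Expr (A.tensor B)}
      (hZ : TCtx TA TB b X (Y ++ [(chB Y, V)]) Z)
      (he : TTg TA TB b ⟨X, u, U⟩ ⟨Y, .var (chB Y), V⟩ e)
      (he' : TTg TA TB b ⟨X, u', U⟩ ⟨Y, .var (chB Y), V⟩ e')
      (hW : TSo TA TB b X (chA X) U Y (chB Y) V W)
      (hg : ∀ j (hj : j < Y.length),
          TTg TA TB b ⟨X, u, U⟩ ⟨Y.take j, .var (Y[j]'hj).1, (Y[j]'hj).2⟩ (g j)) :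
      TJudg TA TB chA chB b (.termEq X u u' U) (.sort Y V)
        (.termEq Z e e' (W.substL (pairsR (chA X) Y g)))
  /- sort equality ⊙ term -/
  | seqt {b : Bool} {X : PreCtx A} {U U' : SortE A} {Y : PreCtx B} {v : Expr B}
      {V : SortE B} {Z : PreCtx (A.tensor B)} {e e' : Expr (A.tensor B)}
      {W : SortE (A.tensor B)} {g : ℕ → Expr (A.tensor B)}
      (hZ : TCtx TA TB b (X ++ [(chA X, U)]) Y Z)
      (he : TTg TA TB b ⟨X, .var (chA X), U⟩ ⟨Y, v, V⟩ e)
      (he' : TTg TA TB b ⟨X, .var (chA X), U'⟩ ⟨Y, v, V⟩ e')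
      (hW : TSo TA TB b X (chA X) U Y (chB Y) V W)
      (hg : ∀ i (hi : i < X.length),
          TTg TA TB b ⟨X.take i, .var (X[i]'hi).1, (X[i]'hi).2⟩ ⟨Y, v, V⟩ (g i)) :
      TJudg TA TB chA chB b (.sortEq X U U') (.term Y v V)
        (.termEq Z e e' (W.substL (pairsL X (chB Y) g)))
  /- term ⊙ sort equality -/
  | tseq {b : Bool} {X : PreCtx A} {u : Expr A} {U : SortE A} {Y : PreCtx B}
      {V V' : SortE B} {Z : PreCtx (A.tensor B)} {e e' : Expr (A.tensor B)}
      {W : SortE (A.tensor B)} {g : ℕ → Expr (A.tensor B)}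
      (hZ : TCtx TA TB b X (Y ++ [(chB Y, V)]) Z)
      (he : TTg TA TB b ⟨X, u, U⟩ ⟨Y, .var (chB Y), V⟩ e)
      (he' : TTg TA TB b ⟨X, u, U⟩ ⟨Y, .var (chB Y), V'⟩ e')
      (hW : TSo TA TB b X (chA X) U Y (chB Y) V W)
      (hg : ∀ j (hj : j < Y.length),
          TTg TA TB b ⟨X, u, U⟩ ⟨Y.take j, .var (Y[j]'hj).1, (Y[j]'hj).2⟩ (g j)) :
      TJudg TA TB chA chB b (.term X u U) (.sortEq Y V V')
        (.termEq Z e e' (W.substL (pairsR (chA X) Y g)))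

/-- A choice, for every precontext, of a variable not contained in it. -/
def FreshCh {A : Alphabet} (ch : PreCtx A → A.Var) : Prop :=
  ∀ X : PreCtx A, ∀ p ∈ X, p.1 ≠ ch X

/-- The set of axioms of the pretheory `𝔸 ⊗ 𝔹`: the judgments `J ⊙ J'` for `J` an
axiom of `𝔸` and `J'` an axiom of `𝔹`. -/
def tensorAx (TA : Set (Judg A)) (TB : Set (Judg B))
    (chA : PreCtx A → A.Var) (chB : PreCtx B → B.Var) : Set (Judg (A.tensor B)) :=
  {K | ∃ J J', J ∈ TA ∧ J' ∈ TB ∧ TJudg TA TB chA chB false J J' K}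

/-- The pair `(𝔸, 𝔹)` is `h`-derivable: `J ⊙ J'` is derivable in the pretheory
`𝔸 ⊗ 𝔹` whenever `J`, `J'` are derivable judgments of `𝔸`, `𝔹` (of admissible
kinds) with `ht J * ht J' ≤ h`. -/
def hDerivable (TA : Set (Judg A)) (TB : Set (Judg B))
    (chA : PreCtx A → A.Var) (chB : PreCtx B → B.Var) (h : ℕ) : Prop :=
  ∀ (J : Judg A) (J' : Judg B) (K : Judg (A.tensor B)),
    Derivable TA J → Derivable TB J' → ht TA J * ht TB J' ≤ h →
    TJudg TA TB chA chB false J J' K → Derivable (tensorAx TA TB chA chB) K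

/-- The tensor `out = f ⊗ g` of two tuples of derivable terms, each entry being
the tensor of terms taken at their canonical sorts, ordered lexicographically. -/
def TMor (TA : Set (Judg A)) (TB : Set (Judg B)) (b : Bool)
    (X : PreCtx A) (f : List (Expr A)) (Y : PreCtx B) (g : List (Expr B))
    (out : List (Expr (A.tensor B))) : Prop :=
  out.length = f.length * g.length ∧
  ∀ i j (hi : i < f.length) (hj : j < g.length) (h : i * g.length + j < out.length),
    ∃ U V, CanonSort TA X (f[i]'hi) U ∧ CanonSort TB Y (g[j]'hj) V ∧
      TTg TA TB b ⟨X, f[i]'hi, U⟩ ⟨Y, g[j]'hj, V⟩ (out[i * g.length + j]'h)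

/-- The tensor `out = f ⊗ Y` of a tuple of derivable terms of `𝔸` with a context
of `𝔹`: entries `fᵢ^{𝒮(fᵢ)} ⊗ yⱼ^{Yⱼ}`. -/
def TMorCtx (TA : Set (Judg A)) (TB : Set (Judg B)) (b : Bool)
    (X : PreCtx A) (f : List (Expr A)) (Y : PreCtx B)
    (out : List (Expr (A.tensor B))) : Prop :=
  out.length = f.length * Y.length ∧
  ∀ i j (hi : i < f.length) (hj : j < Y.length) (h : i * Y.length + j < out.length),
    ∃ U, CanonSort TA X (f[i]'hi) U ∧
      TTg TA TB b ⟨X, f[i]'hi, U⟩ ⟨Y.take j, .var (Y[j]'hj).1, (Y[j]'hj).2⟩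
        (out[i * Y.length + j]'h)

/-- The tensor `out = X ⊗ g` of a context of `𝔸` with a tuple of derivable terms
of `𝔹`: entries `xᵢ^{Xᵢ} ⊗ gⱼ^{𝒮(gⱼ)}`. -/
def TCtxMor (TA : Set (Judg A)) (TB : Set (Judg B)) (b : Bool)
    (X : PreCtx A) (Y : PreCtx B) (g : List (Expr B))
    (out : List (Expr (A.tensor B))) : Prop :=
  out.length = X.length * g.length ∧
  ∀ i j (hi : i < X.length) (hj : j < g.length) (h : i * g.length + j < out.length),
    ∃ V, CanonSort TB Y (g[j]'hj) V ∧
      TTg TA TB b ⟨X.take i, .var (X[i]'hi).1, (X[i]'hi).2⟩ ⟨Y, g[j]'hj, V⟩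
        (out[i * g.length + j]'h)

/-- The tensor `out = (x₁,…,x_m,u^U) ⊗ Y` of the section determined by a term
`X ⊢ u : U` with a context of `𝔹`. -/
def TSecL (TA : Set (Judg A)) (TB : Set (Judg B)) (b : Bool)
    (X : PreCtx A) (u : Expr A) (U : SortE A) (Y : PreCtx B)
    (out : List (Expr (A.tensor B))) : Prop :=
  out.length = (X.length + 1) * Y.length ∧
  (∀ i j (hi : i < X.length) (hj : j < Y.length) (h : i * Y.length + j < out.length),
      TTg TA TB b ⟨X.take i, .var (X[i]'hi).1, (X[i]'hi).2⟩
        ⟨Y.take j, .var (Y[j]'hj).1, (Y[j]'hj).2⟩ (out[i * Y.length + j]'h)) ∧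
  (∀ j (hj : j < Y.length) (h : X.length * Y.length + j < out.length),
      TTg TA TB b ⟨X, u, U⟩ ⟨Y.take j, .var (Y[j]'hj).1, (Y[j]'hj).2⟩
        (out[X.length * Y.length + j]'h))

/-- The tensor `out = X ⊗ (y₁,…,yₙ,v^V)` of a context of `𝔸` with the section
determined by a term `Y ⊢ v : V` of `𝔹`. -/
def TSecR (TA : Set (Judg A)) (TB : Set (Judg B)) (b : Bool)
    (X : PreCtx A) (Y : PreCtx B) (v : Expr B) (V : SortE B)
    (out : List (Expr (A.tensor B))) : Prop :=
  out.length = X.length * (Y.length + 1) ∧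
  (∀ i j (hi : i < X.length) (hj : j < Y.length)
      (h : i * (Y.length + 1) + j < out.length),
      TTg TA TB b ⟨X.take i, .var (X[i]'hi).1, (X[i]'hi).2⟩
        ⟨Y.take j, .var (Y[j]'hj).1, (Y[j]'hj).2⟩ (out[i * (Y.length + 1) + j]'h)) ∧
  (∀ i (hi : i < X.length) (h : i * (Y.length + 1) + Y.length < out.length),
      TTg TA TB b ⟨X.take i, .var (X[i]'hi).1, (X[i]'hi).2⟩ ⟨Y, v, V⟩
        (out[i * (Y.length + 1) + Y.length]'h))

/-! ## Substitution -/

@[simp] theorem Expr.subst_var_eq (σ : A.Var → Expr A) (x : A.Var) :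
    (Expr.var x).subst σ = σ x := by
  rw [Expr.subst]

@[simp] theorem Expr.subst_app_eq (σ : A.Var → Expr A) (t : A.TermSym) (es : List (Expr A)) :
    (Expr.app t es).subst σ = .app t (es.map (Expr.subst σ)) := by
  rw [Expr.subst]
  simp

theorem Expr.ind {P : Expr A → Prop} (var : ∀ x, P (.var x))
    (app : ∀ t es, (∀ e ∈ es, P e) → P (.app t es)) (e : Expr A) : P e :=
  match e with
  | .var x => var x
  | .app t es => app t es fun e he => Expr.ind var app e
termination_by sizeOf e
decreasing_by
  have := List.sizeOf_lt_of_mem he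
  simp only [Expr.app.sizeOf_spec]
  omega

theorem occurs_var_iff {x y : A.Var} : Occurs x (Expr.var y) ↔ x = y := by
  constructor
  · rintro ⟨⟩; rfl
  · rintro rfl; exact .var

theorem occurs_app_iff {x : A.Var} {t : A.TermSym} {es : List (Expr A)} :
    Occurs x (Expr.app t es) ↔ ∃ e ∈ es, Occurs x e := by
  constructor
  · intro h
    cases h with
    | app h1 h2 => exact ⟨_, h1, h2⟩
  · rintro ⟨e, h1, h2⟩
    exact .app h1 h2

theorem Expr.subst_congr {σ θ : A.Var → Expr A} (e : Expr A)
    (h : ∀ z, Occurs z e → σ z = θ z) : e.subst σ = e.subst θ := by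
  induction e using Expr.ind with
  | var x => simpa using h x .var
  | app t es ih =>
    simp only [Expr.subst_app_eq, Expr.app.injEq, true_and]
    exact List.map_congr_left fun e he => ih e he fun z hz => h z (.app he hz)

theorem Expr.subst_subst (σ θ : A.Var → Expr A) (e : Expr A) :
    (e.subst σ).subst θ = e.subst fun z => (σ z).subst θ := by
  induction e using Expr.ind with
  | var x => simp
  | app t es ih => simpa using ih

theorem Expr.subst_var_self (e : Expr A) : e.subst Expr.var = e := by
  induction e using Expr.ind with
  | var x => simp
  | app t es ih =>
    simp only [Expr.subst_app_eq, Expr.app.injEq, true_and]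
    exact (List.map_congr_left ih).trans (List.map_id' es)

theorem Expr.exists_of_occurs_subst {σ : A.Var → Expr A} {z : A.Var} (e : Expr A)
    (h : Occurs z (e.subst σ)) : ∃ w, Occurs w e ∧ Occurs z (σ w) := by
  induction e using Expr.ind with
  | var x => exact ⟨x, .var, by simpa using h⟩
  | app t es ih =>
    rw [Expr.subst_app_eq, occurs_app_iff] at h
    obtain ⟨e', he', hz⟩ := h
    obtain ⟨e, he, rfl⟩ := List.mem_map.1 he'
    obtain ⟨w, hw, hz⟩ := ih e he hz
    exact ⟨w, .app he hw, hz⟩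

theorem SortE.ext' {U V : SortE A} (h1 : U.head = V.head) (h2 : U.args = V.args) : U = V := by
  cases U; cases V; simp_all

theorem SortE.subst_congr {σ θ : A.Var → Expr A} (U : SortE A)
    (h : ∀ z, SOccurs z U → σ z = θ z) : U.subst σ = U.subst θ :=
  SortE.ext' rfl (List.map_congr_left fun e he => e.subst_congr fun z hz => h z ⟨e, he, hz⟩)

theorem SortE.subst_subst (σ θ : A.Var → Expr A) (U : SortE A) :
    (U.subst σ).subst θ = U.subst fun z => (σ z).subst θ :=
  SortE.ext' rfl (by simp [SortE.subst, Expr.subst_subst])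

theorem SortE.subst_var_self (U : SortE A) : U.subst Expr.var = U :=
  SortE.ext' rfl ((List.map_congr_left fun e _ => e.subst_var_self).trans (List.map_id' _))

/-- The names of the variables of a precontext. -/
abbrev names (X : PreCtx A) : List A.Var := X.map Prod.fst

theorem names_take_subset {X : PreCtx A} {i : ℕ} {x : A.Var} (h : x ∈ names (X.take i)) :
    x ∈ names X := by
  rw [names, List.map_take] at h
  exact List.mem_of_mem_take h

theorem lookupV_cases (ps : List (A.Var × Expr A)) (x : A.Var) :
    (∃ p ∈ ps, p.1 = x ∧ lookupV ps x = p.2) ∨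
      ((∀ p ∈ ps, p.1 ≠ x) ∧ lookupV ps x = .var x) := by
  induction ps with
  | nil => simp [lookupV]
  | cons p ps ih =>
    by_cases h : p.1 = x
    · exact .inl ⟨p, by simp, h, by simp [lookupV, h]⟩
    · simp only [lookupV, if_neg h, List.mem_cons]
      rcases ih with ⟨q, h1, h2⟩ | ⟨h1, h2⟩
      · exact .inl ⟨q, .inr h1, h2⟩
      · exact .inr ⟨fun q hq => hq.elim (fun e => e ▸ h) (h1 q), h2⟩

theorem lookupV_of_notMem {ps : List (A.Var × Expr A)} {x : A.Var} (h : ∀ p ∈ ps, p.1 ≠ x) :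
    lookupV ps x = .var x := by
  rcases lookupV_cases ps x with ⟨p, h1, h2, _⟩ | ⟨_, h2⟩
  · exact absurd h2 (h p h1)
  · exact h2

theorem lookupV_mkSub_map (σ : A.Var → Expr A) (X : PreCtx A) {z : A.Var} (hz : z ∈ names X) :
    lookupV (mkSub X (X.map fun p => σ p.1)) z = σ z := by
  induction X with
  | nil => simp at hz
  | cons p X ih =>
    by_cases h : p.1 = z
    · simp [mkSub, lookupV, h]
    · have : z ∈ names X := by
        simp only [names, List.map_cons, List.mem_cons] at hz
        exact hz.resolve_left fun e => h e.symm
      simpa [mkSub, lookupV, h] using ih this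

theorem lookupV_mkSub_subst (σ : A.Var → Expr A) (X : PreCtx A) (f : List (Expr A))
    (hf : f.length = X.length) {z : A.Var} (hz : z ∈ names X) :
    lookupV (mkSub X (f.map (Expr.subst σ))) z = (lookupV (mkSub X f) z).subst σ := by
  induction X generalizing f with
  | nil => simp at hz
  | cons p X ih =>
    obtain _ | ⟨e, f⟩ := f
    · simp at hf
    by_cases h : p.1 = z
    · simp [mkSub, lookupV, h]
    · have : z ∈ names X := by
        simp only [names, List.map_cons, List.mem_cons] at hz
        exact hz.resolve_left fun e => h e.symm
      simpa [mkSub, lookupV, h] using ih f (by simpa using hf) this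

theorem lookupV_mkSub_getElem (X : PreCtx A) (f : List (Expr A)) (hX : (names X).Nodup)
    (i : ℕ) (hi : i < X.length) (hf : i < f.length) :
    lookupV (mkSub X f) (X[i]'hi).1 = f[i]'hf := by
  induction X generalizing f i with
  | nil => simp at hi
  | cons p X ih =>
    obtain _ | ⟨e, f⟩ := f
    · simp at hf
    obtain _ | i := i
    · simp [mkSub, lookupV]
    · have h : p.1 ≠ (X[i]'(by simpa using hi)).1 := by
        intro e
        simp only [names, List.map_cons, List.nodup_cons, List.mem_map, not_exists] at hX
        exact hX.1 _ ⟨List.getElem_mem _, e.symm⟩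
      simp only [mkSub, List.map_cons, List.zip_cons_cons, List.getElem_cons_succ, lookupV, if_neg h]
      exact ih f (by simp at hX; simpa using hX.2) i (by simpa using hi) (by simpa using hf)

theorem SortE.substL_mkSub_subst (σ : A.Var → Expr A) (X : PreCtx A) (f : List (Expr A))
    (hf : f.length = X.length) (U : SortE A) (hU : ∀ z, SOccurs z U → z ∈ names X) :
    U.substL (mkSub X (f.map (Expr.subst σ))) = (U.substL (mkSub X f)).subst σ := by
  rw [SortE.substL, SortE.substL, SortE.subst_subst]
  exact U.subst_congr fun z hz => lookupV_mkSub_subst σ X f hf (hU z hz)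

theorem Expr.substL_mkSub_subst (σ : A.Var → Expr A) (X : PreCtx A) (f : List (Expr A))
    (hf : f.length = X.length) (u : Expr A) (hu : ∀ z, Occurs z u → z ∈ names X) :
    u.substL (mkSub X (f.map (Expr.subst σ))) = (u.substL (mkSub X f)).subst σ := by
  rw [Expr.substL, Expr.substL, Expr.subst_subst]
  exact u.subst_congr fun z hz => lookupV_mkSub_subst σ X f hf (hu z hz)

theorem subPre_map_subst (σ : A.Var → Expr A) (X : PreCtx A) (hX : IsPreCtx X)
    (f : List (Expr A)) (hf : f.length = X.length) (i : ℕ) (hi : i < X.length) :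
    subPre X (f.map (Expr.subst σ)) i hi = (subPre X f i hi).subst σ := by
  rw [subPre, subPre, ← List.map_take]
  exact SortE.substL_mkSub_subst σ _ _ (by simp [hf]) _ fun z hz => hX i hi z hz

theorem subPre_map_var (σ : A.Var → Expr A) (X : PreCtx A) (hX : IsPreCtx X)
    (i : ℕ) (hi : i < X.length) :
    subPre X (X.map fun p => σ p.1) i hi = (X[i]'hi).2.subst σ := by
  rw [subPre, ← List.map_take]
  exact SortE.subst_congr _ fun z hz => lookupV_mkSub_map σ _ (hX i hi z hz)

theorem map_ctxVars (σ : A.Var → Expr A) (X : PreCtx A) :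
    (ctxVars X).map (Expr.subst σ) = X.map fun p => σ p.1 := by
  simp [ctxVars]

/-! ## Derivability -/

/-- The shape of the sort and term axioms of a pretheory. -/
structure Shaped (Ax : Set (Judg A)) : Prop where
  sort_shape : ∀ (X : PreCtx A) (U : SortE A), Judg.sort X U ∈ Ax → U.args = ctxVars X
  term_shape : ∀ (X : PreCtx A) (u : Expr A) (U : SortE A), Judg.term X u U ∈ Ax →
      ∃ t : A.TermSym, u = Expr.app t (ctxVars X)

theorem IsPretheory.shaped {Ax : Set (Judg A)} (h : IsPretheory Ax) : Shaped Ax :=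
  ⟨h.sort_shape, h.term_shape⟩

/-- `e` contains only variables in `S`, and its term symbols are applied to the right
number of arguments. -/
inductive WT (Ax : Set (Judg A)) (S : List A.Var) : Expr A → Prop where
  | var {x : A.Var} (hx : x ∈ S) : WT Ax S (.var x)
  | app {t : A.TermSym} {es : List (Expr A)} {X : PreCtx A} {V : SortE A}
      (hax : introTerm X t V ∈ Ax) (hlen : es.length = X.length)
      (h : ∀ e ∈ es, WT Ax S e) : WT Ax S (.app t es)

/-- The sort analogue of `WT`. -/
def WTs (Ax : Set (Judg A)) (S : List A.Var) (U : SortE A) : Prop := ∀ e ∈ U.args, WT Ax S e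

/-- A precontext with distinct variables all of whose sorts satisfy `WTs`. -/
def Good (Ax : Set (Judg A)) (X : PreCtx A) : Prop :=
  (names X).Nodup ∧ ∀ i (hi : i < X.length), WTs Ax (names (X.take i)) (X[i]'hi).2

theorem WT.mem {Ax : Set (Judg A)} {S : List A.Var} {e : Expr A} (h : WT Ax S e) {z : A.Var}
    (hz : Occurs z e) : z ∈ S := by
  induction h with
  | var hx => cases hz; exact hx
  | app _ _ _ ih =>
    obtain ⟨e, he, hz⟩ := occurs_app_iff.1 hz
    exact ih e he hz

theorem WTs.mem {Ax : Set (Judg A)} {S : List A.Var} {U : SortE A} (h : WTs Ax S U) {z : A.Var}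
    (hz : SOccurs z U) : z ∈ S := by
  obtain ⟨e, he, hz⟩ := hz
  exact (h e he).mem hz

theorem WT.subst {Ax : Set (Judg A)} {S S' : List A.Var} {σ : A.Var → Expr A} {e : Expr A}
    (h : WT Ax S e) (hσ : ∀ x ∈ S, WT Ax S' (σ x)) : WT Ax S' (e.subst σ) := by
  induction h with
  | var hx => simpa using hσ _ hx
  | app hax hlen _ ih =>
    rw [Expr.subst_app_eq]
    refine .app hax (by simpa using hlen) fun e he => ?_
    obtain ⟨e', he', rfl⟩ := List.mem_map.1 he
    exact ih e' he'

theorem WT.mono {Ax : Set (Judg A)} {S S' : List A.Var} {e : Expr A}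
    (h : WT Ax S e) (hS : ∀ x ∈ S, x ∈ S') : WT Ax S' e := by
  simpa [Expr.subst_var_self] using h.subst (σ := Expr.var) fun x hx => .var (hS x hx)

theorem WTs.mono {Ax : Set (Judg A)} {S S' : List A.Var} {U : SortE A}
    (h : WTs Ax S U) (hS : ∀ x ∈ S, x ∈ S') : WTs Ax S' U :=
  fun e he => (h e he).mono hS

theorem WTs.subst {Ax : Set (Judg A)} {S S' : List A.Var} {σ : A.Var → Expr A} {U : SortE A}
    (h : WTs Ax S U) (hσ : ∀ x ∈ S, WT Ax S' (σ x)) : WTs Ax S' (U.subst σ) := by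
  intro e he
  obtain ⟨e', he', rfl⟩ := List.mem_map.1 he
  exact (h e' he').subst hσ

theorem WT.lookupV_mkSub {Ax : Set (Judg A)} {S : List A.Var} {X : PreCtx A} {f : List (Expr A)}
    (hf : ∀ e ∈ f, WT Ax S e) (hlen : f.length = X.length) {x : A.Var} (hx : x ∈ names X) :
    WT Ax S (lookupV (mkSub X f) x) := by
  rcases lookupV_cases (mkSub X f) x with ⟨p, h1, _, h2⟩ | ⟨h1, _⟩
  · rw [h2]
    exact hf _ (List.of_mem_zip h1).2
  · exfalso
    rw [← List.map_fst_zip (l₁ := names X) (l₂ := f) (by simp [hlen])] at hx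
    obtain ⟨p, hp, rfl⟩ := List.mem_map.1 hx
    exact h1 p hp rfl

theorem WT.of_mem_ctxVars {Ax : Set (Judg A)} {X : PreCtx A} {e : Expr A} (he : e ∈ ctxVars X) :
    WT Ax (names X) e := by
  obtain ⟨p, hp, rfl⟩ := List.mem_map.1 he
  exact .var (List.mem_map_of_mem hp)

theorem Good.isPreCtx {Ax : Set (Judg A)} {X : PreCtx A} (h : Good Ax X) : IsPreCtx X :=
  fun i hi _ hv => (h.2 i hi).mem hv

theorem Good.take {Ax : Set (Judg A)} {X : PreCtx A} (h : Good Ax X) (k : ℕ) :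
    Good Ax (X.take k) := by
  refine ⟨?_, fun i hi => ?_⟩
  · rw [names, List.map_take]
    exact h.1.sublist (List.take_sublist _ _)
  · simp only [List.length_take, lt_inf_iff] at hi
    rw [List.take_take, min_eq_left hi.1.le, List.getElem_take]
    exact h.2 i hi.2

theorem Good.wts {Ax : Set (Judg A)} {X : PreCtx A} (h : Good Ax X) {i : ℕ} (hi : i < X.length) :
    WTs Ax (names X) (X[i]'hi).2 :=
  (h.2 i hi).mono fun _ => names_take_subset

theorem Good.snoc {Ax : Set (Judg A)} {X : PreCtx A} {x : A.Var} {U : SortE A} (h : Good Ax X)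
    (hx : ∀ p ∈ X, p.1 ≠ x) (hU : WTs Ax (names X) U) : Good Ax (X ++ [(x, U)]) := by
  refine ⟨?_, fun i hi => ?_⟩
  · simp only [names, List.map_append, List.map_cons, List.map_nil]
    rw [List.nodup_append]
    refine ⟨h.1, by simp, fun a ha b hb => ?_⟩
    obtain ⟨p, hp, rfl⟩ := List.mem_map.1 ha
    simp only [List.mem_singleton] at hb
    exact hb ▸ hx p hp
  · rcases Nat.lt_or_ge i X.length with h' | h'
    · rw [List.take_append_of_le_length h'.le, List.getElem_append_left h']
      exact h.2 i h'
    · have : i = X.length := by simp at hi; omega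
      subst this
      simpa using hU

theorem Step.mono {Ax : Set (Judg A)} {D D' : Judg A → Prop} (hD : ∀ J, D J → D' J) {J : Judg A}
    (h : Step Ax D J) : Step Ax D' J := by
  cases h with
  | ctx_nil => exact .ctx_nil
  | ctx_cons hs hf hp => exact .ctx_cons (hD _ hs) hf hp
  | s1 h => exact .s1 (hD _ h)
  | s2 h => exact .s2 (hD _ h)
  | s3 h1 h2 => exact .s3 (hD _ h1) (hD _ h2)
  | t1 h => exact .t1 (hD _ h)
  | t2 h => exact .t2 (hD _ h)
  | t3 h1 h2 => exact .t3 (hD _ h1) (hD _ h2)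
  | seqt h1 h2 => exact .seqt (hD _ h1) (hD _ h2)
  | seqteq h1 h2 h3 h4 => exact .seqteq (hD _ h1) (hD _ h2) (hD _ h3) (hD _ h4)
  | var hi h => exact .var hi (hD _ h)
  | sA hax h hv => exact .sA hax (hD _ h) fun i hi => hD _ (hv i hi)
  | tA hax h hv => exact .tA hax (hD _ h) fun i hi => hD _ (hv i hi)
  | seqA hax h1 h2 => exact .seqA hax (hD _ h1) (hD _ h2)
  | teqA hax h1 h2 => exact .teqA hax (hD _ h1) (hD _ h2)
  | sSub hax hY hl hJ hc ha =>
    exact .sSub hax hY hl (hD _ hJ) (hD _ hc) fun i h1 h2 => hD _ (ha i h1 h2)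
  | tSub hax hY hl hJ hc ha =>
    exact .tSub hax hY hl (hD _ hJ) (hD _ hc) fun i h1 h2 => hD _ (ha i h1 h2)
  | seqSub1 hax hY hl hJ h1 h2 ha =>
    exact .seqSub1 hax hY hl (hD _ hJ) (hD _ h1) (hD _ h2) fun i h1 h2 => hD _ (ha i h1 h2)
  | seqSub2 hax hY hl hl' hJ h1 h2 ha =>
    exact .seqSub2 hax hY hl hl' (hD _ hJ) (hD _ h1) (hD _ h2)
      fun i h1 h2 h3 => hD _ (ha i h1 h2 h3)
  | teqSub1 hax hY hl hJ h1 h2 ha =>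
    exact .teqSub1 hax hY hl (hD _ hJ) (hD _ h1) (hD _ h2) fun i h1 h2 => hD _ (ha i h1 h2)
  | teqSub2 hax hY hl hl' hJ h1 h2 ha =>
    exact .teqSub2 hax hY hl hl' (hD _ hJ) (hD _ h1) (hD _ h2)
      fun i h1 h2 h3 => hD _ (ha i h1 h2 h3)

theorem DerAt.mono {Ax : Set (Judg A)} {n m : ℕ} (h : n ≤ m) {J : Judg A}
    (hJ : DerAt Ax n J) : DerAt Ax m J := by
  induction h with
  | refl => exact hJ
  | step _ ih => exact .inl ih

theorem exists_stage_of_list {Ax : Set (Judg A)} (L : List (Judg A))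
    (h : ∀ J ∈ L, Derivable Ax J) : ∃ n, ∀ J ∈ L, DerAt Ax n J := by
  induction L with
  | nil => exact ⟨0, by simp⟩
  | cons J L ih =>
    obtain ⟨n, hn⟩ := ih fun K hK => h K (by simp [hK])
    obtain ⟨m, hm⟩ := h J (by simp)
    refine ⟨max n m, fun K hK => ?_⟩
    rcases List.mem_cons.1 hK with rfl | hK
    · exact hm.mono (le_max_right _ _)
    · exact (hn K hK).mono (le_max_left _ _)

theorem Step.finitary {Ax : Set (Judg A)} {J : Judg A} (h : Step Ax (Derivable Ax) J) :
    ∃ L : List (Judg A), (∀ K ∈ L, Derivable Ax K) ∧ Step Ax (· ∈ L) J := by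
  have fin : ∀ (k : ℕ) (F : ∀ i, i < k → Judg A) (P : List (Judg A)),
      (∀ i hi, Derivable Ax (F i hi)) → (∀ K ∈ P, Derivable Ax K) →
      ∃ L : List (Judg A), (∀ K ∈ L, Derivable Ax K) ∧ (∀ i hi, F i hi ∈ L) ∧ ∀ K ∈ P, K ∈ L := by
    intro k F P hF hP
    refine ⟨P ++ List.ofFn fun i : Fin k => F i.1 i.2, ?_, ?_, ?_⟩
    · intro K hK
      rcases List.mem_append.1 hK with hK | hK
      · exact hP K hK
      · obtain ⟨i, rfl⟩ := List.mem_ofFn.1 hK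
        exact hF _ _
    · intro i hi
      exact List.mem_append_right _ (List.mem_ofFn.2 ⟨⟨i, hi⟩, rfl⟩)
    · intro K hK
      exact List.mem_append_left _ hK
  cases h with
  | ctx_nil => exact ⟨[], by simp, .ctx_nil⟩
  | ctx_cons hs hf hp => exact ⟨[_], by simpa using hs, .ctx_cons (by simp) hf hp⟩
  | s1 h => exact ⟨[_], by simpa using h, .s1 (by simp)⟩
  | s2 h => exact ⟨[_], by simpa using h, .s2 (by simp)⟩
  | s3 h1 h2 =>
    exact ⟨[_, _], by simpa using ⟨h1, h2⟩, .s3 (List.mem_cons_self) (by simp)⟩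
  | t1 h => exact ⟨[_], by simpa using h, .t1 (by simp)⟩
  | t2 h => exact ⟨[_], by simpa using h, .t2 (by simp)⟩
  | t3 h1 h2 => exact ⟨[_, _], by simpa using ⟨h1, h2⟩, .t3 (List.mem_cons_self) (by simp)⟩
  | seqt h1 h2 => exact ⟨[_, _], by simpa using ⟨h1, h2⟩, .seqt (List.mem_cons_self) (by simp)⟩
  | seqteq h1 h2 h3 h4 =>
    exact ⟨[_, _, _, _], by simpa using ⟨h1, h2, h3, h4⟩,
      .seqteq (List.mem_cons_self) (by simp) (by simp) (by simp)⟩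
  | var hi h => exact ⟨[_], by simpa using h, .var hi (by simp)⟩
  | sA hax h hv =>
    obtain ⟨L, h1, h2, h3⟩ := fin _ _ [_] hv (by simpa using h)
    exact ⟨L, h1, .sA hax (by simpa using h3) h2⟩
  | tA hax h hv =>
    obtain ⟨L, h1, h2, h3⟩ := fin _ _ [_] hv (by simpa using h)
    exact ⟨L, h1, .tA hax (by simpa using h3) h2⟩
  | seqA hax h1 h2 => exact ⟨[_, _], by simpa using ⟨h1, h2⟩, .seqA hax (List.mem_cons_self) (by simp)⟩
  | teqA hax h1 h2 => exact ⟨[_, _], by simpa using ⟨h1, h2⟩, .teqA hax (List.mem_cons_self) (by simp)⟩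
  | sSub hax hY hl hJ hc ha =>
    obtain ⟨L, h1, h2, h3⟩ := fin _ _ [_, _] (fun i hi => ha i hi (hl ▸ hi)) (by simpa using ⟨hJ, hc⟩)
    exact ⟨L, h1, .sSub hax hY hl (h3 _ (by simp)) (h3 _ (by simp)) fun i hi _ => h2 i hi⟩
  | tSub hax hY hl hJ hc ha =>
    obtain ⟨L, h1, h2, h3⟩ := fin _ _ [_, _] (fun i hi => ha i hi (hl ▸ hi)) (by simpa using ⟨hJ, hc⟩)
    exact ⟨L, h1, .tSub hax hY hl (h3 _ (by simp)) (h3 _ (by simp)) fun i hi _ => h2 i hi⟩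
  | seqSub1 hax hY hl hJ h4 h5 ha =>
    obtain ⟨L, h1, h2, h3⟩ := fin _ _ [_, _, _] (fun i hi => ha i hi (hl ▸ hi))
      (by simpa using ⟨hJ, h4, h5⟩)
    exact ⟨L, h1, .seqSub1 hax hY hl (h3 _ (by simp)) (h3 _ (by simp)) (h3 _ (by simp))
      fun i hi _ => h2 i hi⟩
  | seqSub2 hax hY hl hl' hJ h4 h5 ha =>
    obtain ⟨L, h1, h2, h3⟩ := fin _ _ [_, _, _] (fun i hi => ha i hi (hl ▸ hi) (hl' ▸ hi))
      (by simpa using ⟨hJ, h4, h5⟩)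
    exact ⟨L, h1, .seqSub2 hax hY hl hl' (h3 _ (by simp)) (h3 _ (by simp)) (h3 _ (by simp))
      fun i hi _ _ => h2 i hi⟩
  | teqSub1 hax hY hl hJ h4 h5 ha =>
    obtain ⟨L, h1, h2, h3⟩ := fin _ _ [_, _, _] (fun i hi => ha i hi (hl ▸ hi))
      (by simpa using ⟨hJ, h4, h5⟩)
    exact ⟨L, h1, .teqSub1 hax hY hl (h3 _ (by simp)) (h3 _ (by simp)) (h3 _ (by simp))
      fun i hi _ => h2 i hi⟩
  | teqSub2 hax hY hl hl' hJ h4 h5 ha =>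
    obtain ⟨L, h1, h2, h3⟩ := fin _ _ [_, _, _] (fun i hi => ha i hi (hl ▸ hi) (hl' ▸ hi))
      (by simpa using ⟨hJ, h4, h5⟩)
    exact ⟨L, h1, .teqSub2 hax hY hl hl' (h3 _ (by simp)) (h3 _ (by simp)) (h3 _ (by simp))
      fun i hi _ _ => h2 i hi⟩

/-- Derivable judgments are closed under the inference rules. -/
theorem Derivable.of_step {Ax : Set (Judg A)} {J : Judg A} (h : Step Ax (Derivable Ax) J) :
    Derivable Ax J := by
  obtain ⟨L, hL, hs⟩ := h.finitary
  obtain ⟨n, hn⟩ := exists_stage_of_list L hL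
  exact ⟨n + 1, .inr (hs.mono hn)⟩

/-- What the derivability of a judgment at stage `n` entails: the presupposed judgments
appear at stage `n`, and all expressions are well-scoped. -/
def Presup (Ax : Set (Judg A)) (n : ℕ) : Judg A → Prop
  | .ctx X => Good Ax X
  | .sort X U => DerAt Ax n (.ctx X) ∧ WTs Ax (names X) U
  | .term X u U => DerAt Ax n (.sort X U) ∧ WT Ax (names X) u
  | .sortEq X U V => DerAt Ax n (.sort X U) ∧ DerAt Ax n (.sort X V)
  | .termEq X u v U => DerAt Ax n (.term X u U) ∧ DerAt Ax n (.term X v U)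

theorem Presup.succ {Ax : Set (Judg A)} {n : ℕ} {J : Judg A} (h : Presup Ax n J) :
    Presup Ax (n + 1) J := by
  cases J with
  | ctx X => exact h
  | sort X U => exact ⟨.inl h.1, h.2⟩
  | term X u U => exact ⟨.inl h.1, h.2⟩
  | sortEq X U V => exact ⟨.inl h.1, .inl h.2⟩
  | termEq X u v U => exact ⟨.inl h.1, .inl h.2⟩

theorem DerAt.presup {Ax : Set (Judg A)} (hs : Shaped Ax) {n : ℕ} {J : Judg A}
    (h : DerAt Ax n J) : Presup Ax n J := by
  induction n generalizing J with
  | zero => exact h.elim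
  | succ n ih =>
    rcases h with h | h
    · exact (ih h).succ
    have wt : ∀ {X : PreCtx A} {f : List (Expr A)} {Y : PreCtx A} {F : ∀ i, i < X.length → SortE A} (hl : f.length = X.length),
        (∀ i (hi : i < X.length) (hif : i < f.length),
          DerAt Ax n (.term Y (f[i]'hif) (F i hi))) → ∀ e ∈ f, WT Ax (names Y) e := by
      intro X f Y F hl hf e he
      obtain ⟨i, hi, rfl⟩ := List.getElem_of_mem he
      exact (ih (hf i (hl ▸ hi) hi)).2
    cases h with
    | ctx_nil => exact ⟨by simp, by simp⟩
    | ctx_cons hsort hf hp =>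
      obtain ⟨h1, h2⟩ := ih hsort
      exact Good.snoc (ih h1) hf h2
    | s1 h => exact ⟨.inl h, .inl h⟩
    | s2 h => exact ⟨.inl (ih h).2, .inl (ih h).1⟩
    | s3 h1 h2 => exact ⟨.inl (ih h1).1, .inl (ih h2).2⟩
    | t1 h => exact ⟨.inl h, .inl h⟩
    | t2 h => exact ⟨.inl (ih h).2, .inl (ih h).1⟩
    | t3 h1 h2 => exact ⟨.inl (ih h1).1, .inl (ih h2).2⟩
    | seqt h1 h2 => exact ⟨.inl (ih h1).2, (ih h2).2⟩
    | seqteq h1 h2 h3 h4 => exact ⟨.inl h3, .inl h4⟩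
    | var hi h => exact ⟨.inl h, .var (List.mem_map_of_mem (List.getElem_mem hi))⟩
    | sA hax h hv =>
      refine ⟨.inl h, fun e he => ?_⟩
      rw [hs.sort_shape _ _ hax] at he
      exact .of_mem_ctxVars he
    | tA hax h hv =>
      obtain ⟨t, rfl⟩ := hs.term_shape _ _ _ hax
      exact ⟨.inl h, .app hax (by simp [ctxVars]) fun e he => .of_mem_ctxVars he⟩
    | seqA hax h1 h2 => exact ⟨.inl h1, .inl h2⟩
    | teqA hax h1 h2 => exact ⟨.inl h1, .inl h2⟩
    | sSub hax hY hl hJ hc ha => exact ⟨.inl hc, wt hl ha⟩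
    | tSub hax hY hl hJ hc ha => exact ⟨.inl hc, .app hax hl (wt hl ha)⟩
    | seqSub1 hax hY hl hJ h1 h2 ha => exact ⟨.inl h1, .inl h2⟩
    | seqSub2 hax hY hl hl' hJ h1 h2 ha => exact ⟨.inl h1, .inl h2⟩
    | teqSub1 hax hY hl hJ h1 h2 ha => exact ⟨.inl h1, .inl h2⟩
    | teqSub2 hax hY hl hl' hJ h1 h2 ha => exact ⟨.inl h1, .inl h2⟩

section Inversion

variable {Ax : Set (Judg A)} {X : PreCtx A} {u v : Expr A} {U V : SortE A}

theorem Derivable.good (h : Derivable Ax (.ctx X)) (hs : Shaped Ax) : Good Ax X :=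
  h.elim fun _ h => h.presup hs

theorem Derivable.wts (h : Derivable Ax (.sort X U)) (hs : Shaped Ax) : WTs Ax (names X) U :=
  h.elim fun _ h => (h.presup hs).2

theorem Derivable.ctx_of_sort (h : Derivable Ax (.sort X U)) (hs : Shaped Ax) :
    Derivable Ax (.ctx X) :=
  h.elim fun _ h => ⟨_, (h.presup hs).1⟩

theorem Derivable.wt (h : Derivable Ax (.term X u U)) (hs : Shaped Ax) : WT Ax (names X) u :=
  h.elim fun _ h => (h.presup hs).2

theorem Derivable.sort_of_term (h : Derivable Ax (.term X u U)) (hs : Shaped Ax) :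
    Derivable Ax (.sort X U) :=
  h.elim fun _ h => ⟨_, (h.presup hs).1⟩

theorem Derivable.term_left (h : Derivable Ax (.termEq X u v U)) (hs : Shaped Ax) :
    Derivable Ax (.term X u U) :=
  h.elim fun _ h => ⟨_, (h.presup hs).1⟩

theorem Derivable.term_right (h : Derivable Ax (.termEq X u v U)) (hs : Shaped Ax) :
    Derivable Ax (.term X v U) :=
  h.elim fun _ h => ⟨_, (h.presup hs).2⟩

end Inversion

theorem DerAt.sort_of_ctx {Ax : Set (Judg A)} (hs : Shaped Ax) {n : ℕ} {X : PreCtx A}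
    (h : DerAt Ax n (.ctx X)) (i : ℕ) (hi : i < X.length) :
    DerAt Ax n (.sort (X.take i) (X[i]'hi).2) := by
  induction n generalizing X with
  | zero => exact h.elim
  | succ n ih =>
    rcases h with h | h
    · exact .inl (ih h hi)
    · generalize hJ : Judg.ctx X = J at h
      cases h with
      | ctx_nil => cases hJ; simp at hi
      | @ctx_cons X0 U x hsort hf hp =>
        cases hJ
        left
        rcases Nat.lt_or_ge i X0.length with h' | h'
        · rw [List.take_append_of_le_length h'.le]
          simp only [List.getElem_append_left h']
          exact ih (hsort.presup hs).1 h'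
        · have : i = X0.length := by simp at hi; omega
          subst this
          simpa using hsort
      | _ => cases hJ

theorem Derivable.sort_of_ctx {Ax : Set (Judg A)} {X : PreCtx A} (h : Derivable Ax (.ctx X))
    (hs : Shaped Ax) (i : ℕ) (hi : i < X.length) :
    Derivable Ax (.sort (X.take i) (X[i]'hi).2) :=
  h.elim fun n h => ⟨n, h.sort_of_ctx hs i hi⟩

theorem Derivable.snoc {Ax : Set (Judg A)} (hs : Shaped Ax) {X : PreCtx A} {U : SortE A}
    {x : A.Var} (h : Derivable Ax (.sort X U)) (hx : ∀ p ∈ X, p.1 ≠ x) :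
    Derivable Ax (.ctx (X ++ [(x, U)])) :=
  .of_step (.ctx_cons h hx (((h.ctx_of_sort hs).good hs).snoc hx (h.wts hs)).isPreCtx)

/-! ## Heights -/

theorem Derivable.derAt_ht {Ax : Set (Judg A)} {J : Judg A} (h : Derivable Ax J) :
    DerAt Ax (ht Ax J) J :=
  Nat.sInf_mem (s := {n | DerAt Ax n J}) h

theorem DerAt.ht_le {Ax : Set (Judg A)} {J : Judg A} {n : ℕ} (h : DerAt Ax n J) : ht Ax J ≤ n :=
  Nat.sInf_le h

theorem ht_le_htCtx {Ax : Set (Judg A)} (hs : Shaped Ax) {X : PreCtx A}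
    (h : Derivable Ax (.ctx X)) (i : ℕ) (hi : i < X.length) :
    ht Ax (.sort (X.take i) (X[i]'hi).2) ≤ htCtx Ax X := by
  have hl : 0 < X.length := by omega
  have hne : X ≠ [] := List.length_pos_iff.1 hl
  have e : htCtx Ax X = ht Ax (.sort X.dropLast (X.getLast hne).2) := by
    cases X with
    | nil => exact absurd rfl hne
    | cons p X => rfl
  have e1 : X.dropLast = X.take (X.length - 1) := List.dropLast_eq_take
  have e2 : X.getLast hne = X[X.length - 1]'(by omega) := List.getLast_eq_getElem hne
  have h1 := (h.sort_of_ctx hs (X.length - 1) (by omega)).derAt_ht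
  rw [e, e1]
  simp only [e2]
  rcases Nat.lt_or_ge i (X.length - 1) with h' | h'
  · refine DerAt.ht_le ?_
    have := (h1.presup hs).1.sort_of_ctx hs i (by simp; omega)
    rw [List.take_take, min_eq_left h'.le, List.getElem_take] at this
    exact this
  · obtain rfl : i = X.length - 1 := by omega
    exact le_rfl

/-! ## The substitution lemma -/

/-- The judgment obtained by substituting along `σ` into the context `Y`. -/
def Judg.subst (Y : PreCtx A) (σ : A.Var → Expr A) : Judg A → Judg A
  | .ctx X => .ctx Y
  | .sort X U => .sort Y (U.subst σ)
  | .term X u U => .term Y (u.subst σ) (U.subst σ)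
  | .sortEq X U V => .sortEq Y (U.subst σ) (V.subst σ)
  | .termEq X u v U => .termEq Y (u.subst σ) (v.subst σ) (U.subst σ)

theorem DerAt.subst {Ax : Set (Judg A)} (hs : Shaped Ax) {Y : PreCtx A}
    (hY : Derivable Ax (.ctx Y)) {σ : A.Var → Expr A} {n : ℕ} {J : Judg A} (h : DerAt Ax n J)
    (hσ : ∀ p ∈ J.ctxOf, Derivable Ax (.term Y (σ p.1) (p.2.subst σ))) :
    Derivable Ax (J.subst Y σ) := by
  have hYp := (hY.good hs).isPreCtx
  induction n generalizing J with
  | zero => exact h.elim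
  | succ n ih =>
    rcases h with h | h
    · exact ih h hσ
    have args : ∀ {X : PreCtx A} {f : List (Expr A)} (hl : f.length = X.length) (hX : Good Ax X),
        (∀ i (hi : i < X.length) (hif : i < f.length),
          DerAt Ax n (.term J.ctxOf (f[i]'hif) (subPre X f i hi))) →
        ∀ i (hi : i < X.length) (hif : i < (f.map (Expr.subst σ)).length),
          Derivable Ax (.term Y ((f.map (Expr.subst σ))[i]'hif)
            (subPre X (f.map (Expr.subst σ)) i hi)) := by
      intro X f hl hX hf i hi hif
      rw [subPre_map_subst σ X hX.isPreCtx f hl, List.getElem_map]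
      exact ih (hf i hi (hl ▸ hi)) hσ
    have argsEq : ∀ {X : PreCtx A} {f g : List (Expr A)} (hl : f.length = X.length) (hl' : g.length = X.length)
        (hX : Good Ax X),
        (∀ i (hi : i < X.length) (hif : i < f.length) (hig : i < g.length),
          DerAt Ax n (.termEq J.ctxOf (f[i]'hif) (g[i]'hig) (subPre X f i hi))) →
        ∀ i (hi : i < X.length) (hif : i < (f.map (Expr.subst σ)).length)
          (hig : i < (g.map (Expr.subst σ)).length),
          Derivable Ax (.termEq Y ((f.map (Expr.subst σ))[i]'hif)
            ((g.map (Expr.subst σ))[i]'hig) (subPre X (f.map (Expr.subst σ)) i hi)) := by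
      intro X f g hl hl' hX hf i hi hif hig
      rw [subPre_map_subst σ X hX.isPreCtx f hl, List.getElem_map, List.getElem_map]
      exact ih (hf i hi (hl ▸ hi) (hl' ▸ hi)) hσ
    have vars : ∀ (hX : Good Ax J.ctxOf) i (hi : i < J.ctxOf.length)
        (hif : i < (J.ctxOf.map fun p => σ p.1).length),
        Derivable Ax (.term Y ((J.ctxOf.map fun p => σ p.1)[i]'hif)
          (subPre J.ctxOf (J.ctxOf.map fun p => σ p.1) i hi)) := by
      intro hX i hi hif
      rw [subPre_map_var σ _ hX.isPreCtx, List.getElem_map]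
      exact hσ _ (List.getElem_mem hi)
    have substVars : ∀ {X : PreCtx A} {U : SortE A}, WTs Ax (names X) U →
        U.substL (mkSub X (X.map fun p => σ p.1)) = U.subst σ := fun hU =>
      SortE.subst_congr _ fun z hz => lookupV_mkSub_map σ _ (hU.mem hz)
    have substVarsT : ∀ {X : PreCtx A} {u : Expr A}, WT Ax (names X) u →
        u.substL (mkSub X (X.map fun p => σ p.1)) = u.subst σ := fun hu =>
      Expr.subst_congr _ fun z hz => lookupV_mkSub_map σ _ (hu.mem hz)
    cases h with
    | ctx_nil => exact hY
    | ctx_cons hsort hf hp => exact hY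
    | s1 h => exact .of_step (.s1 (ih h hσ))
    | s2 h => exact .of_step (.s2 (ih h hσ))
    | s3 h1 h2 => exact .of_step (.s3 (ih h1 hσ) (ih h2 hσ))
    | t1 h => exact .of_step (.t1 (ih h hσ))
    | t2 h => exact .of_step (.t2 (ih h hσ))
    | t3 h1 h2 => exact .of_step (.t3 (ih h1 hσ) (ih h2 hσ))
    | seqt h1 h2 => exact .of_step (.seqt (ih h1 hσ) (ih h2 hσ))
    | seqteq h1 h2 h3 h4 =>
      exact .of_step (.seqteq (ih h1 hσ) (ih h2 hσ) (ih h3 hσ) (ih h4 hσ))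
    | var hi h =>
      simpa [Judg.subst] using hσ _ (List.getElem_mem hi)
    | @sA X U hax h hv =>
      have hg : Good Ax X := h.presup hs
      have hd : Derivable Ax (.sort X U) := ⟨n + 1, .inr (.sA hax h hv)⟩
      have hU := hs.sort_shape _ _ hax
      obtain ⟨S, f⟩ := U
      obtain rfl : f = ctxVars X := hU
      have := Derivable.of_step (Step.sSub hax hYp (f := X.map fun p : A.Var × SortE A => σ p.1) (by simp) hd hY
        (vars hg))
      simpa [Judg.subst, SortE.subst, map_ctxVars] using this
    | @tA X u U hax h hv =>
      have hg : Good Ax X := ((h.presup hs).1).presup hs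
      have hd : Derivable Ax (.term X u U) := ⟨n + 1, .inr (.tA hax h hv)⟩
      obtain ⟨t, rfl⟩ := hs.term_shape _ _ _ hax
      have e := substVars (h.presup hs).2
      have := Derivable.of_step (Step.tSub hax hYp (f := X.map fun p : A.Var × SortE A => σ p.1) (by simp) hd
        (by rw [e]; exact ih h hσ) (vars hg))
      simpa [Judg.subst, map_ctxVars, e] using this
    | @seqA X U U' hax h1 h2 =>
      have hg : Good Ax X := ((h1.presup hs).1).presup hs
      have hd : Derivable Ax (.sortEq X U U') := ⟨n + 1, .inr (.seqA hax h1 h2)⟩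
      have e1 := substVars (h1.presup hs).2
      have e2 := substVars (h2.presup hs).2
      have := Derivable.of_step (Step.seqSub1 hax hYp (f := X.map fun p : A.Var × SortE A => σ p.1) (by simp) hd
        (by rw [e1]; exact ih h1 hσ) (by rw [e2]; exact ih h2 hσ) (vars hg))
      simpa [Judg.subst, e1, e2] using this
    | @teqA X u u' U hax h1 h2 =>
      have hU := (h1.presup hs).1.presup hs
      have hg : Good Ax X := hU.1.presup hs
      have hd : Derivable Ax (.termEq X u u' U) := ⟨n + 1, .inr (.teqA hax h1 h2)⟩
      have e0 := substVars hU.2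
      have e1 := substVarsT (h1.presup hs).2
      have e2 := substVarsT (h2.presup hs).2
      have := Derivable.of_step (Step.teqSub1 hax hYp (f := X.map fun p : A.Var × SortE A => σ p.1) (by simp) hd
        (by rw [e0, e1]; exact ih h1 hσ) (by rw [e0, e2]; exact ih h2 hσ) (vars hg))
      simpa [Judg.subst, e0, e1, e2] using this
    | @sSub X S hax Z hZ f hl hJ hc ha =>
      have hX : Good Ax X := (hJ.presup hs).1.presup hs
      exact .of_step (.sSub hax hYp (by simpa using hl) ⟨n, hJ⟩ hY (args hl hX ha))
    | @tSub X t U hax Z hZ f hl hJ hc ha =>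
      have hU := (hJ.presup hs).1.presup hs
      have hX : Good Ax X := hU.1.presup hs
      have e := SortE.substL_mkSub_subst σ X f hl U fun z hz => hU.2.mem hz
      have := Derivable.of_step (Step.tSub hax hYp (f := f.map (Expr.subst σ)) (by simpa using hl)
        ⟨n, hJ⟩ (by rw [e]; exact ih hc hσ) (args hl hX ha))
      simpa [Judg.subst, e] using this
    | @seqSub1 X U U' hax Z hZ f hl hJ h1 h2 ha =>
      have hU := (hJ.presup hs).1.presup hs
      have hU' := (hJ.presup hs).2.presup hs
      have hX : Good Ax X := hU.1.presup hs
      have e1 := SortE.substL_mkSub_subst σ X f hl U fun z hz => hU.2.mem hz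
      have e2 := SortE.substL_mkSub_subst σ X f hl U' fun z hz => hU'.2.mem hz
      have := Derivable.of_step (Step.seqSub1 hax hYp (f := f.map (Expr.subst σ))
        (by simpa using hl) ⟨n, hJ⟩ (by rw [e1]; exact ih h1 hσ) (by rw [e2]; exact ih h2 hσ)
        (args hl hX ha))
      simpa [Judg.subst, e1, e2] using this
    | @seqSub2 X S hax Z hZ f g hl hl' hJ h1 h2 ha =>
      have hX : Good Ax X := (hJ.presup hs).1.presup hs
      exact .of_step (.seqSub2 hax hYp (by simpa using hl) (by simpa using hl') ⟨n, hJ⟩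
        (ih h1 hσ) (ih h2 hσ) (argsEq hl hl' hX ha))
    | @teqSub1 X u u' U hax Z hZ f hl hJ h1 h2 ha =>
      have hu := (hJ.presup hs).1.presup hs
      have hu' := (hJ.presup hs).2.presup hs
      have hU := hu.1.presup hs
      have hX : Good Ax X := hU.1.presup hs
      have e0 := SortE.substL_mkSub_subst σ X f hl U fun z hz => hU.2.mem hz
      have e1 := Expr.substL_mkSub_subst σ X f hl u fun z hz => hu.2.mem hz
      have e2 := Expr.substL_mkSub_subst σ X f hl u' fun z hz => hu'.2.mem hz
      have := Derivable.of_step (Step.teqSub1 hax hYp (f := f.map (Expr.subst σ))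
        (by simpa using hl) ⟨n, hJ⟩ (by rw [e0, e1]; exact ih h1 hσ)
        (by rw [e0, e2]; exact ih h2 hσ) (args hl hX ha))
      simpa [Judg.subst, e0, e1, e2] using this
    | @teqSub2 X t U hax Z hZ f g hl hl' hJ h1 h2 ha =>
      have hU := (hJ.presup hs).1.presup hs
      have hX : Good Ax X := hU.1.presup hs
      have e := SortE.substL_mkSub_subst σ X f hl U fun z hz => hU.2.mem hz
      have i1 := ih h1 hσ
      have i2 := ih h2 hσ
      simp only [Judg.subst, Expr.subst_app_eq, ← e] at i1 i2
      have := Derivable.of_step (Step.teqSub2 hax hYp (by simpa using hl) (by simpa using hl')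
        ⟨n, hJ⟩ i1 i2 (argsEq hl hl' hX ha))
      simpa [Judg.subst, e] using this

theorem Derivable.subst {Ax : Set (Judg A)} {J : Judg A} (h : Derivable Ax J)
    (hs : Shaped Ax) {Y : PreCtx A} (hY : Derivable Ax (.ctx Y)) {σ : A.Var → Expr A}
    (hσ : ∀ p ∈ J.ctxOf, Derivable Ax (.term Y (σ p.1) (p.2.subst σ))) :
    Derivable Ax (J.subst Y σ) :=
  h.elim fun _ h => h.subst hs hY hσ

/-- The variables of a derivable context are derivable terms. -/
theorem Derivable.var_of_ctx {Ax : Set (Judg A)} (hs : Shaped Ax) {X : PreCtx A}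
    (h : Derivable Ax (.ctx X)) : ∀ p ∈ X, Derivable Ax (.term X (.var p.1) p.2) := by
  have key : ∀ i (hi : i < X.length),
      Derivable Ax (.term X (.var (X[i]'hi).1) (X[i]'hi).2) := by
    intro i
    induction i using Nat.strong_induction_on with
    | _ i ih =>
      intro hi
      refine .of_step (.var hi ?_)
      have := (h.sort_of_ctx hs i hi).subst hs h (σ := Expr.var) ?_
      · simpa [Judg.subst, SortE.subst_var_self] using this
      · intro p hp
        obtain ⟨k, hk, rfl⟩ := List.getElem_of_mem hp
        simp only [Judg.ctxOf, List.length_take, lt_inf_iff] at hk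
        simp only [Judg.ctxOf, List.getElem_take, SortE.subst_var_self]
        exact ih k hk.1 hk.2
  intro p hp
  obtain ⟨k, hk, rfl⟩ := List.getElem_of_mem hp
  exact key k hk

/-! ## Renaming of variables -/

/-- The substitution renaming variables along a permutation. -/
def ren (π : Equiv.Perm A.Var) : A.Var → Expr A := fun x => .var (π x)

theorem ren_apply (π : Equiv.Perm A.Var) (x : A.Var) : ren π x = .var (π x) := rfl

/-- Renaming of the variables of a precontext. -/
def renCtx (π : Equiv.Perm A.Var) (X : PreCtx A) : PreCtx A :=
  X.map fun p => (π p.1, p.2.subst (ren π))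

@[simp] theorem length_renCtx (π : Equiv.Perm A.Var) (X : PreCtx A) :
    (renCtx π X).length = X.length := by simp [renCtx]

@[simp] theorem getElem_renCtx (π : Equiv.Perm A.Var) (X : PreCtx A) (i : ℕ)
    (hi : i < (renCtx π X).length) :
    (renCtx π X)[i]'hi = (π (X[i]'(by simpa using hi)).1,
      (X[i]'(by simpa using hi)).2.subst (ren π)) := by simp [renCtx]

theorem renCtx_take (π : Equiv.Perm A.Var) (X : PreCtx A) (i : ℕ) :
    renCtx π (X.take i) = (renCtx π X).take i := List.map_take

theorem ren_fresh {π : Equiv.Perm A.Var} {X : PreCtx A} {x : A.Var} (h : ∀ p ∈ X, p.1 ≠ x) :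
    ∀ p ∈ renCtx π X, p.1 ≠ π x := by
  intro p hp
  obtain ⟨q, hq, rfl⟩ := List.mem_map.1 hp
  simpa using h q hq

theorem Expr.subst_ren_of_fixed {π : Equiv.Perm A.Var} {S : List A.Var} (hπ : ∀ x ∈ S, π x = x)
    {e : Expr A} (he : ∀ z, Occurs z e → z ∈ S) : e.subst (ren π) = e := by
  conv_rhs => rw [← e.subst_var_self]
  exact e.subst_congr fun z hz => by rw [ren, hπ z (he z hz)]

theorem SortE.subst_ren_of_fixed {π : Equiv.Perm A.Var} {S : List A.Var} (hπ : ∀ x ∈ S, π x = x)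
    {U : SortE A} (hU : ∀ z, SOccurs z U → z ∈ S) : U.subst (ren π) = U := by
  conv_rhs => rw [← U.subst_var_self]
  exact U.subst_congr fun z hz => by rw [ren, hπ z (hU z hz)]

theorem Good.renCtx_of_fixed {Ax : Set (Judg A)} {X : PreCtx A} (h : Good Ax X)
    {π : Equiv.Perm A.Var} (hπ : ∀ x ∈ names X, π x = x) : renCtx π X = X := by
  refine List.ext_getElem (by simp) fun i h1 h2 => ?_
  rw [getElem_renCtx]
  refine Prod.ext (hπ _ (List.mem_map_of_mem (List.getElem_mem h2))) ?_
  exact SortE.subst_ren_of_fixed hπ fun z hz => (h.wts h2).mem hz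

theorem swap_fixes {X : PreCtx A} {x y : A.Var} (hx : ∀ p ∈ X, p.1 ≠ x) (hy : ∀ p ∈ X, p.1 ≠ y)
    [DecidableEq A.Var] : ∀ z ∈ names X, Equiv.swap x y z = z := by
  intro z hz
  obtain ⟨p, hp, rfl⟩ := List.mem_map.1 hz
  exact Equiv.swap_apply_of_ne_of_ne (hx p hp) (hy p hp)

theorem lookupV_ren (ρ : Equiv.Perm A.Var) (ps : List (A.Var × Expr A)) (z : A.Var) :
    lookupV (ps.map fun p => (ρ p.1, p.2.subst (ren ρ))) (ρ z) = (lookupV ps z).subst (ren ρ) := by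
  induction ps with
  | nil => simp [lookupV, ren]
  | cons p ps ih =>
    by_cases h : p.1 = z
    · simp [lookupV, h]
    · simpa [lookupV, h] using ih

theorem Expr.substL_ren (ρ : Equiv.Perm A.Var) (ps : List (A.Var × Expr A)) (e : Expr A) :
    (e.subst (ren ρ)).substL (ps.map fun p => (ρ p.1, p.2.subst (ren ρ))) =
      (e.substL ps).subst (ren ρ) := by
  rw [Expr.substL, Expr.substL, Expr.subst_subst, Expr.subst_subst]
  exact e.subst_congr fun z _ => by rw [← lookupV_ren]; simp [ren]

/-- The permutation of the variables of the tensor alphabet induced by permutations of the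
variables of the factors. -/
abbrev ren₂ (π : Equiv.Perm A.Var) (τ : Equiv.Perm B.Var) : Equiv.Perm (A.tensor B).Var :=
  Equiv.prodCongr π τ

theorem pairsR_ren (π : Equiv.Perm A.Var) (τ : Equiv.Perm B.Var) (x : A.Var) (Y : PreCtx B)
    (g : ℕ → Expr (A.tensor B)) :
    pairsR (π x) (renCtx τ Y) (fun j => (g j).subst (ren (ren₂ π τ))) =
      (pairsR x Y g).map fun p => (ren₂ π τ p.1, p.2.subst (ren (ren₂ π τ))) := by
  refine List.ext_getElem (by simp [pairsR]) fun i h1 h2 => ?_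
  simp [pairsR]

theorem lookupV_pairsR_getElem {x : A.Var} {Y : PreCtx B} (hY : (names Y).Nodup)
    (g : ℕ → Expr (A.tensor B)) {j : ℕ} (hj : j < Y.length) :
    lookupV (pairsR x Y g) (x, (Y[j]'hj).1) = g j := by
  rcases lookupV_cases (pairsR x Y g) (x, (Y[j]'hj).1) with ⟨p, h1, h2, h3⟩ | ⟨h1, _⟩
  · obtain ⟨k, _, rfl⟩ := List.mem_map.1 h1
    have e : (names Y)[k.1]'(by simp) = (names Y)[j]'(by simpa using hj) := by
      simpa using h2
    rw [hY.getElem_inj_iff] at e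
    rw [h3, ← e]
  · exact absurd rfl (h1 ((x, (Y[j]'hj).1), g j)
      (List.mem_map.2 ⟨⟨j, hj⟩, List.mem_finRange _, rfl⟩))

theorem lookupV_pairsR_of_ne {x : A.Var} {Y : PreCtx B} {g : ℕ → Expr (A.tensor B)}
    {z : A.Var × B.Var} (h : z.1 ≠ x) : lookupV (pairsR x Y g) z = .var z := by
  refine lookupV_of_notMem fun p hp => ?_
  obtain ⟨k, _, rfl⟩ := List.mem_map.1 hp
  rintro rfl
  exact h rfl

theorem lookupV_pairsL_getElem {X : PreCtx A} {y : B.Var} (hX : (names X).Nodup)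
    (g : ℕ → Expr (A.tensor B)) {i : ℕ} (hi : i < X.length) :
    lookupV (pairsL X y g) ((X[i]'hi).1, y) = g i := by
  rcases lookupV_cases (pairsL X y g) ((X[i]'hi).1, y) with ⟨p, h1, h2, h3⟩ | ⟨h1, _⟩
  · obtain ⟨k, _, rfl⟩ := List.mem_map.1 h1
    have e : (names X)[k.1]'(by simp) = (names X)[i]'(by simpa using hi) := by
      simpa using h2
    rw [hX.getElem_inj_iff] at e
    rw [h3, ← e]
  · exact absurd rfl (h1 (((X[i]'hi).1, y), g i)
      (List.mem_map.2 ⟨⟨i, hi⟩, List.mem_finRange _, rfl⟩))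

theorem lookupV_pairsL_of_ne {X : PreCtx A} {y : B.Var} {g : ℕ → Expr (A.tensor B)}
    {z : A.Var × B.Var} (h : z.2 ≠ y) : lookupV (pairsL X y g) z = .var z := by
  refine lookupV_of_notMem fun p hp => ?_
  obtain ⟨k, _, rfl⟩ := List.mem_map.1 hp
  rintro rfl
  exact h rfl

/-! ## Grids -/

theorem grid_index {m n k : ℕ} (h : k < m * n) :
    k / n < m ∧ k % n < n ∧ k / n * n + k % n = k := by
  have hn : 0 < n := Nat.pos_of_ne_zero (by rintro rfl; simp at h)
  exact ⟨(Nat.div_lt_iff_lt_mul hn).2 h, Nat.mod_lt _ hn, Nat.div_add_mod' k n⟩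

theorem grid_lt {m n i j : ℕ} (hi : i < m) (hj : j < n) : i * n + j < m * n := by
  calc i * n + j < i * n + n := by omega
    _ = (i + 1) * n := by ring
    _ ≤ m * n := Nat.mul_le_mul_right _ hi

theorem grid_inj {n i j i' j' : ℕ} (hj : j < n) (hj' : j' < n)
    (h : i * n + j = i' * n + j') : i = i' ∧ j = j' := by
  have e1 : (i * n + j) / n = i := by
    rw [add_comm, Nat.add_mul_div_right _ _ (by omega), Nat.div_eq_of_lt hj, zero_add]
  have e2 : (i' * n + j') / n = i' := by
    rw [add_comm, Nat.add_mul_div_right _ _ (by omega), Nat.div_eq_of_lt hj', zero_add]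
  have : i = i' := by rw [← e1, h, e2]
  subst this
  exact ⟨rfl, by omega⟩

theorem IsGrid.exists_of_getElem {γ : Type} {m n : ℕ} {M : ℕ → ℕ → γ} {L : List γ}
    (h : IsGrid m n M L) {k : ℕ} (hk : k < L.length) :
    ∃ i < m, ∃ j < n, k = i * n + j ∧ L[k] = M i j := by
  obtain ⟨h1, h2, h3⟩ := grid_index (h.1 ▸ hk)
  refine ⟨_, h1, _, h2, h3.symm, ?_⟩
  rw [← h.2 _ _ h1 h2 (by rw [h3]; exact hk)]
  simp only [h3]

theorem IsGrid.exists_of_mem {γ : Type} {m n : ℕ} {M : ℕ → ℕ → γ} {L : List γ}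
    (h : IsGrid m n M L) {e : γ} (he : e ∈ L) : ∃ i < m, ∃ j < n, e = M i j := by
  obtain ⟨k, hk, rfl⟩ := List.getElem_of_mem he
  obtain ⟨i, hi, j, hj, _, h⟩ := h.exists_of_getElem hk
  exact ⟨i, hi, j, hj, h⟩

theorem IsGrid.det {γ : Type} {m n : ℕ} {M M' : ℕ → ℕ → γ} {L L' : List γ}
    (h : IsGrid m n M L) (h' : IsGrid m n M' L') (hM : ∀ i < m, ∀ j < n, M i j = M' i j) :
    L = L' := by
  refine List.ext_getElem (h.1.trans h'.1.symm) fun k hk hk' => ?_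
  obtain ⟨i, hi, j, hj, rfl, e⟩ := h.exists_of_getElem hk
  rw [e, h'.2 i j hi hj hk', hM i hi j hj]

theorem IsGrid.map {γ δ : Type} {m n : ℕ} {M : ℕ → ℕ → γ} {L : List γ}
    (h : IsGrid m n M L) (f : γ → δ) : IsGrid m n (fun i j => f (M i j)) (L.map f) :=
  ⟨by rw [List.length_map, h.1], fun i j hi hj hk => by
    rw [List.getElem_map, h.2 i j hi hj]⟩

/-! ## The graphs of the tensor operations -/

/-- The term symbols of `Ax` are introduced by a single axiom, with a well-scoped sort. -/
structure SymbolsOK (Ax : Set (Judg A)) : Prop where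
  wts : ∀ {X : PreCtx A} {t : A.TermSym} {V : SortE A}, introTerm X t V ∈ Ax → WTs Ax (names X) V
  uniq : ∀ {X X' : PreCtx A} {t : A.TermSym} {V V' : SortE A},
    introTerm X t V ∈ Ax → introTerm X' t V' ∈ Ax → X = X' ∧ V = V'

theorem IsGAT.symbolsOK {Ax : Set (Judg A)} (h : IsGAT Ax) : SymbolsOK Ax where
  wts hax := ((h.2 _ hax).sort_of_term h.1.shaped).wts h.1.shaped
  uniq h1 h2 := Prod.ext_iff.1 ((h.1.term_intro _).unique (y₁ := (_, _)) (y₂ := (_, _)) h1 h2)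

theorem CanonSort.wts {Ax : Set (Judg A)} (ok : SymbolsOK Ax) {X : PreCtx A} (hX : Good Ax X)
    {u : Expr A} {U : SortE A} (hu : WT Ax (names X) u) (h : CanonSort Ax X u U) :
    WTs Ax (names X) U := by
  cases h with
  | var hi => exact hX.wts hi
  | app hax =>
    cases hu with
    | app hax' hlen hf =>
      obtain ⟨rfl, rfl⟩ := ok.uniq hax hax'
      exact (ok.wts hax).subst fun x hx => WT.lookupV_mkSub hf hlen hx

theorem CanonSort.det {Ax : Set (Judg A)} (ok : SymbolsOK Ax) {X : PreCtx A} (hX : Good Ax X)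
    {u : Expr A} {U U' : SortE A} (h : CanonSort Ax X u U) (h' : CanonSort Ax X u U') :
    U = U' := by
  cases h with
  | @var i hi =>
    generalize hu : Expr.var (X[i]'hi).1 = u at h'
    cases h' with
    | @var k hk =>
      have e : (names X)[i]'(by simpa using hi) = (names X)[k]'(by simpa using hk) := by
        simpa using hu
      rw [hX.1.getElem_inj_iff] at e
      subst e
      rfl
    | app => cases hu
  | app hax =>
    cases h' with
    | app hax' =>
      obtain ⟨rfl, rfl⟩ := ok.uniq hax hax'
      rfl

theorem CanonSort.ren {Ax : Set (Judg A)} (ok : SymbolsOK Ax) {X : PreCtx A} {u : Expr A}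
    {U : SortE A} (hu : WT Ax (names X) u) (h : CanonSort Ax X u U) (π : Equiv.Perm A.Var) :
    CanonSort Ax (renCtx π X) (u.subst (GATPaper.ren π)) (U.subst (GATPaper.ren π)) := by
  cases h with
  | @var i hi =>
    have := CanonSort.var (Ax := Ax) (X := renCtx π X) (i := i) (by simpa using hi)
    simpa [GATPaper.ren] using this
  | @app t f Xa V hax =>
    cases hu with
    | app hax' hlen hf =>
      obtain ⟨rfl, rfl⟩ := ok.uniq hax hax'
      rw [← SortE.substL_mkSub_subst _ _ _ hlen _ fun z hz => (ok.wts hax).mem hz,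
        Expr.subst_app_eq]
      exact .app hax

/-- Renaming of the variables of an argument of the tensor operations. -/
def TArg.ren (π : Equiv.Perm A.Var) (a : TArg A) : TArg A :=
  ⟨renCtx π a.ctx, a.tm.subst (GATPaper.ren π), a.srt.subst (GATPaper.ren π)⟩

/-- Well-scopedness of an argument of the tensor operations; a variable need not be declared
in the context. -/
structure TArg.WF (Ax : Set (Judg A)) (a : TArg A) : Prop where
  good : Good Ax a.ctx
  wts : WTs Ax (names a.ctx) a.srt
  wt : ∀ t es, a.tm = .app t es → WT Ax (names a.ctx) a.tm

theorem TArg.WF.var {Ax : Set (Judg A)} {X : PreCtx A} {x : A.Var} {U : SortE A}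
    (hX : Good Ax X) (hU : WTs Ax (names X) U) : TArg.WF Ax ⟨X, .var x, U⟩ :=
  ⟨hX, hU, fun _ _ h => by cases h⟩

theorem TArg.WF.of_wt {Ax : Set (Judg A)} {X : PreCtx A} {u : Expr A} {U : SortE A}
    (hX : Good Ax X) (hu : WT Ax (names X) u) (hU : WTs Ax (names X) U) : TArg.WF Ax ⟨X, u, U⟩ :=
  ⟨hX, hU, fun _ _ _ => hu⟩

theorem TArg.WF.take {Ax : Set (Judg A)} {X : PreCtx A} (hX : Good Ax X) {i : ℕ}
    (hi : i < X.length) : TArg.WF Ax ⟨X.take i, .var (X[i]'hi).1, (X[i]'hi).2⟩ :=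
  .var (hX.take i) (hX.2 i hi)

theorem TArg.WF.canon {Ax : Set (Judg A)} (ok : SymbolsOK Ax) {X : PreCtx A} {u : Expr A}
    {U : SortE A} (hX : Good Ax X) (hu : WT Ax (names X) u) (h : CanonSort Ax X u U) :
    TArg.WF Ax ⟨X, u, U⟩ :=
  .of_wt hX hu (h.wts ok hX hu)

theorem TArg.WF.wt_args {Ax : Set (Judg A)} {X : PreCtx A} {t : A.TermSym} {es : List (Expr A)}
    {U : SortE A} (h : TArg.WF Ax ⟨X, .app t es, U⟩) {e : Expr A} (he : e ∈ es) :
    WT Ax (names X) e := by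
  cases h.wt _ _ rfl with
  | app _ _ h => exact h e he

theorem TArg.WF.mem_names {Ax : Set (Judg A)} {X : PreCtx A} {t : A.TermSym}
    {es : List (Expr A)} {U : SortE A} (h : TArg.WF Ax ⟨X, .app t es, U⟩) {z : A.Var}
    (hz : Occurs z (.app t es)) : z ∈ names X :=
  (h.wt _ _ rfl).mem hz

theorem TTg.scope {TA : Set (Judg A)} {TB : Set (Judg B)} (okA : SymbolsOK TA)
    (okB : SymbolsOK TB) {a : TArg A} {b : TArg B} {e : Expr (A.tensor B)}
    (h : TTg TA TB false a b e) (ha : a.WF TA) (hb : b.WF TB) {z : A.Var × B.Var}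
    (hz : Occurs (A := A.tensor B) z e) :
    (z.1 ∈ names a.ctx ∨ Occurs z.1 a.tm) ∧ (z.2 ∈ names b.ctx ∨ Occurs z.2 b.tm) := by
  generalize hf : false = f at h
  induction h generalizing z with
  | varvar =>
    rw [occurs_var_iff] at hz
    subst hz
    exact ⟨.inr .var, .inr .var⟩
  | @varapp _ X x S ss Y t ts V SS TSf hSS hTS M out hM hMx hout ihM ihMx =>
    rw [occurs_app_iff] at hz
    obtain ⟨e, he, hz⟩ := hz
    obtain ⟨i, hi, j, hj, rfl⟩ := hout.exists_of_mem he
    have wtj := hb.wt_args (List.getElem_mem hj)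
    have hbj := TArg.WF.canon okB hb.good wtj (hTS j hj)
    rcases Nat.lt_succ_iff_lt_or_eq.1 hi with hi | rfl
    · have wti := ha.wts _ (List.getElem_mem hi)
      obtain ⟨h1, h2⟩ := ihM i hi j hj (TArg.WF.canon okA ha.good wti (hSS i hi)) hbj hz hf
      exact ⟨.inl (h1.elim id wti.mem), .inl (h2.elim id wtj.mem)⟩
    · obtain ⟨h1, h2⟩ := ihMx j hj ha hbj hz hf
      exact ⟨h1, .inl (h2.elim id wtj.mem)⟩
  | @appvar _ X s ss U Y y T ts SS TSf hSS hTS M out hM hMy hout ihM ihMy =>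
    rw [occurs_app_iff] at hz
    obtain ⟨e, he, hz⟩ := hz
    obtain ⟨i, hi, j, hj, rfl⟩ := hout.exists_of_mem he
    have wti := ha.wt_args (List.getElem_mem hi)
    have hai := TArg.WF.canon okA ha.good wti (hSS i hi)
    rcases Nat.lt_succ_iff_lt_or_eq.1 hj with hj | rfl
    · have wtj := hb.wts _ (List.getElem_mem hj)
      obtain ⟨h1, h2⟩ := ihM i hi j hj hai (TArg.WF.canon okB hb.good wtj (hTS j hj)) hz hf
      exact ⟨.inl (h1.elim id wti.mem), .inl (h2.elim id wtj.mem)⟩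
    · obtain ⟨h1, h2⟩ := ihMy i hi hai hb hz hf
      exact ⟨.inl (h1.elim id wti.mem), h2⟩
  | @appapp_base X s ss U Y t ts V x hx e0 h0 g hg ih0 ihg =>
    obtain ⟨w, hw, hzw⟩ := Expr.exists_of_occurs_subst _ hz
    rcases lookupV_cases (pairsR x Y g) w with ⟨p, hp, h1, h2⟩ | ⟨h1, h2⟩
    · rw [h2] at hzw
      obtain ⟨j, _, rfl⟩ := List.mem_map.1 hp
      obtain ⟨h1, h2⟩ := ihg j.1 j.2 ha (.take hb.good j.2) hzw hf
      refine ⟨h1, .inl (h2.elim names_take_subset fun h => ?_)⟩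
      rw [occurs_var_iff] at h
      rw [h]
      exact List.mem_map_of_mem (List.getElem_mem _)
    · rw [h2, occurs_var_iff] at hzw
      subst hzw
      obtain ⟨h3, h4⟩ := ih0 (.var ha.good ha.wts) hb hw hf
      have h4' := h4.elim id hb.mem_names
      refine ⟨.inl (h3.elim id fun h => ?_), .inl h4'⟩
      rw [occurs_var_iff] at h
      obtain ⟨q, hq, h5⟩ := List.mem_map.1 h4'
      obtain ⟨j, hj, rfl⟩ := List.getElem_of_mem hq
      refine absurd ?_ (h1 ((x, (Y[j]'hj).1), g j)
        (List.mem_map.2 ⟨⟨j, hj⟩, List.mem_finRange _, rfl⟩))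
      exact Prod.ext h.symm h5
  | appapp_star => cases hf

theorem TTg.ren {TA : Set (Judg A)} {TB : Set (Judg B)} (okA : SymbolsOK TA)
    (okB : SymbolsOK TB) {a : TArg A} {b : TArg B} {e : Expr (A.tensor B)}
    (h : TTg TA TB false a b e) (ha : a.WF TA) (hb : b.WF TB)
    (π : Equiv.Perm A.Var) (τ : Equiv.Perm B.Var) :
    TTg TA TB false (a.ren π) (b.ren τ) (e.subst (GATPaper.ren (ren₂ π τ))) := by
  generalize hf : false = f at h ⊢
  induction h with
  | varvar =>
    simp only [TArg.ren, Expr.subst_var_eq]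
    exact .varvar
  | @varapp _ X x S ss Y t ts V SS TSf hSS hTS M out hM hMx hout ihM ihMx =>
    simp only [TArg.ren, Expr.subst_var_eq, Expr.subst_app_eq, SortE.subst]
    have wti : ∀ i (hi : i < ss.length), WT TA (names X) ss[i] := fun i hi =>
      ha.wts _ (List.getElem_mem hi)
    have wtj : ∀ j (hj : j < ts.length), WT TB (names Y) ts[j] := fun j hj =>
      hb.wt_args (List.getElem_mem hj)
    refine .varapp (fun i => (SS i).subst (GATPaper.ren π))
      (fun j => (TSf j).subst (GATPaper.ren τ)) ?_ ?_
      (fun i j => (M i j).subst (GATPaper.ren (ren₂ π τ))) _ ?_ ?_ ?_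
    · intro i hi
      rw [List.length_map] at hi
      rw [List.getElem_map]
      exact (hSS i hi).ren okA (wti i hi) π
    · intro j hj
      rw [List.length_map] at hj
      rw [List.getElem_map]
      exact (hTS j hj).ren okB (wtj j hj) τ
    · intro i hi j hj
      rw [List.length_map] at hi hj
      rw [List.getElem_map, List.getElem_map]
      exact ihM i hi j hj (.canon okA ha.good (wti i hi) (hSS i hi))
        (.canon okB hb.good (wtj j hj) (hTS j hj)) hf
    · intro j hj
      rw [List.length_map] at hj
      simp only [List.getElem_map, List.length_map]
      simpa [TArg.ren, SortE.subst, ren_apply] using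
        ihMx j hj ha (.canon okB hb.good (wtj j hj) (hTS j hj)) hf
    · simpa using hout.map _
  | @appvar _ X s ss U Y y T ts SS TSf hSS hTS M out hM hMy hout ihM ihMy =>
    simp only [TArg.ren, Expr.subst_var_eq, Expr.subst_app_eq, SortE.subst]
    have wti : ∀ i (hi : i < ss.length), WT TA (names X) ss[i] := fun i hi =>
      ha.wt_args (List.getElem_mem hi)
    have wtj : ∀ j (hj : j < ts.length), WT TB (names Y) ts[j] := fun j hj =>
      hb.wts _ (List.getElem_mem hj)
    refine .appvar (fun i => (SS i).subst (GATPaper.ren π))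
      (fun j => (TSf j).subst (GATPaper.ren τ)) ?_ ?_
      (fun i j => (M i j).subst (GATPaper.ren (ren₂ π τ))) _ ?_ ?_ ?_
    · intro i hi
      rw [List.length_map] at hi
      rw [List.getElem_map]
      exact (hSS i hi).ren okA (wti i hi) π
    · intro j hj
      rw [List.length_map] at hj
      rw [List.getElem_map]
      exact (hTS j hj).ren okB (wtj j hj) τ
    · intro i hi j hj
      rw [List.length_map] at hi hj
      rw [List.getElem_map, List.getElem_map]
      exact ihM i hi j hj (.canon okA ha.good (wti i hi) (hSS i hi))
        (.canon okB hb.good (wtj j hj) (hTS j hj)) hf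
    · intro i hi
      rw [List.length_map] at hi
      simp only [List.getElem_map, List.length_map]
      simpa [TArg.ren, SortE.subst, ren_apply] using
        ihMy i hi (.canon okA ha.good (wti i hi) (hSS i hi)) hb hf
    · simpa using hout.map _
  | @appapp_base X s ss U Y t ts V x hx e0 h0 g hg ih0 ihg =>
    have h1 := ih0 (.var ha.good ha.wts) hb hf
    rw [← Expr.substL_ren, ← pairsR_ren]
    simp only [TArg.ren, Expr.subst_app_eq, Expr.subst_var_eq] at h1 ⊢
    refine .appapp_base (ren_fresh hx) _ h1 _ fun j hj => ?_
    rw [length_renCtx] at hj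
    have := ihg j hj ha (.take hb.good hj) hf
    simp only [TArg.ren, Expr.subst_app_eq, Expr.subst_var_eq] at this
    simpa [← renCtx_take, ren_apply] using this
  | appapp_star => cases hf

theorem TTg.det {TA : Set (Judg A)} {TB : Set (Judg B)} (okA : SymbolsOK TA)
    (okB : SymbolsOK TB) {a : TArg A} {b : TArg B} {e e' : Expr (A.tensor B)}
    (h : TTg TA TB false a b e) (h' : TTg TA TB false a b e') (ha : a.WF TA) (hb : b.WF TB) :
    e = e' := by
  generalize hf : false = f at h
  induction h generalizing e' with
  | varvar => cases h'; rfl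
  | @varapp _ X x S ss Y t ts V SS TSf hSS hTS M out hM hMx hout ihM ihMx =>
    cases h' with
    | varapp SS' TSf' hSS' hTS' M' out' hM' hMx' hout' =>
      congr 1
      refine hout.det hout' fun i hi j hj => ?_
      have wtj := hb.wt_args (List.getElem_mem hj)
      have hbj := TArg.WF.canon okB hb.good wtj (hTS j hj)
      have ej := (hTS j hj).det okB hb.good (hTS' j hj)
      rcases Nat.lt_succ_iff_lt_or_eq.1 hi with hi | rfl
      · have wti := ha.wts _ (List.getElem_mem hi)
        have ei := (hSS i hi).det okA ha.good (hSS' i hi)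
        exact ihM i hi j hj (ei ▸ ej ▸ hM' i hi j hj) (.canon okA ha.good wti (hSS i hi)) hbj hf
      · exact ihMx j hj (ej ▸ hMx' j hj) ha hbj hf
  | @appvar _ X s ss U Y y T ts SS TSf hSS hTS M out hM hMy hout ihM ihMy =>
    cases h' with
    | appvar SS' TSf' hSS' hTS' M' out' hM' hMy' hout' =>
      congr 1
      refine hout.det hout' fun i hi j hj => ?_
      have wti := ha.wt_args (List.getElem_mem hi)
      have hai := TArg.WF.canon okA ha.good wti (hSS i hi)
      have ei := (hSS i hi).det okA ha.good (hSS' i hi)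
      rcases Nat.lt_succ_iff_lt_or_eq.1 hj with hj | rfl
      · have wtj := hb.wts _ (List.getElem_mem hj)
        have ej := (hTS j hj).det okB hb.good (hTS' j hj)
        exact ihM i hi j hj (ei ▸ ej ▸ hM' i hi j hj) hai (.canon okB hb.good wtj (hTS j hj)) hf
      · exact ihMy i hi (ei ▸ hMy' i hi) hai hb hf
  | @appapp_base X s ss U Y t ts V x hx e0 h0 g hg ih0 ihg =>
    cases h' with
    | @appapp_base _ _ _ _ _ _ _ _ x' hx' e0' h0' g' hg' =>
      classical
      have hgg : ∀ j < Y.length, g j = g' j := fun j hj =>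
        ihg j hj (hg' j hj) ha (.take hb.good hj) hf
      have hπ := swap_fixes hx' hx
      have key := h0'.ren okA okB (.var ha.good ha.wts) hb (Equiv.swap x' x) (Equiv.refl _)
      have e1 : TArg.ren (Equiv.swap x' x) ⟨X, .var x', U⟩ = ⟨X, .var x, U⟩ := by
        simp [TArg.ren, ren_apply, ha.good.renCtx_of_fixed hπ,
          SortE.subst_ren_of_fixed hπ fun z hz => ha.wts.mem hz]
      have e2 : TArg.ren (Equiv.refl _) ⟨Y, .app t ts, V⟩ = ⟨Y, .app t ts, V⟩ := by
        simp only [TArg.ren]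
        rw [hb.good.renCtx_of_fixed fun _ _ => rfl,
          SortE.subst_ren_of_fixed (fun _ _ => rfl) fun z hz => hb.wts.mem hz,
          Expr.subst_ren_of_fixed (fun _ _ => rfl) fun z hz => hb.mem_names hz]
      rw [e1, e2] at key
      rw [ih0 key (.var ha.good ha.wts) hb hf, Expr.substL, Expr.substL, Expr.subst_subst]
      refine Expr.subst_congr _ fun z hz => ?_
      obtain ⟨h1, h2⟩ := h0'.scope okA okB (.var ha.good ha.wts) hb hz
      rw [ren_apply, Expr.subst_var_eq]
      by_cases hzx : z.1 = x'
      · obtain ⟨q, hq, h5⟩ := List.mem_map.1 (h2.elim id hb.mem_names)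
        obtain ⟨j, hj, rfl⟩ := List.getElem_of_mem hq
        obtain rfl : z = (x', (Y[j]'hj).1) := Prod.ext hzx h5.symm
        have e3 : ren₂ (Equiv.swap x' x) (Equiv.refl B.Var) (x', (Y[j]'hj).1) =
            (x, (Y[j]'hj).1) := by simp
        rw [e3, lookupV_pairsR_getElem hb.good.1 g hj, lookupV_pairsR_getElem hb.good.1 g' hj,
          hgg j hj]
      · have hz1 : z.1 ∈ names X := h1.elim id fun h => absurd (occurs_var_iff.1 h) hzx
        have e3 : ren₂ (Equiv.swap x' x) (Equiv.refl B.Var) z = z := Prod.ext (hπ _ hz1) rfl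
        obtain ⟨p, hp, h6⟩ := List.mem_map.1 hz1
        rw [e3, lookupV_pairsR_of_ne (h6 ▸ hx p hp), lookupV_pairsR_of_ne hzx]
  | appapp_star => cases hf

section TSo

variable {TA : Set (Judg A)} {TB : Set (Judg B)} {X : PreCtx A} {x : A.Var} {U : SortE A}
  {Y : PreCtx B} {y : B.Var} {V : SortE B} {W W' : SortE (A.tensor B)}

theorem TSo.fresh_left (h : TSo TA TB false X x U Y y V W) : ∀ p ∈ X, p.1 ≠ x := by
  cases h; assumption

theorem TSo.fresh_right (h : TSo TA TB false X x U Y y V W) : ∀ p ∈ Y, p.1 ≠ y := by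
  cases h; assumption

theorem TSo.det (okA : SymbolsOK TA) (okB : SymbolsOK TB) (hX : Good TA X)
    (hU : WTs TA (names X) U) (hY : Good TB Y) (hV : WTs TB (names Y) V)
    (h : TSo TA TB false X x U Y y V W) (h' : TSo TA TB false X x U Y y V W') : W = W' := by
  cases h with
  | @mk S ss _ _ T ts hx hy SS TSf hSS hTS M out hM hMx hMy hout =>
  cases h' with
  | mk _ _ SS' TSf' hSS' hTS' M' out' hM' hMx' hMy' hout' =>
  have es := fun i hi => (hSS i hi).det okA hX (hSS' i hi)
  have et := fun j hj => (hTS j hj).det okB hY (hTS' j hj)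
  have hai := fun i (hi : i < ss.length) =>
    TArg.WF.canon okA hX (hU _ (List.getElem_mem hi)) (hSS i hi)
  have hbj := fun j (hj : j < ts.length) =>
    TArg.WF.canon okB hY (hV _ (List.getElem_mem hj)) (hTS j hj)
  congr 1
  have hl : out.length = out'.length := hout.1.trans hout'.1.symm
  refine List.ext_getElem (by simp [hl]) fun k hk hk' => ?_
  simp only [List.length_dropLast] at hk hk'
  simp only [List.getElem_dropLast]
  obtain ⟨i, hi, j, hj, rfl, e⟩ := hout.exists_of_getElem (by omega : k < out.length)
  rw [e, hout'.2 i j hi hj (by omega)]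
  rcases Nat.lt_succ_iff_lt_or_eq.1 hi with hi | rfl <;>
    rcases Nat.lt_succ_iff_lt_or_eq.1 hj with hj | rfl
  · exact (hM i hi j hj).det okA okB (es i hi ▸ et j hj ▸ hM' i hi j hj) (hai i hi) (hbj j hj)
  · exact (hMy i hi).det okA okB (es i hi ▸ hMy' i hi) (hai i hi) (.var hY hV)
  · exact (hMx j hj).det okA okB (et j hj ▸ hMx' j hj) (.var hX hU) (hbj j hj)
  · have := hout.1
    have : (ss.length + 1) * (ts.length + 1) = ss.length * (ts.length + 1) + (ts.length + 1) := by
      ring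
    omega

theorem TSo.scope (okA : SymbolsOK TA) (okB : SymbolsOK TB) (hX : Good TA X)
    (hU : WTs TA (names X) U) (hY : Good TB Y) (hV : WTs TB (names Y) V)
    (h : TSo TA TB false X x U Y y V W) {z : A.Var × B.Var} (hz : SOccurs (A := A.tensor B) z W) :
    (z.1 ∈ names X ∧ z.2 ∈ names Y) ∨ (z.1 = x ∧ z.2 ∈ names Y) ∨ (z.1 ∈ names X ∧ z.2 = y) := by
  cases h with
  | @mk S ss _ _ T ts hx hy SS TSf hSS hTS M out hM hMx hMy hout =>
  have wti := fun i (hi : i < ss.length) => hU _ (List.getElem_mem hi)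
  have wtj := fun j (hj : j < ts.length) => hV _ (List.getElem_mem hj)
  have hai := fun i (hi : i < ss.length) => TArg.WF.canon okA hX (wti i hi) (hSS i hi)
  have hbj := fun j (hj : j < ts.length) => TArg.WF.canon okB hY (wtj j hj) (hTS j hj)
  obtain ⟨e, he, hz⟩ := hz
  obtain ⟨k, hk, rfl⟩ := List.getElem_of_mem he
  simp only [List.length_dropLast] at hk
  simp only [List.getElem_dropLast] at hz
  obtain ⟨i, hi, j, hj, rfl, e⟩ := hout.exists_of_getElem (by omega : k < out.length)
  rw [e] at hz
  rcases Nat.lt_succ_iff_lt_or_eq.1 hi with hi | rfl <;>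
    rcases Nat.lt_succ_iff_lt_or_eq.1 hj with hj | rfl
  · obtain ⟨h1, h2⟩ := (hM i hi j hj).scope okA okB (hai i hi) (hbj j hj) hz
    exact .inl ⟨h1.elim id (wti i hi).mem, h2.elim id (wtj j hj).mem⟩
  · obtain ⟨h1, h2⟩ := (hMy i hi).scope okA okB (hai i hi) (.var hY hV) hz
    rw [occurs_var_iff] at h2
    have h1 := h1.elim id (wti i hi).mem
    exact h2.elim (fun h => .inl ⟨h1, h⟩) fun h => .inr (.inr ⟨h1, h⟩)
  · obtain ⟨h1, h2⟩ := (hMx j hj).scope okA okB (.var hX hU) (hbj j hj) hz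
    rw [occurs_var_iff] at h1
    have h2 := h2.elim id (wtj j hj).mem
    exact h1.elim (fun h => .inl ⟨h, h2⟩) fun h => .inr (.inl ⟨h, h2⟩)
  · have := hout.1
    have : (ss.length + 1) * (ts.length + 1) = ss.length * (ts.length + 1) + (ts.length + 1) := by
      ring
    omega

theorem TSo.ren (okA : SymbolsOK TA) (okB : SymbolsOK TB) (hX : Good TA X)
    (hU : WTs TA (names X) U) (hY : Good TB Y) (hV : WTs TB (names Y) V)
    (h : TSo TA TB false X x U Y y V W) (π : Equiv.Perm A.Var) (τ : Equiv.Perm B.Var) :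
    TSo TA TB false (renCtx π X) (π x) (U.subst (GATPaper.ren π)) (renCtx τ Y) (τ y)
      (V.subst (GATPaper.ren τ)) (W.subst (GATPaper.ren (ren₂ π τ))) := by
  cases h with
  | @mk S ss _ _ T ts hx hy SS TSf hSS hTS M out hM hMx hMy hout =>
  have wti := fun i (hi : i < ss.length) => hU _ (List.getElem_mem hi)
  have wtj := fun j (hj : j < ts.length) => hV _ (List.getElem_mem hj)
  have hai := fun i (hi : i < ss.length) => TArg.WF.canon okA hX (wti i hi) (hSS i hi)
  have hbj := fun j (hj : j < ts.length) => TArg.WF.canon okB hY (wtj j hj) (hTS j hj)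
  simp only [SortE.subst, List.map_dropLast]
  refine .mk (ren_fresh hx) (ren_fresh hy) (fun i => (SS i).subst (GATPaper.ren π))
    (fun j => (TSf j).subst (GATPaper.ren τ)) ?_ ?_
    (fun i j => (M i j).subst (GATPaper.ren (ren₂ π τ))) _ ?_ ?_ ?_ ?_
  · intro i hi
    rw [List.length_map] at hi
    rw [List.getElem_map]
    exact (hSS i hi).ren okA (wti i hi) π
  · intro j hj
    rw [List.length_map] at hj
    rw [List.getElem_map]
    exact (hTS j hj).ren okB (wtj j hj) τ
  · intro i hi j hj
    rw [List.length_map] at hi hj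
    rw [List.getElem_map, List.getElem_map]
    exact (hM i hi j hj).ren okA okB (hai i hi) (hbj j hj) π τ
  · intro j hj
    rw [List.length_map] at hj
    simp only [List.getElem_map, List.length_map]
    simpa [TArg.ren, SortE.subst, ren_apply] using
      (hMx j hj).ren okA okB (.var hX hU) (hbj j hj) π τ
  · intro i hi
    rw [List.length_map] at hi
    simp only [List.getElem_map, List.length_map]
    simpa [TArg.ren, SortE.subst, ren_apply] using
      (hMy i hi).ren okA okB (hai i hi) (.var hY hV) π τ
  · simpa using hout.map _

end TSo

section TCtx

variable {TA : Set (Judg A)} {TB : Set (Judg B)} {X : PreCtx A} {Y : PreCtx B}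
  {Z Z' : PreCtx (A.tensor B)}

theorem TCtx.lt (h : TCtx TA TB false X Y Z) {i j : ℕ} (hi : i < X.length) (hj : j < Y.length) :
    i * Y.length + j < Z.length :=
  h.1 ▸ grid_lt hi hj

theorem TCtx.getElem_fst (h : TCtx TA TB false X Y Z) {i j : ℕ} (hi : i < X.length)
    (hj : j < Y.length) : (Z[i * Y.length + j]'(h.lt hi hj)).1 = ((X[i]'hi).1, (Y[j]'hj).1) :=
  (h.2 i j hi hj _).1

theorem TCtx.tso (h : TCtx TA TB false X Y Z) {i j : ℕ} (hi : i < X.length)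
    (hj : j < Y.length) : TSo TA TB false (X.take i) (X[i]'hi).1 (X[i]'hi).2 (Y.take j)
      (Y[j]'hj).1 (Y[j]'hj).2 (Z[i * Y.length + j]'(h.lt hi hj)).2 :=
  (h.2 i j hi hj _).2

theorem TCtx.exists_index (h : TCtx TA TB false X Y Z) {k : ℕ} (hk : k < Z.length) :
    ∃ i j, i < X.length ∧ j < Y.length ∧ k = i * Y.length + j := by
  obtain ⟨h1, h2, h3⟩ := grid_index (h.1 ▸ hk)
  exact ⟨_, _, h1, h2, h3.symm⟩

theorem TCtx.nodup (h : TCtx TA TB false X Y Z) (hX : (names X).Nodup) (hY : (names Y).Nodup) :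
    (names Z).Nodup := by
  rw [List.nodup_iff_injective_getElem]
  rintro ⟨k, hk⟩ ⟨l, hl⟩ e
  simp only [names, List.length_map] at hk hl
  simp only [names, List.getElem_map] at e
  obtain ⟨i, j, hi, hj, rfl⟩ := h.exists_index hk
  obtain ⟨i', j', hi', hj', rfl⟩ := h.exists_index hl
  rw [h.getElem_fst hi hj, h.getElem_fst hi' hj', Prod.mk.injEq] at e
  have e1 : (names X)[i]'(by simpa using hi) = (names X)[i']'(by simpa using hi') := by
    simpa using e.1
  have e2 : (names Y)[j]'(by simpa using hj) = (names Y)[j']'(by simpa using hj') := by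
    simpa using e.2
  rw [hX.getElem_inj_iff] at e1
  rw [hY.getElem_inj_iff] at e2
  subst e1 e2
  rfl

theorem TCtx.ren (okA : SymbolsOK TA) (okB : SymbolsOK TB) (hX : Good TA X) (hY : Good TB Y)
    (h : TCtx TA TB false X Y Z) (π : Equiv.Perm A.Var) (τ : Equiv.Perm B.Var) :
    TCtx TA TB false (renCtx π X) (renCtx τ Y) (renCtx (ren₂ π τ) Z) := by
  refine ⟨by simpa [renCtx] using h.1, fun i j hi hj hk => ?_⟩
  simp only [length_renCtx] at hi hj
  have hk' := h.lt hi hj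
  have e : ∀ l (hl : l < (renCtx (A := A.tensor B) (ren₂ π τ) Z).length)
      (_ : l = i * Y.length + j), (renCtx (A := A.tensor B) (ren₂ π τ) Z)[l] =
        (ren₂ π τ Z[i * Y.length + j].1, Z[i * Y.length + j].2.subst (GATPaper.ren (ren₂ π τ))) := by
    rintro _ hl rfl
    exact getElem_renCtx (A := A.tensor B) (ren₂ π τ) Z _ hl
  rw [e _ hk (by simp)]
  simp only [getElem_renCtx, ← renCtx_take]
  refine ⟨?_, (h.tso hi hj).ren okA okB (hX.take i) (hX.2 i hi) (hY.take j) (hY.2 j hj) π τ⟩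
  rw [h.getElem_fst hi hj]
  rfl

/-- The restriction of the tensor of two precontexts to initial segments. -/
theorem TCtx.exists_take (h : TCtx TA TB false X Y Z) {a b : ℕ} (ha : a ≤ X.length)
    (hb : b ≤ Y.length) : ∃ Z0, TCtx TA TB false (X.take a) (Y.take b) Z0 ∧
      ∀ k (hk : k < Z0.length), ∃ i j, ∃ (hi : i < a) (hj : j < b), k = i * b + j ∧
        Z0[k] = Z[i * Y.length + j]'(h.lt (hi.trans_le ha) (hj.trans_le hb)) := by
  have hlt : ∀ k : Fin (a * b), (k.1 / b) * Y.length + k.1 % b < Z.length := fun k =>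
    have := grid_index k.2
    h.lt (this.1.trans_le ha) (this.2.1.trans_le hb)
  refine ⟨(List.finRange (a * b)).map fun k => Z[(k.1 / b) * Y.length + k.1 % b]'(hlt k), ⟨?_, ?_⟩,
    ?_⟩
  · simp [ha, hb]
  · intro i j hi hj hk
    have hl : (Y.take b).length = b := by simp [hb]
    have hi' : i < a := by simp at hi; exact hi.1
    have hj' : j < b := by simp at hj; exact hj.1
    obtain ⟨e1, e2⟩ : (i * b + j) / b = i ∧ (i * b + j) % b = j := by
      obtain ⟨h1, h2, h3⟩ := grid_index (grid_lt hi' hj')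
      exact grid_inj h2 hj' h3
    simp only [hl, List.getElem_map, List.getElem_finRange, List.getElem_take, e1, e2,
      Fin.val_cast, List.take_take, min_eq_left hi'.le, min_eq_left hj'.le]
    exact ⟨h.getElem_fst _ _, h.tso _ _⟩
  · intro k hk
    simp only [List.length_map, List.length_finRange] at hk
    obtain ⟨h1, h2, h3⟩ := grid_index hk
    exact ⟨_, _, h1, h2, h3.symm, by simp⟩

end TCtx

theorem TTg.var_var {TA : Set (Judg A)} {TB : Set (Judg B)} {b : Bool} {X : PreCtx A}
    {U : SortE A} {x : A.Var} {Y : PreCtx B} {V : SortE B} {y : B.Var} {e : Expr (A.tensor B)}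
    (h : TTg TA TB b ⟨X, .var x, U⟩ ⟨Y, .var y, V⟩ e) : e = .var (x, y) := by
  cases h; rfl

theorem TCtx.eq_ctxVars {TA : Set (Judg A)} {TB : Set (Judg B)} {X : PreCtx A} {Y : PreCtx B}
    {Z : PreCtx (A.tensor B)} {m n : ℕ} {M : ℕ → ℕ → Expr (A.tensor B)}
    {out : List (Expr (A.tensor B))} (h : TCtx TA TB false X Y Z) (hm : m = X.length)
    (hn : n = Y.length) (hout : IsGrid m n M out)
    (hM : ∀ i (hi : i < X.length) j (hj : j < Y.length), M i j = .var (X[i].1, Y[j].1)) :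
    out = ctxVars Z := by
  subst hm hn
  refine List.ext_getElem (by rw [hout.1, ctxVars, List.length_map, h.1]) fun k hk hk' => ?_
  obtain ⟨i, hi, j, hj, rfl, e⟩ := hout.exists_of_getElem hk
  simp only [ctxVars, List.getElem_map]
  rw [e, hM i hi j hj, h.getElem_fst hi hj]

theorem TCtx.dropLast_eq_ctxVars {TA : Set (Judg A)} {TB : Set (Judg B)} {X : PreCtx A}
    {Y : PreCtx B} {Z : PreCtx (A.tensor B)} {m n : ℕ} {M : ℕ → ℕ → Expr (A.tensor B)}
    {out : List (Expr (A.tensor B))} (h : TCtx TA TB false X Y Z) (hm : m + 1 = X.length)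
    (hn : n + 1 = Y.length) (hout : IsGrid (m + 1) (n + 1) M out)
    (hM : ∀ i (hi : i < X.length) j (hj : j < Y.length), i < m ∨ j < n →
      M i j = .var (X[i].1, Y[j].1)) :
    out.dropLast = ctxVars Z.dropLast := by
  have hl : out.length = Z.length := by rw [hout.1, h.1, hm, hn]
  refine List.ext_getElem (by simp [ctxVars, hl]) fun k hk hk' => ?_
  simp only [List.length_dropLast] at hk
  obtain ⟨i, hi, j, hj, rfl, e⟩ := hout.exists_of_getElem (by omega : k < out.length)
  simp only [ctxVars, List.getElem_map, List.getElem_dropLast]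
  rw [e, hM i (hm ▸ hi) j (hn ▸ hj)]
  · have := h.getElem_fst (hm ▸ hi) (hn ▸ hj)
    simp only [← hn] at this
    rw [this]
  · by_contra hc
    have e1 : i = m := by omega
    have e2 : j = n := by omega
    subst e1 e2
    have := hout.1
    have : (i + 1) * (j + 1) = i * (j + 1) + (j + 1) := by ring
    omega

theorem tensorAx_shaped {TA : Set (Judg A)} {TB : Set (Judg B)} {chA : PreCtx A → A.Var}
    {chB : PreCtx B → B.Var} (sA : Shaped TA) (sB : Shaped TB) :
    Shaped (tensorAx TA TB chA chB) := by
  constructor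
  · rintro Z W ⟨J, J', hJ, hJ', hT⟩
    cases hT with
    | @ss X U Y V Z W hZ hW =>
      have eU := sA.sort_shape _ _ hJ
      have eV := sB.sort_shape _ _ hJ'
      cases hW with
      | @mk S ss _ _ T ts hx hy SS TSf hSS hTS M out hM hMx hMy hout =>
      have eU : ss = ctxVars X := eU
      have eV : ts = ctxVars Y := eV
      subst eU eV
      have lX : (ctxVars X).length = X.length := List.length_map _
      have lY : (ctxVars Y).length = Y.length := List.length_map _
      refine hZ.dropLast_eq_ctxVars (by simp [lX]) (by simp [lY]) hout fun i hi j hj hij => ?_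
      simp only [List.length_append, List.length_singleton] at hi hj
      rcases Nat.lt_succ_iff_lt_or_eq.1 hi with hi | rfl <;>
        rcases Nat.lt_succ_iff_lt_or_eq.1 hj with hj | rfl
      · have := hM i (by omega) j (by omega)
        simp only [ctxVars, List.getElem_map] at this
        simp [this.var_var, List.getElem_append_left, hi, hj]
      · have := hMy i (by omega)
        rw [lY] at this
        simp only [ctxVars, List.getElem_map] at this
        simp [this.var_var, List.getElem_append_left, hi]
      · have := hMx j (by omega)
        rw [lX] at this
        simp only [ctxVars, List.getElem_map] at this
        simp [this.var_var, List.getElem_append_left, hj]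
      · omega
  · rintro Z e W ⟨J, J', hJ, hJ', hT⟩
    cases hT with
    | @st X U Y v V Z e W g hZ he hW hg =>
      have eU := sA.sort_shape _ _ hJ
      obtain ⟨t, rfl⟩ := sB.term_shape _ _ _ hJ'
      cases he with
      | @varapp _ _ _ S ss _ _ _ _ SS TSf hSS hTS M out hM hMx hout =>
      have eU : ss = ctxVars X := eU
      subst eU
      have lX : (ctxVars X).length = X.length := List.length_map _
      have lY : (ctxVars Y).length = Y.length := List.length_map _
      refine ⟨_, congrArg _ (hZ.eq_ctxVars (by simp [lX]) (by simp [lY]) hout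
        fun i hi j hj => ?_)⟩
      simp only [List.length_append, List.length_singleton] at hi
      rcases Nat.lt_succ_iff_lt_or_eq.1 hi with hi | rfl
      · have := hM i (by omega) j (by omega)
        simp only [ctxVars, List.getElem_map] at this
        simp [this.var_var, List.getElem_append_left, hi]
      · have := hMx j (by omega)
        rw [lX] at this
        simp only [ctxVars, List.getElem_map] at this
        simp [this.var_var]
    | @ts X u U Y V Z e W g hZ he hW hg =>
      obtain ⟨s, rfl⟩ := sA.term_shape _ _ _ hJ
      have eV := sB.sort_shape _ _ hJ'
      cases he with
      | @appvar _ _ _ _ _ _ _ T ts SS TSf hSS hTS M out hM hMy hout =>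
      have eV : ts = ctxVars Y := eV
      subst eV
      have lX : (ctxVars X).length = X.length := List.length_map _
      have lY : (ctxVars Y).length = Y.length := List.length_map _
      refine ⟨_, congrArg _ (hZ.eq_ctxVars (by simp [lX]) (by simp [lY]) hout
        fun i hi j hj => ?_)⟩
      simp only [List.length_append, List.length_singleton] at hj
      rcases Nat.lt_succ_iff_lt_or_eq.1 hj with hj | rfl
      · have := hM i (by omega) j (by omega)
        simp only [ctxVars, List.getElem_map] at this
        simp [this.var_var, List.getElem_append_left, hj]
      · have := hMy i (by omega)
        rw [lY] at this
        simp only [ctxVars, List.getElem_map] at this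
        simp [this.var_var]

theorem Expr.subst_ren_ren {π : Equiv.Perm A.Var} (hπ : ∀ z, π (π z) = z) (e : Expr A) :
    (e.subst (ren π)).subst (ren π) = e := by
  rw [Expr.subst_subst]
  conv_rhs => rw [← Expr.subst_var_self e]
  exact Expr.subst_congr _ fun z _ => by rw [ren_apply, Expr.subst_var_eq, ren_apply, hπ]

theorem SortE.subst_ren_ren {π : Equiv.Perm A.Var} (hπ : ∀ z, π (π z) = z) (U : SortE A) :
    (U.subst (ren π)).subst (ren π) = U := by
  rw [SortE.subst_subst]
  conv_rhs => rw [← SortE.subst_var_self U]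
  exact SortE.subst_congr _ fun z _ => by rw [ren_apply, Expr.subst_var_eq, ren_apply, hπ]

theorem ren₂_ren₂ {π : Equiv.Perm A.Var} {τ : Equiv.Perm B.Var} (hπ : ∀ z, π (π z) = z)
    (hτ : ∀ z, τ (τ z) = z) (z : A.Var × B.Var) : ren₂ π τ (ren₂ π τ z) = z :=
  Prod.ext (hπ _) (hτ _)

theorem renCtx_snoc {Ax : Set (Judg A)} {X : PreCtx A} {U : SortE A} {x x' : A.Var}
    [DecidableEq A.Var] (hX : Good Ax X) (hU : WTs Ax (names X) U) (hx : ∀ p ∈ X, p.1 ≠ x)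
    (hx' : ∀ p ∈ X, p.1 ≠ x') :
    renCtx (Equiv.swap x x') (X ++ [(x, U)]) = X ++ [(x', U)] := by
  have hπ := swap_fixes hx hx'
  have := hX.renCtx_of_fixed hπ
  unfold renCtx at this ⊢
  rw [List.map_append, this]
  simp [SortE.subst_ren_of_fixed hπ fun z hz => hU.mem hz]

theorem vars_of_renCtx {Ax : Set (Judg A)} {π : Equiv.Perm A.Var} (hπ : ∀ z, π (π z) = z)
    {Γ Z : PreCtx A} (hv : ∀ p ∈ Z, Derivable Ax (.term Γ (.var p.1) p.2)) :
    ∀ p ∈ renCtx π Z, Derivable Ax (.term Γ (ren π p.1) (p.2.subst (ren π))) := by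
  intro p hp
  obtain ⟨q, hq, rfl⟩ := List.mem_map.1 hp
  rw [ren_apply, hπ, SortE.subst_ren_ren hπ]
  exact hv q hq

section

variable {TA : Set (Judg A)} {TB : Set (Judg B)} {chA : PreCtx A → A.Var}
  {chB : PreCtx B → B.Var} {h : ℕ} {X : PreCtx A} {x : A.Var} {U : SortE A}
  {Y : PreCtx B} {y : B.Var} {V : SortE B} {W : SortE (A.tensor B)}
  {Z Γ : PreCtx (A.tensor B)}

theorem ren_swap_pairsR {Ax : Set (Judg B)} [DecidableEq A.Var] [DecidableEq B.Var] {x' : A.Var}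
    {y' : B.Var} (hY : Good Ax Y)
    (hsc : ∀ z : A.Var × B.Var, SOccurs (A := A.tensor B) z W →
      (z.1 ∈ names X ∧ z.2 ∈ names Y) ∨ (z.1 = x ∧ z.2 ∈ names Y) ∨ (z.1 ∈ names X ∧ z.2 = y))
    (hx : ∀ p ∈ X, p.1 ≠ x) (hx' : ∀ p ∈ X, p.1 ≠ x') (hy : ∀ p ∈ Y, p.1 ≠ y)
    (hy' : ∀ p ∈ Y, p.1 ≠ y') {g : ℕ → Expr (A.tensor B)}
    (hg : ∀ j < Y.length, (g j).subst (ren (ren₂ (Equiv.refl _) (Equiv.swap y y'))) = g j) :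
    ((W.subst (ren (ren₂ (Equiv.swap x x') (Equiv.swap y y')))).substL (pairsR x' Y g)).subst
      (ren (ren₂ (Equiv.refl _) (Equiv.swap y y'))) = W.substL (pairsR x Y g) := by
  rw [SortE.substL, SortE.substL, SortE.subst_subst, SortE.subst_subst]
  refine SortE.subst_congr _ fun z hz => ?_
  have fx := swap_fixes hx hx'
  have fy := swap_fixes hy hy'
  have ne : ∀ z1 ∈ names X, z1 ≠ x ∧ z1 ≠ x' := by
    intro z1 h1
    obtain ⟨p, hp, rfl⟩ := List.mem_map.1 h1
    exact ⟨hx p hp, hx' p hp⟩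
  obtain ⟨z1, z2⟩ := z
  rw [ren_apply, Expr.subst_var_eq]
  rcases hsc _ hz with ⟨h1, h2⟩ | ⟨rfl, h2⟩ | ⟨h1, rfl⟩
  · have e : ren₂ (Equiv.swap x x') (Equiv.swap y y') (z1, z2) = (z1, z2) :=
      Prod.ext (fx _ h1) (fy _ h2)
    rw [e, lookupV_pairsR_of_ne (ne _ h1).2, lookupV_pairsR_of_ne (ne _ h1).1,
      Expr.subst_var_eq, ren_apply]
    exact congrArg _ (Prod.ext rfl (fy _ h2))
  · obtain ⟨q, hq, rfl⟩ := List.mem_map.1 h2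
    obtain ⟨j, hj, rfl⟩ := List.getElem_of_mem hq
    have e : ren₂ (Equiv.swap z1 x') (Equiv.swap y y') (z1, Y[j].1) = (x', Y[j].1) :=
      Prod.ext (Equiv.swap_apply_left _ _) (fy _ h2)
    rw [e, lookupV_pairsR_getElem hY.1 g hj, lookupV_pairsR_getElem hY.1 g hj, hg j hj]
  · have e : ren₂ (Equiv.swap x x') (Equiv.swap z2 y') (z1, z2) = (z1, y') :=
      Prod.ext (fx _ h1) (Equiv.swap_apply_left _ _)
    rw [e, lookupV_pairsR_of_ne (z := (z1, y')) (ne _ h1).2,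
      lookupV_pairsR_of_ne (z := (z1, z2)) (ne _ h1).1,
      Expr.subst_var_eq, ren_apply]
    exact congrArg _ (Prod.ext rfl (Equiv.swap_apply_right _ _))

theorem ren_swap_pairsL {Ax : Set (Judg A)} [DecidableEq A.Var] [DecidableEq B.Var] {x' : A.Var}
    {y' : B.Var} (hX : Good Ax X)
    (hsc : ∀ z : A.Var × B.Var, SOccurs (A := A.tensor B) z W →
      (z.1 ∈ names X ∧ z.2 ∈ names Y) ∨ (z.1 = x ∧ z.2 ∈ names Y) ∨ (z.1 ∈ names X ∧ z.2 = y))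
    (hx : ∀ p ∈ X, p.1 ≠ x) (hx' : ∀ p ∈ X, p.1 ≠ x') (hy : ∀ p ∈ Y, p.1 ≠ y)
    (hy' : ∀ p ∈ Y, p.1 ≠ y') {g : ℕ → Expr (A.tensor B)}
    (hg : ∀ i < X.length, (g i).subst (ren (ren₂ (Equiv.swap x x') (Equiv.refl _))) = g i) :
    ((W.subst (ren (ren₂ (Equiv.swap x x') (Equiv.swap y y')))).substL (pairsL X y' g)).subst
      (ren (ren₂ (Equiv.swap x x') (Equiv.refl _))) = W.substL (pairsL X y g) := by
  rw [SortE.substL, SortE.substL, SortE.subst_subst, SortE.subst_subst]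
  refine SortE.subst_congr _ fun z hz => ?_
  have fx := swap_fixes hx hx'
  have fy := swap_fixes hy hy'
  have ne : ∀ z2 ∈ names Y, z2 ≠ y ∧ z2 ≠ y' := by
    intro z2 h2
    obtain ⟨p, hp, rfl⟩ := List.mem_map.1 h2
    exact ⟨hy p hp, hy' p hp⟩
  obtain ⟨z1, z2⟩ := z
  rw [ren_apply, Expr.subst_var_eq]
  rcases hsc _ hz with ⟨h1, h2⟩ | ⟨rfl, h2⟩ | ⟨h1, rfl⟩
  · have e : ren₂ (Equiv.swap x x') (Equiv.swap y y') (z1, z2) = (z1, z2) :=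
      Prod.ext (fx _ h1) (fy _ h2)
    rw [e, lookupV_pairsL_of_ne (ne _ h2).2, lookupV_pairsL_of_ne (ne _ h2).1,
      Expr.subst_var_eq, ren_apply]
    exact congrArg _ (Prod.ext (fx _ h1) rfl)
  · have e : ren₂ (Equiv.swap z1 x') (Equiv.swap y y') (z1, z2) = (x', z2) :=
      Prod.ext (Equiv.swap_apply_left _ _) (fy _ h2)
    rw [e, lookupV_pairsL_of_ne (z := (x', z2)) (ne _ h2).2,
      lookupV_pairsL_of_ne (z := (z1, z2)) (ne _ h2).1,
      Expr.subst_var_eq, ren_apply]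
    exact congrArg _ (Prod.ext (Equiv.swap_apply_right _ _) rfl)
  · obtain ⟨q, hq, rfl⟩ := List.mem_map.1 h1
    obtain ⟨i, hi, rfl⟩ := List.getElem_of_mem hq
    have e : ren₂ (Equiv.swap x x') (Equiv.swap z2 y') (X[i].1, z2) = (X[i].1, y') :=
      Prod.ext (fx _ h1) (Equiv.swap_apply_left _ _)
    rw [e, lookupV_pairsL_getElem hX.1 g hi, lookupV_pairsL_getElem hX.1 g hi, hg i hi]

theorem tensor_sort (hA : IsGAT TA) (hB : IsGAT TB) (hchA : FreshCh chA) (hchB : FreshCh chB)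
    (hder : hDerivable TA TB chA chB h) (hXU : Derivable TA (.sort X U))
    (hYV : Derivable TB (.sort Y V)) (hh : ht TA (.sort X U) * ht TB (.sort Y V) ≤ h)
    (hZ : TCtx TA TB false (X ++ [(x, U)]) (Y ++ [(y, V)]) Z)
    (hW : TSo TA TB false X x U Y y V W)
    (hΓ : Derivable (tensorAx TA TB chA chB) (.ctx Γ))
    (hv : ∀ p ∈ Z.dropLast, Derivable (tensorAx TA TB chA chB) (.term Γ (.var p.1) p.2)) :
    Derivable (tensorAx TA TB chA chB) (.sort Γ W) := by
  classical
  have sA := hA.1.shaped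
  have sB := hB.1.shaped
  have gX := (hXU.ctx_of_sort sA).good sA
  have gY := (hYV.ctx_of_sort sB).good sB
  have wU := hXU.wts sA
  have wV := hYV.wts sB
  have hx := hW.fresh_left
  have hy := hW.fresh_right
  have hZ' := hZ.ren hA.symbolsOK hB.symbolsOK (gX.snoc hx wU) (gY.snoc hy wV)
    (Equiv.swap x (chA X)) (Equiv.swap y (chB Y))
  have hW' := hW.ren hA.symbolsOK hB.symbolsOK gX wU gY wV
    (Equiv.swap x (chA X)) (Equiv.swap y (chB Y))
  have fX := swap_fixes hx (hchA X)
  have fY := swap_fixes hy (hchB Y)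
  rw [renCtx_snoc gX wU hx (hchA X), renCtx_snoc gY wV hy (hchB Y)] at hZ'
  rw [gX.renCtx_of_fixed fX, gY.renCtx_of_fixed fY,
    SortE.subst_ren_of_fixed fX fun z hz => wU.mem hz,
    SortE.subst_ren_of_fixed fY fun z hz => wV.mem hz, Equiv.swap_apply_left,
    Equiv.swap_apply_left] at hW'
  have key := hder _ _ _ hXU hYV hh (.ss hZ' hW')
  have hρ : ∀ z, ren₂ (Equiv.swap x (chA X)) (Equiv.swap y (chB Y))
      (ren₂ (Equiv.swap x (chA X)) (Equiv.swap y (chB Y)) z) = z :=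
    ren₂_ren₂ (by simp) (by simp)
  have e : (renCtx (A := A.tensor B) (ren₂ (Equiv.swap x (chA X)) (Equiv.swap y (chB Y)))
      Z).dropLast = renCtx (A := A.tensor B)
        (ren₂ (Equiv.swap x (chA X)) (Equiv.swap y (chB Y))) Z.dropLast :=
    List.map_dropLast.symm
  rw [e] at key
  have := key.subst (tensorAx_shaped sA sB) hΓ
    (vars_of_renCtx (A := A.tensor B) (π := ren₂ (Equiv.swap x (chA X)) (Equiv.swap y (chB Y)))
      hρ hv)
  rw [Judg.subst, SortE.subst_ren_ren (A := A.tensor B) hρ] at this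
  exact this

end

theorem ren_refl : ren (Equiv.refl A.Var) = Expr.var := rfl

theorem renCtx_refl (X : PreCtx A) : renCtx (Equiv.refl _) X = X := by
  simp [renCtx, ren_refl, SortE.subst_var_self]

theorem TArg.ren_refl (a : TArg A) : a.ren (Equiv.refl _) = a := by
  simp [TArg.ren, renCtx_refl, GATPaper.ren_refl, SortE.subst_var_self, Expr.subst_var_self]

theorem TArg.ren_var {Ax : Set (Judg A)} {X : PreCtx A} {U : SortE A} {x x' : A.Var}
    [DecidableEq A.Var] (hX : Good Ax X) (hU : WTs Ax (names X) U) (hx : ∀ p ∈ X, p.1 ≠ x)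
    (hx' : ∀ p ∈ X, p.1 ≠ x') :
    TArg.ren (Equiv.swap x x') ⟨X, .var x, U⟩ = ⟨X, .var x', U⟩ := by
  have hπ := swap_fixes hx hx'
  simp [TArg.ren, ren_apply, hX.renCtx_of_fixed hπ,
    SortE.subst_ren_of_fixed hπ fun z hz => hU.mem hz]

theorem Derivable.targ_wf {Ax : Set (Judg A)} {X : PreCtx A} {u : Expr A} {U : SortE A}
    (h : Derivable Ax (.term X u U)) (hs : Shaped Ax) : TArg.WF Ax ⟨X, u, U⟩ :=
  have h' := h.sort_of_term hs
  .of_wt ((h'.ctx_of_sort hs).good hs) (h.wt hs) (h'.wts hs)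

theorem TTg.ren_take_right {TA : Set (Judg A)} {TB : Set (Judg B)} (okA : SymbolsOK TA)
    (okB : SymbolsOK TB) {a : TArg A} {Y : PreCtx B} {j : ℕ} {hj : j < Y.length}
    {e : Expr (A.tensor B)} (ha : a.WF TA) (hY : Good TB Y)
    (h : TTg TA TB false a ⟨Y.take j, .var (Y[j]'hj).1, (Y[j]'hj).2⟩ e)
    {τ : Equiv.Perm B.Var} (hτ : ∀ z ∈ names Y, τ z = z) :
    e.subst (GATPaper.ren (ren₂ (Equiv.refl _) τ)) = e := by
  conv_rhs => rw [← Expr.subst_var_self e]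
  refine Expr.subst_congr _ fun z hz => congrArg Expr.var (Prod.ext rfl (hτ _ ?_))
  rcases (h.scope okA okB ha (.take hY hj) hz).2 with h1 | h1
  · exact names_take_subset h1
  · rw [occurs_var_iff.1 h1]
    exact List.mem_map_of_mem (List.getElem_mem hj)

theorem TTg.ren_take_left {TA : Set (Judg A)} {TB : Set (Judg B)} (okA : SymbolsOK TA)
    (okB : SymbolsOK TB) {X : PreCtx A} {b : TArg B} {i : ℕ} {hi : i < X.length}
    {e : Expr (A.tensor B)} (hX : Good TA X) (hb : b.WF TB)
    (h : TTg TA TB false ⟨X.take i, .var (X[i]'hi).1, (X[i]'hi).2⟩ b e)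
    {π : Equiv.Perm A.Var} (hπ : ∀ z ∈ names X, π z = z) :
    e.subst (GATPaper.ren (ren₂ π (Equiv.refl _))) = e := by
  conv_rhs => rw [← Expr.subst_var_self e]
  refine Expr.subst_congr _ fun z hz => congrArg Expr.var (Prod.ext (hπ _ ?_) rfl)
  rcases (h.scope okA okB (.take hX hi) hb hz).1 with h1 | h1
  · exact names_take_subset h1
  · rw [occurs_var_iff.1 h1]
    exact List.mem_map_of_mem (List.getElem_mem hi)

section

variable {TA : Set (Judg A)} {TB : Set (Judg B)} {chA : PreCtx A → A.Var}
  {chB : PreCtx B → B.Var} {h : ℕ} {X : PreCtx A} {x : A.Var} {U : SortE A}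
  {Y : PreCtx B} {y : B.Var} {V : SortE B} {W : SortE (A.tensor B)}
  {Z Γ : PreCtx (A.tensor B)} {g : ℕ → Expr (A.tensor B)} {e e' : Expr (A.tensor B)}

theorem tensor_term_sort {u : Expr A} (hA : IsGAT TA) (hB : IsGAT TB) (hchA : FreshCh chA)
    (hchB : FreshCh chB) (hder : hDerivable TA TB chA chB h) (hu : Derivable TA (.term X u U))
    (hYV : Derivable TB (.sort Y V)) (hh : ht TA (.term X u U) * ht TB (.sort Y V) ≤ h)
    (hZ : TCtx TA TB false X (Y ++ [(y, V)]) Z)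
    (he : TTg TA TB false ⟨X, u, U⟩ ⟨Y, .var y, V⟩ e) (hW : TSo TA TB false X x U Y y V W)
    (hg : ∀ j (hj : j < Y.length),
      TTg TA TB false ⟨X, u, U⟩ ⟨Y.take j, .var (Y[j]'hj).1, (Y[j]'hj).2⟩ (g j))
    (hΓ : Derivable (tensorAx TA TB chA chB) (.ctx Γ))
    (hv : ∀ p ∈ Z, Derivable (tensorAx TA TB chA chB) (.term Γ (.var p.1) p.2)) :
    Derivable (tensorAx TA TB chA chB) (.term Γ e (W.substL (pairsR x Y g))) := by
  classical
  have sA := hA.1.shaped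
  have sB := hB.1.shaped
  have okA := hA.symbolsOK
  have okB := hB.symbolsOK
  have hXU := hu.sort_of_term sA
  have gX := (hXU.ctx_of_sort sA).good sA
  have gY := (hYV.ctx_of_sort sB).good sB
  have wU := hXU.wts sA
  have wV := hYV.wts sB
  have hx := hW.fresh_left
  have hy := hW.fresh_right
  have fX := swap_fixes hx (hchA X)
  have fY := swap_fixes hy (hchB Y)
  have hZ' := hZ.ren okA okB gX (gY.snoc hy wV) (Equiv.refl _) (Equiv.swap y (chB Y))
  have hW' := hW.ren okA okB gX wU gY wV (Equiv.swap x (chA X)) (Equiv.swap y (chB Y))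
  have he' := he.ren okA okB (hu.targ_wf sA) (.var gY wV) (Equiv.refl _) (Equiv.swap y (chB Y))
  rw [renCtx_refl, renCtx_snoc gY wV hy (hchB Y)] at hZ'
  rw [gX.renCtx_of_fixed fX, gY.renCtx_of_fixed fY,
    SortE.subst_ren_of_fixed fX fun z hz => wU.mem hz,
    SortE.subst_ren_of_fixed fY fun z hz => wV.mem hz, Equiv.swap_apply_left,
    Equiv.swap_apply_left] at hW'
  rw [TArg.ren_refl, TArg.ren_var gY wV hy (hchB Y)] at he'
  have key := hder _ _ _ hu hYV hh (.ts hZ' he' hW' hg)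
  have hρ : ∀ z, ren₂ (Equiv.refl A.Var) (Equiv.swap y (chB Y))
      (ren₂ (Equiv.refl A.Var) (Equiv.swap y (chB Y)) z) = z :=
    ren₂_ren₂ (by simp) (by simp)
  have := key.subst (tensorAx_shaped sA sB) hΓ
    (vars_of_renCtx (A := A.tensor B) (π := ren₂ (Equiv.refl _) (Equiv.swap y (chB Y))) hρ hv)
  rw [Judg.subst, Expr.subst_ren_ren (A := A.tensor B) hρ,
    ren_swap_pairsR gY (fun z hz => hW.scope okA okB gX wU gY wV hz) hx (hchA X) hy (hchB Y)
      fun j hj => (hg j hj).ren_take_right okA okB (hu.targ_wf sA) gY fY] at this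
  exact this

theorem tensor_termEq_sort {u v : Expr A} (hA : IsGAT TA) (hB : IsGAT TB) (hchA : FreshCh chA)
    (hchB : FreshCh chB) (hder : hDerivable TA TB chA chB h)
    (huv : Derivable TA (.termEq X u v U)) (hYV : Derivable TB (.sort Y V))
    (hh : ht TA (.termEq X u v U) * ht TB (.sort Y V) ≤ h)
    (hZ : TCtx TA TB false X (Y ++ [(y, V)]) Z)
    (he : TTg TA TB false ⟨X, u, U⟩ ⟨Y, .var y, V⟩ e)
    (he' : TTg TA TB false ⟨X, v, U⟩ ⟨Y, .var y, V⟩ e') (hW : TSo TA TB false X x U Y y V W)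
    (hg : ∀ j (hj : j < Y.length),
      TTg TA TB false ⟨X, u, U⟩ ⟨Y.take j, .var (Y[j]'hj).1, (Y[j]'hj).2⟩ (g j))
    (hΓ : Derivable (tensorAx TA TB chA chB) (.ctx Γ))
    (hv : ∀ p ∈ Z, Derivable (tensorAx TA TB chA chB) (.term Γ (.var p.1) p.2)) :
    Derivable (tensorAx TA TB chA chB) (.termEq Γ e e' (W.substL (pairsR x Y g))) := by
  classical
  have sA := hA.1.shaped
  have sB := hB.1.shaped
  have okA := hA.symbolsOK
  have okB := hB.symbolsOK
  have hu := huv.term_left sA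
  have hXU := hu.sort_of_term sA
  have gX := (hXU.ctx_of_sort sA).good sA
  have gY := (hYV.ctx_of_sort sB).good sB
  have wU := hXU.wts sA
  have wV := hYV.wts sB
  have hx := hW.fresh_left
  have hy := hW.fresh_right
  have fX := swap_fixes hx (hchA X)
  have fY := swap_fixes hy (hchB Y)
  have hZ' := hZ.ren okA okB gX (gY.snoc hy wV) (Equiv.refl _) (Equiv.swap y (chB Y))
  have hW' := hW.ren okA okB gX wU gY wV (Equiv.swap x (chA X)) (Equiv.swap y (chB Y))
  have he := he.ren okA okB (hu.targ_wf sA) (.var gY wV) (Equiv.refl _) (Equiv.swap y (chB Y))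
  have he' := he'.ren okA okB ((huv.term_right sA).targ_wf sA) (.var gY wV) (Equiv.refl _)
    (Equiv.swap y (chB Y))
  rw [renCtx_refl, renCtx_snoc gY wV hy (hchB Y)] at hZ'
  rw [gX.renCtx_of_fixed fX, gY.renCtx_of_fixed fY,
    SortE.subst_ren_of_fixed fX fun z hz => wU.mem hz,
    SortE.subst_ren_of_fixed fY fun z hz => wV.mem hz, Equiv.swap_apply_left,
    Equiv.swap_apply_left] at hW'
  rw [TArg.ren_refl, TArg.ren_var gY wV hy (hchB Y)] at he he'
  have key := hder _ _ _ huv hYV hh (.teqs hZ' he he' hW' hg)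
  have hρ : ∀ z, ren₂ (Equiv.refl A.Var) (Equiv.swap y (chB Y))
      (ren₂ (Equiv.refl A.Var) (Equiv.swap y (chB Y)) z) = z :=
    ren₂_ren₂ (by simp) (by simp)
  have := key.subst (tensorAx_shaped sA sB) hΓ
    (vars_of_renCtx (A := A.tensor B) (π := ren₂ (Equiv.refl _) (Equiv.swap y (chB Y))) hρ hv)
  rw [Judg.subst, Expr.subst_ren_ren (A := A.tensor B) hρ,
    Expr.subst_ren_ren (A := A.tensor B) hρ,
    ren_swap_pairsR gY (fun z hz => hW.scope okA okB gX wU gY wV hz) hx (hchA X) hy (hchB Y)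
      fun j hj => (hg j hj).ren_take_right okA okB (hu.targ_wf sA) gY fY] at this
  exact this

theorem tensor_sort_term {v : Expr B} (hA : IsGAT TA) (hB : IsGAT TB) (hchA : FreshCh chA)
    (hchB : FreshCh chB) (hder : hDerivable TA TB chA chB h) (hXU : Derivable TA (.sort X U))
    (hvV : Derivable TB (.term Y v V)) (hh : ht TA (.sort X U) * ht TB (.term Y v V) ≤ h)
    (hZ : TCtx TA TB false (X ++ [(x, U)]) Y Z)
    (he : TTg TA TB false ⟨X, .var x, U⟩ ⟨Y, v, V⟩ e) (hW : TSo TA TB false X x U Y y V W)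
    (hg : ∀ i (hi : i < X.length),
      TTg TA TB false ⟨X.take i, .var (X[i]'hi).1, (X[i]'hi).2⟩ ⟨Y, v, V⟩ (g i))
    (hΓ : Derivable (tensorAx TA TB chA chB) (.ctx Γ))
    (hv : ∀ p ∈ Z, Derivable (tensorAx TA TB chA chB) (.term Γ (.var p.1) p.2)) :
    Derivable (tensorAx TA TB chA chB) (.term Γ e (W.substL (pairsL X y g))) := by
  classical
  have sA := hA.1.shaped
  have sB := hB.1.shaped
  have okA := hA.symbolsOK
  have okB := hB.symbolsOK
  have hYV := hvV.sort_of_term sB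
  have gX := (hXU.ctx_of_sort sA).good sA
  have gY := (hYV.ctx_of_sort sB).good sB
  have wU := hXU.wts sA
  have wV := hYV.wts sB
  have hx := hW.fresh_left
  have hy := hW.fresh_right
  have fX := swap_fixes hx (hchA X)
  have fY := swap_fixes hy (hchB Y)
  have hZ' := hZ.ren okA okB (gX.snoc hx wU) gY (Equiv.swap x (chA X)) (Equiv.refl _)
  have hW' := hW.ren okA okB gX wU gY wV (Equiv.swap x (chA X)) (Equiv.swap y (chB Y))
  have he' := he.ren okA okB (.var gX wU) (hvV.targ_wf sB) (Equiv.swap x (chA X)) (Equiv.refl _)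
  rw [renCtx_refl, renCtx_snoc gX wU hx (hchA X)] at hZ'
  rw [gX.renCtx_of_fixed fX, gY.renCtx_of_fixed fY,
    SortE.subst_ren_of_fixed fX fun z hz => wU.mem hz,
    SortE.subst_ren_of_fixed fY fun z hz => wV.mem hz, Equiv.swap_apply_left,
    Equiv.swap_apply_left] at hW'
  rw [TArg.ren_refl, TArg.ren_var gX wU hx (hchA X)] at he'
  have key := hder _ _ _ hXU hvV hh (.st hZ' he' hW' hg)
  have hρ : ∀ z, ren₂ (Equiv.swap x (chA X)) (Equiv.refl B.Var)
      (ren₂ (Equiv.swap x (chA X)) (Equiv.refl B.Var) z) = z :=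
    ren₂_ren₂ (by simp) (by simp)
  have := key.subst (tensorAx_shaped sA sB) hΓ
    (vars_of_renCtx (A := A.tensor B) (π := ren₂ (Equiv.swap x (chA X)) (Equiv.refl _)) hρ hv)
  rw [Judg.subst, Expr.subst_ren_ren (A := A.tensor B) hρ,
    ren_swap_pairsL gX (fun z hz => hW.scope okA okB gX wU gY wV hz) hx (hchA X) hy (hchB Y)
      fun i hi => (hg i hi).ren_take_left okA okB gX (hvV.targ_wf sB) fX] at this
  exact this

theorem tensor_sort_termEq {v v' : Expr B} (hA : IsGAT TA) (hB : IsGAT TB) (hchA : FreshCh chA)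
    (hchB : FreshCh chB) (hder : hDerivable TA TB chA chB h) (hXU : Derivable TA (.sort X U))
    (hvv : Derivable TB (.termEq Y v v' V)) (hh : ht TA (.sort X U) * ht TB (.termEq Y v v' V) ≤ h)
    (hZ : TCtx TA TB false (X ++ [(x, U)]) Y Z)
    (he : TTg TA TB false ⟨X, .var x, U⟩ ⟨Y, v, V⟩ e)
    (he' : TTg TA TB false ⟨X, .var x, U⟩ ⟨Y, v', V⟩ e') (hW : TSo TA TB false X x U Y y V W)
    (hg : ∀ i (hi : i < X.length),
      TTg TA TB false ⟨X.take i, .var (X[i]'hi).1, (X[i]'hi).2⟩ ⟨Y, v, V⟩ (g i))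
    (hΓ : Derivable (tensorAx TA TB chA chB) (.ctx Γ))
    (hv : ∀ p ∈ Z, Derivable (tensorAx TA TB chA chB) (.term Γ (.var p.1) p.2)) :
    Derivable (tensorAx TA TB chA chB) (.termEq Γ e e' (W.substL (pairsL X y g))) := by
  classical
  have sA := hA.1.shaped
  have sB := hB.1.shaped
  have okA := hA.symbolsOK
  have okB := hB.symbolsOK
  have hvV := hvv.term_left sB
  have hYV := hvV.sort_of_term sB
  have gX := (hXU.ctx_of_sort sA).good sA
  have gY := (hYV.ctx_of_sort sB).good sB
  have wU := hXU.wts sA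
  have wV := hYV.wts sB
  have hx := hW.fresh_left
  have hy := hW.fresh_right
  have fX := swap_fixes hx (hchA X)
  have fY := swap_fixes hy (hchB Y)
  have hZ' := hZ.ren okA okB (gX.snoc hx wU) gY (Equiv.swap x (chA X)) (Equiv.refl _)
  have hW' := hW.ren okA okB gX wU gY wV (Equiv.swap x (chA X)) (Equiv.swap y (chB Y))
  have he := he.ren okA okB (.var gX wU) (hvV.targ_wf sB) (Equiv.swap x (chA X)) (Equiv.refl _)
  have he' := he'.ren okA okB (.var gX wU) ((hvv.term_right sB).targ_wf sB)
    (Equiv.swap x (chA X)) (Equiv.refl _)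
  rw [renCtx_refl, renCtx_snoc gX wU hx (hchA X)] at hZ'
  rw [gX.renCtx_of_fixed fX, gY.renCtx_of_fixed fY,
    SortE.subst_ren_of_fixed fX fun z hz => wU.mem hz,
    SortE.subst_ren_of_fixed fY fun z hz => wV.mem hz, Equiv.swap_apply_left,
    Equiv.swap_apply_left] at hW'
  rw [TArg.ren_refl, TArg.ren_var gX wU hx (hchA X)] at he he'
  have key := hder _ _ _ hXU hvv hh (.steq hZ' he he' hW' hg)
  have hρ : ∀ z, ren₂ (Equiv.swap x (chA X)) (Equiv.refl B.Var)
      (ren₂ (Equiv.swap x (chA X)) (Equiv.refl B.Var) z) = z :=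
    ren₂_ren₂ (by simp) (by simp)
  have := key.subst (tensorAx_shaped sA sB) hΓ
    (vars_of_renCtx (A := A.tensor B) (π := ren₂ (Equiv.swap x (chA X)) (Equiv.refl _)) hρ hv)
  rw [Judg.subst, Expr.subst_ren_ren (A := A.tensor B) hρ,
    Expr.subst_ren_ren (A := A.tensor B) hρ,
    ren_swap_pairsL gX (fun z hz => hW.scope okA okB gX wU gY wV hz) hx (hchA X) hy (hchB Y)
      fun i hi => (hg i hi).ren_take_left okA okB gX (hvV.targ_wf sB) fX] at this
  exact this

end

theorem lex_of_grid_lt {n i j i' j' : ℕ} (hj : j < n) (h : i' * n + j' < i * n + j) :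
    i' < i ∨ i' = i ∧ j' < j := by
  rcases lt_trichotomy i' i with hi | rfl | hi
  · exact .inl hi
  · exact .inr ⟨rfl, by omega⟩
  · have := Nat.mul_le_mul_right n hi
    rw [Nat.succ_mul] at this
    omega

theorem grid_lt_of_lex {n i j i' j' : ℕ} (hj' : j' < n) (h : i' < i ∨ i' = i ∧ j' < j) :
    i' * n + j' < i * n + j := by
  rcases h with hi | ⟨rfl, hj⟩
  · have := Nat.mul_le_mul_right n hi
    rw [Nat.succ_mul] at this
    omega
  · omega

/-- The sorts of a morphism can be computed by any substitution agreeing with it on the variables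
which occur. -/
theorem subPre_eq_subst {Ax : Set (Judg A)} {Z : PreCtx A} (hZ : Good Ax Z) {f : List (Expr A)}
    (hf : f.length = Z.length) {k : ℕ} (hk : k < Z.length) {θ : A.Var → Expr A}
    (hθ : ∀ l (hl : l < k), SOccurs (Z[l]).1 (Z[k]).2 → θ (Z[l]).1 = f[l]) :
    subPre Z f k hk = (Z[k]).2.subst θ := by
  refine SortE.subst_congr _ fun z hz => ?_
  have hm := hZ.isPreCtx k hk z hz
  obtain ⟨p, hp, rfl⟩ := List.mem_map.1 hm
  obtain ⟨l, hl, rfl⟩ := List.getElem_of_mem hp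
  simp only [List.length_take, lt_inf_iff] at hl
  simp only [List.getElem_take] at hz ⊢
  rw [hθ l hl.1 hz]
  have := lookupV_mkSub_getElem (Z.take k) (f.take k) (hZ.take k).1 l (by simp [hl]) (by simp; omega)
  simpa using this

section
variable {TA : Set (Judg A)} {TB : Set (Judg B)} {chA : PreCtx A → A.Var}
  {chB : PreCtx B → B.Var} {h : ℕ} {X : PreCtx A} {Y : PreCtx B} {x : A.Var} {y : B.Var}
  {U : SortE A} {V : SortE B} {Z Z' : PreCtx (A.tensor B)} {out : List (Expr (A.tensor B))}

/-- The tensor of two contexts is a context. -/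
theorem tensor_ctx (hA : IsGAT TA) (hB : IsGAT TB) (hchA : FreshCh chA) (hchB : FreshCh chB)
    (hder : hDerivable TA TB chA chB h) (hX : Derivable TA (.ctx X)) (hY : Derivable TB (.ctx Y))
    {M N : ℕ} (hM : ∀ i (hi : i < X.length), ht TA (.sort (X.take i) (X[i]).2) ≤ M)
    (hN : ∀ j (hj : j < Y.length), ht TB (.sort (Y.take j) (Y[j]).2) ≤ N) (hMN : M * N ≤ h)
    (hZ : TCtx TA TB false X Y Z) : Derivable (tensorAx TA TB chA chB) (.ctx Z) := by
  have hs := tensorAx_shaped (chA := chA) (chB := chB) hA.1.shaped hB.1.shaped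
  have hnd := hZ.nodup (hX.good hA.1.shaped).1 (hY.good hB.1.shaped).1
  suffices ∀ k ≤ Z.length, Derivable (tensorAx TA TB chA chB) (.ctx (Z.take k)) by
    simpa using this _ le_rfl
  intro k
  induction k with
  | zero => exact fun _ => .of_step .ctx_nil
  | succ k ih =>
  intro hk
  have ih := ih (by omega)
  rw [← List.take_append_getElem (by omega)]
  refine Derivable.snoc hs ?_ fun p hp e => ?_
  · obtain ⟨i, j, hi, hj, rfl⟩ := hZ.exists_index hk
    obtain ⟨Z0, hZ0, hZ0'⟩ := hZ.exists_take (a := i + 1) (b := j + 1) hi hj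
    rw [← List.take_append_getElem hi, ← List.take_append_getElem hj] at hZ0
    refine tensor_sort hA hB hchA hchB hder (hX.sort_of_ctx hA.1.shaped i hi)
      (hY.sort_of_ctx hB.1.shaped j hj) ((Nat.mul_le_mul (hM i hi) (hN j hj)).trans hMN) hZ0
      (hZ.tso hi hj) ih fun p hp => ?_
    refine ih.var_of_ctx hs p ?_
    obtain ⟨l, hl, rfl⟩ := List.getElem_of_mem hp
    have hlen : Z0.length = (i + 1) * (j + 1) := by
      rw [hZ0.1]; simp [Nat.min_eq_left (Nat.succ_le_of_lt hi), Nat.min_eq_left (Nat.succ_le_of_lt hj)]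
    simp only [List.length_dropLast, hlen] at hl
    obtain ⟨i', j', hi', hj', rfl, e⟩ := hZ0' l (by omega)
    rw [List.getElem_dropLast, e, List.mem_take_iff_getElem]
    refine ⟨i' * Y.length + j', ?_, rfl⟩
    have := hZ.lt (hi'.trans_le hi) (hj'.trans_le hj)
    refine lt_min (grid_lt_of_lex (by omega) ?_) this
    rw [Nat.succ_mul] at hl
    exact lex_of_grid_lt (n := j + 1) (by omega) (by omega)
  · obtain ⟨l, hl, rfl⟩ := List.getElem_of_mem hp
    simp only [List.length_take, lt_inf_iff] at hl
    rw [List.getElem_take] at e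
    have := (hnd.getElem_inj_iff (i := l) (j := k) (hi := by simpa using hl.2)
      (hj := by simpa using hk)).1 (by simpa using e)
    omega

theorem TCtx.tso_init_left (h : TCtx TA TB false (X ++ [(x, U)]) Y Z') {i j : ℕ} (hi : i < X.length)
    (hj : j < Y.length) (hk : i * Y.length + j < Z'.length) :
    (Z'[i * Y.length + j]).1 = ((X[i]).1, (Y[j]).1) ∧
      TSo TA TB false (X.take i) (X[i]).1 (X[i]).2 (Y.take j) (Y[j]).1 (Y[j]).2
        (Z'[i * Y.length + j]).2 := by
  have := h.2 i j (by simp; omega) hj hk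
  rwa [List.getElem_append_left hi, List.take_append_of_le_length hi.le] at this

theorem TCtx.tso_last_left (h : TCtx TA TB false (X ++ [(x, U)]) Y Z') {j : ℕ}
    (hj : j < Y.length) (hk : X.length * Y.length + j < Z'.length) :
    (Z'[X.length * Y.length + j]).1 = (x, (Y[j]).1) ∧
      TSo TA TB false X x U (Y.take j) (Y[j]).1 (Y[j]).2 (Z'[X.length * Y.length + j]).2 := by
  have := h.2 X.length j (by simp) hj hk
  simpa using this

theorem TCtx.tso_init_right (h : TCtx TA TB false X (Y ++ [(y, V)]) Z') {i j : ℕ}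
    (hi : i < X.length) (hj : j < Y.length) (hk : i * (Y.length + 1) + j < Z'.length) :
    (Z'[i * (Y.length + 1) + j]).1 = ((X[i]).1, (Y[j]).1) ∧
      TSo TA TB false (X.take i) (X[i]).1 (X[i]).2 (Y.take j) (Y[j]).1 (Y[j]).2
        (Z'[i * (Y.length + 1) + j]).2 := by
  have := h.2 i j hi (by simp; omega) (by simpa using hk)
  simp only [List.length_append, List.length_cons, List.length_nil, zero_add] at this
  rwa [List.getElem_append_left hj, List.take_append_of_le_length hj.le] at this

theorem TCtx.tso_last_right (h : TCtx TA TB false X (Y ++ [(y, V)]) Z') {i : ℕ}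
    (hi : i < X.length) (hk : i * (Y.length + 1) + Y.length < Z'.length) :
    (Z'[i * (Y.length + 1) + Y.length]).1 = ((X[i]).1, y) ∧
      TSo TA TB false (X.take i) (X[i]).1 (X[i]).2 Y y V (Z'[i * (Y.length + 1) + Y.length]).2 := by
  have := h.2 i Y.length hi (by simp) (by simpa using hk)
  simpa using this

end

section
variable {TA : Set (Judg A)} {TB : Set (Judg B)} {chA : PreCtx A → A.Var}
  {chB : PreCtx B → B.Var} {h : ℕ} {X : PreCtx A} {Y : PreCtx B} {x : A.Var} {y : B.Var}
  {u u' : Expr A} {v v' : Expr B} {U : SortE A} {V : SortE B} {Z Z' : PreCtx (A.tensor B)}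
  {out out' : List (Expr (A.tensor B))} {Ax : Set (Judg (A.tensor B))}

theorem TCtx.exists_take_right (h : TCtx TA TB false X Y Z) {j : ℕ} (hj : j < Y.length) :
    ∃ Z0, TCtx TA TB false X (Y.take j ++ [Y[j]]) Z0 ∧ ∀ p ∈ Z0, p ∈ Z := by
  obtain ⟨Z0, h0, h1⟩ := h.exists_take (a := X.length) (b := j + 1) le_rfl hj
  rw [List.take_length, ← List.take_append_getElem hj] at h0
  refine ⟨Z0, h0, fun p hp => ?_⟩
  obtain ⟨k, hk, rfl⟩ := List.getElem_of_mem hp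
  obtain ⟨_, _, _, _, _, e⟩ := h1 k hk
  exact e ▸ List.getElem_mem _

theorem TCtx.exists_take_left (h : TCtx TA TB false X Y Z) {i : ℕ} (hi : i < X.length) :
    ∃ Z0, TCtx TA TB false (X.take i ++ [X[i]]) Y Z0 ∧ ∀ p ∈ Z0, p ∈ Z := by
  obtain ⟨Z0, h0, h1⟩ := h.exists_take (a := i + 1) (b := Y.length) hi le_rfl
  rw [List.take_length, ← List.take_append_getElem hi] at h0
  refine ⟨Z0, h0, fun p hp => ?_⟩
  obtain ⟨k, hk, rfl⟩ := List.getElem_of_mem hp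
  obtain ⟨_, _, _, _, _, e⟩ := h1 k hk
  exact e ▸ List.getElem_mem _

theorem TSecL.length_eq (hout : TSecL TA TB false X u U Y out)
    (hZ' : TCtx TA TB false (X ++ [(x, U)]) Y Z') : out.length = Z'.length := by
  rw [hout.1, hZ'.1]; simp

theorem TSecR.length_eq (hout : TSecR TA TB false X Y v V out)
    (hZ' : TCtx TA TB false X (Y ++ [(y, V)]) Z') : out.length = Z'.length := by
  rw [hout.1, hZ'.1]; simp

theorem TSecL.subPre_init (hout : TSecL TA TB false X u U Y out)
    (hZ' : TCtx TA TB false (X ++ [(x, U)]) Y Z') (hg : Good Ax Z') {i j : ℕ} (hi : i < X.length)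
    (hj : j < Y.length) (hk : i * Y.length + j < Z'.length) :
    subPre Z' out _ hk = (Z'[i * Y.length + j]).2 := by
  rw [subPre_eq_subst hg (hout.length_eq hZ') hk (θ := Expr.var), SortE.subst_var_self]
  intro l hl _
  obtain ⟨i', j', hi', hj', rfl⟩ := hZ'.exists_index (hl.trans hk)
  have hi' : i' < X.length := by have := lex_of_grid_lt hj hl; omega
  rw [(hZ'.tso_init_left hi' hj' (hl.trans hk)).1]
  exact (hout.2.1 i' j' hi' hj' _).var_var.symm

theorem TSecL.subPre_last (hout : TSecL TA TB false X u U Y out)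
    (hZ' : TCtx TA TB false (X ++ [(x, U)]) Y Z') (hg : Good Ax Z') (hx : ∀ p ∈ X, p.1 ≠ x)
    (hY : (names Y).Nodup) {j : ℕ} (hj : j < Y.length)
    (hk : X.length * Y.length + j < Z'.length) {g : ℕ → Expr (A.tensor B)}
    (hgo : ∀ l (hl : X.length * Y.length + l < out.length), g l = out[X.length * Y.length + l]) :
    subPre Z' out _ hk =
      ((Z'[X.length * Y.length + j]).2).substL (pairsR x (Y.take j) g) := by
  refine subPre_eq_subst hg (hout.length_eq hZ') hk fun l hl _ => ?_
  have hl' := hl.trans hk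
  obtain ⟨i', j', hi', hj', rfl⟩ := hZ'.exists_index hl'
  rcases lex_of_grid_lt hj hl with hi' | ⟨rfl, hjj⟩
  · rw [(hZ'.tso_init_left hi' hj' hl').1, (hout.2.1 i' j' hi' hj' _).var_var]
    exact lookupV_pairsR_of_ne (z := (_, _)) (hx _ (List.getElem_mem hi'))
  · rw [(hZ'.tso_last_left hj' hl').1, ← hgo]
    have hn : (names (Y.take j)).Nodup := by
      rw [names, List.map_take]; exact hY.sublist (List.take_sublist _ _)
    have := lookupV_pairsR_getElem (x := x) hn g (j := j') (by simp; omega)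
    rwa [List.getElem_take] at this

theorem TSecR.subPre_init (hout : TSecR TA TB false X Y v V out)
    (okA : SymbolsOK TA) (okB : SymbolsOK TB) (hX : Good TA X) (hY : Good TB Y)
    (hZ' : TCtx TA TB false X (Y ++ [(y, V)]) Z') (hg : Good Ax Z') (hy : ∀ p ∈ Y, p.1 ≠ y)
    {i j : ℕ} (hi : i < X.length) (hj : j < Y.length) (hk : i * (Y.length + 1) + j < Z'.length) :
    subPre Z' out _ hk = (Z'[i * (Y.length + 1) + j]).2 := by
  rw [subPre_eq_subst hg (hout.length_eq hZ') hk (θ := Expr.var), SortE.subst_var_self]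
  intro l hl hz
  have hl' := hl.trans hk
  obtain ⟨i', j', hi', hj', rfl⟩ := hZ'.exists_index hl'
  simp only [List.length_append, List.length_cons, List.length_nil, zero_add] at hl hl' hj' hz ⊢
  rcases Nat.lt_succ_iff_lt_or_eq.1 hj' with hj' | rfl
  · rw [(hZ'.tso_init_right hi' hj' hl').1]
    exact (hout.2.1 i' j' hi' hj' _).var_var.symm
  · rw [(hZ'.tso_last_right hi' hl').1] at hz
    have hne : y ∉ names Y := fun hm => by
      obtain ⟨p, hp, e⟩ := List.mem_map.1 hm
      exact hy p hp e
    have := TSo.scope okA okB (hX.take i) (hX.2 i hi) (hY.take j) (hY.2 j hj)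
      (hZ'.tso_init_right hi hj hk).2 hz
    rcases this with ⟨_, h⟩ | ⟨_, h⟩ | ⟨_, h⟩
    · exact absurd (names_take_subset h) hne
    · exact absurd (names_take_subset h) hne
    · exact absurd h (hy _ (List.getElem_mem hj)).symm

theorem TSecR.subPre_last (hout : TSecR TA TB false X Y v V out)
    (hZ' : TCtx TA TB false X (Y ++ [(y, V)]) Z') (hg : Good Ax Z') (hy : ∀ p ∈ Y, p.1 ≠ y)
    (hX : (names X).Nodup) {i : ℕ} (hi : i < X.length)
    (hk : i * (Y.length + 1) + Y.length < Z'.length) {g : ℕ → Expr (A.tensor B)}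
    (hgo : ∀ l (hl : l * (Y.length + 1) + Y.length < out.length),
      g l = out[l * (Y.length + 1) + Y.length]) :
    subPre Z' out _ hk =
      ((Z'[i * (Y.length + 1) + Y.length]).2).substL (pairsL (X.take i) y g) := by
  refine subPre_eq_subst hg (hout.length_eq hZ') hk fun l hl _ => ?_
  have hl' := hl.trans hk
  obtain ⟨i', j', hi', hj', rfl⟩ := hZ'.exists_index hl'
  simp only [List.length_append, List.length_cons, List.length_nil, zero_add] at hl hl' hj' ⊢
  rcases Nat.lt_succ_iff_lt_or_eq.1 hj' with hj' | rfl
  · rw [(hZ'.tso_init_right hi' hj' hl').1, (hout.2.1 i' j' hi' hj' _).var_var]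
    exact lookupV_pairsL_of_ne (z := (_, _)) (hy _ (List.getElem_mem hj'))
  · have hii : i' < i := by have := lex_of_grid_lt (Nat.lt_succ_self Y.length) hl; omega
    rw [(hZ'.tso_last_right hi' hl').1, ← hgo]
    have hn : (names (X.take i)).Nodup := by
      rw [names, List.map_take]; exact hX.sublist (List.take_sublist _ _)
    have := lookupV_pairsL_getElem (y := y) hn g (i := i') (by simp; omega)
    rwa [List.getElem_take] at this

end

/-- All sorts of a context extended by the sort of a term equality have at most the height of the
equality. -/
theorem ht_snoc_le {Ax : Set (Judg A)} (hs : Shaped Ax) {X : PreCtx A} {u v : Expr A} {U : SortE A}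
    (huv : Derivable Ax (.termEq X u v U)) (x : A.Var) (i : ℕ) (hi : i < (X ++ [(x, U)]).length) :
    ht Ax (.sort ((X ++ [(x, U)]).take i) ((X ++ [(x, U)])[i]).2) ≤ ht Ax (.termEq X u v U) := by
  have hU : DerAt Ax _ (.sort X U) := (huv.derAt_ht.presup hs).1.presup hs |>.1
  have hX : DerAt Ax _ (.ctx X) := (hU.presup hs).1
  simp only [List.length_append, List.length_cons, List.length_nil, zero_add] at hi
  rcases Nat.lt_succ_iff_lt_or_eq.1 hi with hi | rfl
  · rw [List.take_append_of_le_length hi.le, List.getElem_append_left hi]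
    exact (hX.sort_of_ctx hs i hi).ht_le
  · simpa using hU.ht_le

section
variable {TA : Set (Judg A)} {TB : Set (Judg B)} {chA : PreCtx A → A.Var}
  {chB : PreCtx B → B.Var} {h : ℕ} {X : PreCtx A} {Y : PreCtx B} {x : A.Var} {y : B.Var}
  {u u' : Expr A} {v v' : Expr B} {U : SortE A} {V : SortE B} {Z Z' : PreCtx (A.tensor B)}
  {out out' : List (Expr (A.tensor B))}

theorem TSecL.term_init (hout : TSecL TA TB false X u U Y out) (hA : IsGAT TA) (hB : IsGAT TB)
    (hX : Good TA X) (hY : Good TB Y) (hZ : TCtx TA TB false X Y Z)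
    (hZ' : TCtx TA TB false (X ++ [(x, U)]) Y Z')
    (hΓ : Derivable (tensorAx TA TB chA chB) (.ctx Z))
    (hΓ' : Derivable (tensorAx TA TB chA chB) (.ctx Z')) {i j : ℕ} (hi : i < X.length)
    (hj : j < Y.length) (hk : i * Y.length + j < Z'.length) (hk' : i * Y.length + j < out.length) :
    out[i * Y.length + j] = .var ((X[i]).1, (Y[j]).1) ∧
      Derivable (tensorAx TA TB chA chB) (.term Z out[i * Y.length + j] (subPre Z' out _ hk)) := by
  have hs := tensorAx_shaped (chA := chA) (chB := chB) hA.1.shaped hB.1.shaped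
  have e := (hout.2.1 i j hi hj hk').var_var
  refine ⟨e, ?_⟩
  rw [e, hout.subPre_init hZ' (hΓ'.good hs) hi hj hk,
    TSo.det hA.symbolsOK hB.symbolsOK (hX.take i) (hX.2 i hi) (hY.take j) (hY.2 j hj)
      (hZ'.tso_init_left hi hj hk).2 (hZ.tso hi hj), ← hZ.getElem_fst hi hj]
  exact hΓ.var_of_ctx hs _ (List.getElem_mem _)

theorem tensor_secL_isMor (hA : IsGAT TA) (hB : IsGAT TB) (hchA : FreshCh chA)
    (hchB : FreshCh chB) (hder : hDerivable TA TB chA chB h) (hu : Derivable TA (.term X u U))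
    (hY : Derivable TB (.ctx Y))
    (hh : ∀ j (hj : j < Y.length), ht TA (.term X u U) * ht TB (.sort (Y.take j) (Y[j]).2) ≤ h)
    (hx : ∀ p ∈ X, p.1 ≠ x) (hout : TSecL TA TB false X u U Y out)
    (hZ : TCtx TA TB false X Y Z) (hZ' : TCtx TA TB false (X ++ [(x, U)]) Y Z')
    (hΓ : Derivable (tensorAx TA TB chA chB) (.ctx Z))
    (hΓ' : Derivable (tensorAx TA TB chA chB) (.ctx Z')) :
    IsMor (tensorAx TA TB chA chB) Z Z' out := by
  have hs := tensorAx_shaped (chA := chA) (chB := chB) hA.1.shaped hB.1.shaped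
  have hX := ((hu.sort_of_term hA.1.shaped).ctx_of_sort hA.1.shaped).good hA.1.shaped
  refine ⟨hΓ, hΓ', hout.length_eq hZ', fun k hk hk' => ?_⟩
  obtain ⟨i, j, hi, hj, rfl⟩ := hZ'.exists_index hk
  simp only [List.length_append, List.length_cons, List.length_nil, zero_add] at hi
  rcases Nat.lt_succ_iff_lt_or_eq.1 hi with hi | rfl
  · exact (hout.term_init hA hB hX (hY.good hB.1.shaped) hZ hZ' hΓ hΓ' hi hj hk hk').2
  · have hgo : ∀ l (hl : X.length * Y.length + l < out.length),
        out.getD (X.length * Y.length + l) out[X.length * Y.length + j] =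
          out[X.length * Y.length + l] := fun l hl => by simp [List.getD, hl]
    rw [hout.subPre_last hZ' (hΓ'.good hs) hx (hY.good hB.1.shaped).1 hj hk hgo]
    obtain ⟨Z0, hZ0, hm⟩ := hZ.exists_take_right hj
    refine tensor_term_sort hA hB hchA hchB hder hu (hY.sort_of_ctx hB.1.shaped j hj) (hh j hj) hZ0
      (hout.2.2 j hj hk') (hZ'.tso_last_left hj hk).2 (fun l hl => ?_) hΓ
      fun p hp => hΓ.var_of_ctx hs p (hm p hp)
    simp only [List.length_take, lt_inf_iff] at hl
    rw [hgo l (by omega), List.take_take, min_eq_left hl.1.le, List.getElem_take]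
    exact hout.2.2 l hl.2 _

/-- The morphism equality obtained by tensoring a term equality with a context. -/
theorem tensor_secL_morEq (hA : IsGAT TA) (hB : IsGAT TB) (hchA : FreshCh chA)
    (hchB : FreshCh chB) (hder : hDerivable TA TB chA chB h)
    (huv : Derivable TA (.termEq X u u' U)) (hY : Derivable TB (.ctx Y))
    (hh : ht TA (.termEq X u u' U) * htCtx TB Y ≤ h)
    (hx : ∀ p ∈ X, p.1 ≠ x) (hout : TSecL TA TB false X u U Y out)
    (hout' : TSecL TA TB false X u' U Y out')
    (hZ : TCtx TA TB false X Y Z) (hZ' : TCtx TA TB false (X ++ [(x, U)]) Y Z') :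
    MorEq (tensorAx TA TB chA chB) Z Z' out out' := by
  have sA := hA.1.shaped
  have sB := hB.1.shaped
  have hs := tensorAx_shaped (chA := chA) (chB := chB) sA sB
  have hu := huv.term_left sA
  have hU := hu.sort_of_term sA
  have hX := hU.ctx_of_sort sA
  have hM := ht_snoc_le sA huv x
  have hN := ht_le_htCtx sB hY
  have hh' : ∀ j (hj : j < Y.length),
      ht TA (.termEq X u u' U) * ht TB (.sort (Y.take j) (Y[j]).2) ≤ h :=
    fun j hj => (Nat.mul_le_mul_left _ (hN j hj)).trans hh
  have hΓ : Derivable (tensorAx TA TB chA chB) (.ctx Z) :=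
    tensor_ctx hA hB hchA hchB hder hX hY (fun i hi => by
      have := hM i (by simp; omega)
      rwa [List.take_append_of_le_length hi.le, List.getElem_append_left hi] at this) hN hh hZ
  have hΓ' : Derivable (tensorAx TA TB chA chB) (.ctx Z') :=
    tensor_ctx hA hB hchA hchB hder (hU.snoc sA hx) hY hM hN hh hZ'
  have hd := huv.derAt_ht.presup sA
  refine ⟨tensor_secL_isMor hA hB hchA hchB hder hu hY
      (fun j hj => (Nat.mul_le_mul_right _ hd.1.ht_le).trans (hh' j hj)) hx hout hZ hZ' hΓ hΓ',
    tensor_secL_isMor hA hB hchA hchB hder (huv.term_right sA) hY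
      (fun j hj => (Nat.mul_le_mul_right _ hd.2.ht_le).trans (hh' j hj)) hx hout' hZ hZ' hΓ hΓ',
    fun k hk hk' hk'' => ?_⟩
  obtain ⟨i, j, hi, hj, rfl⟩ := hZ'.exists_index hk
  simp only [List.length_append, List.length_cons, List.length_nil, zero_add] at hi
  rcases Nat.lt_succ_iff_lt_or_eq.1 hi with hi | rfl
  · have h1 := hout.term_init hA hB (hX.good sA) (hY.good sB) hZ hZ' hΓ hΓ' hi hj hk hk'
    have h2 := hout'.term_init hA hB (hX.good sA) (hY.good sB) hZ hZ' hΓ hΓ' hi hj hk hk''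
    rw [h2.1, ← h1.1]
    exact .of_step (.t1 h1.2)
  · have hgo : ∀ l (hl : X.length * Y.length + l < out.length),
        out.getD (X.length * Y.length + l) out[X.length * Y.length + j] =
          out[X.length * Y.length + l] := fun l hl => by simp [List.getD, hl]
    rw [hout.subPre_last hZ' (hΓ'.good hs) hx (hY.good sB).1 hj hk hgo]
    obtain ⟨Z0, hZ0, hm⟩ := hZ.exists_take_right hj
    refine tensor_termEq_sort hA hB hchA hchB hder huv (hY.sort_of_ctx sB j hj) (hh' j hj) hZ0
      (hout.2.2 j hj hk') (hout'.2.2 j hj hk'') (hZ'.tso_last_left hj hk).2 (fun l hl => ?_) hΓ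
      fun p hp => hΓ.var_of_ctx hs p (hm p hp)
    simp only [List.length_take, lt_inf_iff] at hl
    rw [hgo l (by omega), List.take_take, min_eq_left hl.1.le, List.getElem_take]
    exact hout.2.2 l hl.2 _

theorem TSecR.term_init (hout : TSecR TA TB false X Y v V out) (hA : IsGAT TA) (hB : IsGAT TB)
    (hX : Good TA X) (hY : Good TB Y) (hy : ∀ p ∈ Y, p.1 ≠ y) (hZ : TCtx TA TB false X Y Z)
    (hZ' : TCtx TA TB false X (Y ++ [(y, V)]) Z')
    (hΓ : Derivable (tensorAx TA TB chA chB) (.ctx Z))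
    (hΓ' : Derivable (tensorAx TA TB chA chB) (.ctx Z')) {i j : ℕ} (hi : i < X.length)
    (hj : j < Y.length) (hk : i * (Y.length + 1) + j < Z'.length)
    (hk' : i * (Y.length + 1) + j < out.length) :
    out[i * (Y.length + 1) + j] = .var ((X[i]).1, (Y[j]).1) ∧
      Derivable (tensorAx TA TB chA chB)
        (.term Z out[i * (Y.length + 1) + j] (subPre Z' out _ hk)) := by
  have hs := tensorAx_shaped (chA := chA) (chB := chB) hA.1.shaped hB.1.shaped
  have e := (hout.2.1 i j hi hj hk').var_var
  refine ⟨e, ?_⟩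
  rw [e, hout.subPre_init hA.symbolsOK hB.symbolsOK hX hY hZ' (hΓ'.good hs) hy hi hj hk,
    TSo.det hA.symbolsOK hB.symbolsOK (hX.take i) (hX.2 i hi) (hY.take j) (hY.2 j hj)
      (hZ'.tso_init_right hi hj hk).2 (hZ.tso hi hj), ← hZ.getElem_fst hi hj]
  exact hΓ.var_of_ctx hs _ (List.getElem_mem _)

theorem tensor_secR_isMor (hA : IsGAT TA) (hB : IsGAT TB) (hchA : FreshCh chA)
    (hchB : FreshCh chB) (hder : hDerivable TA TB chA chB h) (hX : Derivable TA (.ctx X))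
    (hv : Derivable TB (.term Y v V))
    (hh : ∀ i (hi : i < X.length), ht TA (.sort (X.take i) (X[i]).2) * ht TB (.term Y v V) ≤ h)
    (hy : ∀ p ∈ Y, p.1 ≠ y) (hout : TSecR TA TB false X Y v V out)
    (hZ : TCtx TA TB false X Y Z) (hZ' : TCtx TA TB false X (Y ++ [(y, V)]) Z')
    (hΓ : Derivable (tensorAx TA TB chA chB) (.ctx Z))
    (hΓ' : Derivable (tensorAx TA TB chA chB) (.ctx Z')) :
    IsMor (tensorAx TA TB chA chB) Z Z' out := by
  have hs := tensorAx_shaped (chA := chA) (chB := chB) hA.1.shaped hB.1.shaped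
  have hY := ((hv.sort_of_term hB.1.shaped).ctx_of_sort hB.1.shaped).good hB.1.shaped
  refine ⟨hΓ, hΓ', hout.length_eq hZ', fun k hk hk' => ?_⟩
  obtain ⟨i, j, hi, hj, rfl⟩ := hZ'.exists_index hk
  simp only [List.length_append, List.length_cons, List.length_nil, zero_add] at hk hk' hj ⊢
  rcases Nat.lt_succ_iff_lt_or_eq.1 hj with hj | rfl
  · exact (hout.term_init hA hB (hX.good hA.1.shaped) hY hy hZ hZ' hΓ hΓ' hi hj hk hk').2
  · have hgo : ∀ l (hl : l * (Y.length + 1) + Y.length < out.length),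
        out.getD (l * (Y.length + 1) + Y.length) out[i * (Y.length + 1) + Y.length] =
          out[l * (Y.length + 1) + Y.length] := fun l hl => by simp [List.getD, hl]
    rw [hout.subPre_last hZ' (hΓ'.good hs) hy (hX.good hA.1.shaped).1 hi hk hgo]
    obtain ⟨Z0, hZ0, hm⟩ := hZ.exists_take_left hi
    refine tensor_sort_term hA hB hchA hchB hder (hX.sort_of_ctx hA.1.shaped i hi) hv (hh i hi) hZ0
      (hout.2.2 i hi hk') (hZ'.tso_last_right hi hk).2 (fun l hl => ?_) hΓ
      fun p hp => hΓ.var_of_ctx hs p (hm p hp)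
    simp only [List.length_take, lt_inf_iff] at hl
    rw [hgo l ((grid_lt_of_lex (Nat.lt_succ_self _) (.inl hl.1)).trans hk'), List.take_take,
      min_eq_left hl.1.le, List.getElem_take]
    exact hout.2.2 l hl.2 _

/-- The morphism equality obtained by tensoring a context with a term equality. -/
theorem tensor_secR_morEq (hA : IsGAT TA) (hB : IsGAT TB) (hchA : FreshCh chA)
    (hchB : FreshCh chB) (hder : hDerivable TA TB chA chB h) (hX : Derivable TA (.ctx X))
    (hvv : Derivable TB (.termEq Y v v' V))
    (hh : htCtx TA X * ht TB (.termEq Y v v' V) ≤ h)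
    (hy : ∀ p ∈ Y, p.1 ≠ y) (hout : TSecR TA TB false X Y v V out)
    (hout' : TSecR TA TB false X Y v' V out')
    (hZ : TCtx TA TB false X Y Z) (hZ' : TCtx TA TB false X (Y ++ [(y, V)]) Z') :
    MorEq (tensorAx TA TB chA chB) Z Z' out out' := by
  have sA := hA.1.shaped
  have sB := hB.1.shaped
  have hs := tensorAx_shaped (chA := chA) (chB := chB) sA sB
  have hv := hvv.term_left sB
  have hV := hv.sort_of_term sB
  have hY := hV.ctx_of_sort sB
  have hM := ht_le_htCtx sA hX
  have hN := ht_snoc_le sB hvv y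
  have hh' : ∀ i (hi : i < X.length),
      ht TA (.sort (X.take i) (X[i]).2) * ht TB (.termEq Y v v' V) ≤ h :=
    fun i hi => (Nat.mul_le_mul_right _ (hM i hi)).trans hh
  have hΓ : Derivable (tensorAx TA TB chA chB) (.ctx Z) :=
    tensor_ctx hA hB hchA hchB hder hX hY hM (fun j hj => by
      have := hN j (by simp; omega)
      rwa [List.take_append_of_le_length hj.le, List.getElem_append_left hj] at this) hh hZ
  have hΓ' : Derivable (tensorAx TA TB chA chB) (.ctx Z') :=
    tensor_ctx hA hB hchA hchB hder hX (hV.snoc sB hy) hM hN hh hZ'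
  have hd := hvv.derAt_ht.presup sB
  refine ⟨tensor_secR_isMor hA hB hchA hchB hder hX hv
      (fun i hi => (Nat.mul_le_mul_left _ hd.1.ht_le).trans (hh' i hi)) hy hout hZ hZ' hΓ hΓ',
    tensor_secR_isMor hA hB hchA hchB hder hX (hvv.term_right sB)
      (fun i hi => (Nat.mul_le_mul_left _ hd.2.ht_le).trans (hh' i hi)) hy hout' hZ hZ' hΓ hΓ',
    fun k hk hk' hk'' => ?_⟩
  obtain ⟨i, j, hi, hj, rfl⟩ := hZ'.exists_index hk
  simp only [List.length_append, List.length_cons, List.length_nil, zero_add] at hk hk' hk'' hj ⊢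
  rcases Nat.lt_succ_iff_lt_or_eq.1 hj with hj | rfl
  · have h1 := hout.term_init hA hB (hX.good sA) (hY.good sB) hy hZ hZ' hΓ hΓ' hi hj hk hk'
    have h2 := hout'.term_init hA hB (hX.good sA) (hY.good sB) hy hZ hZ' hΓ hΓ' hi hj hk hk''
    rw [h2.1, ← h1.1]
    exact .of_step (.t1 h1.2)
  · have hgo : ∀ l (hl : l * (Y.length + 1) + Y.length < out.length),
        out.getD (l * (Y.length + 1) + Y.length) out[i * (Y.length + 1) + Y.length] =
          out[l * (Y.length + 1) + Y.length] := fun l hl => by simp [List.getD, hl]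
    rw [hout.subPre_last hZ' (hΓ'.good hs) hy (hX.good sA).1 hi hk hgo]
    obtain ⟨Z0, hZ0, hm⟩ := hZ.exists_take_left hi
    refine tensor_sort_termEq hA hB hchA hchB hder (hX.sort_of_ctx sA i hi) hvv (hh' i hi) hZ0
      (hout.2.2 i hi hk') (hout'.2.2 i hi hk'') (hZ'.tso_last_right hi hk).2 (fun l hl => ?_) hΓ
      fun p hp => hΓ.var_of_ctx hs p (hm p hp)
    simp only [List.length_take, lt_inf_iff] at hl
    rw [hgo l ((grid_lt_of_lex (Nat.lt_succ_self _) (.inl hl.1)).trans hk'), List.take_take,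
      min_eq_left hl.1.le, List.getElem_take]
    exact hout.2.2 l hl.2 _

end

/-- Suppose `(𝔸,𝔹)` is `h`-derivable and let `X`, `Y` be
contexts of `𝔸`, `𝔹`.  (1) If `X ⊢ u ≡ v : U` is derivable with
`ht(X ⊢ u ≡ v:U) · ht(Y) ≤ h` then, for a variable `x'` not in `X`, the morphism
equality `(x₁,…,x_m,u^U) ⊗ Y ≡ (x₁,…,x_m,v^U) ⊗ Y : X⊗Y → X'⊗Y` is derivable in
`𝔸⊗𝔹`, where `X' = (X, x':U)`.  (2) Symmetrically for a derivable
`Y ⊢ u ≡ v : V` with `ht(X) · ht(Y ⊢ u ≡ v:V) ≤ h`. -/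
theorem tensor_section_morphism_equality
    (A B : Alphabet) (TA : Set (Judg A)) (TB : Set (Judg B))
    (hA : IsGAT TA) (hB : IsGAT TB)
    (chA : PreCtx A → A.Var) (hchA : FreshCh chA)
    (chB : PreCtx B → B.Var) (hchB : FreshCh chB)
    (h : ℕ) (hder : hDerivable TA TB chA chB h)
    (X : PreCtx A) (Y : PreCtx B)
    (hX : Derivable TA (.ctx X)) (hY : Derivable TB (.ctx Y)) :
    (∀ (u v : Expr A) (U : SortE A) (x' : A.Var)
        (out1 out2 : List (Expr (A.tensor B))) (ZXY ZX'Y : PreCtx (A.tensor B)),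
        Derivable TA (.termEq X u v U) →
        ht TA (.termEq X u v U) * htCtx TB Y ≤ h →
        (∀ p ∈ X, p.1 ≠ x') →
        TSecL TA TB false X u U Y out1 →
        TSecL TA TB false X v U Y out2 →
        TCtx TA TB false X Y ZXY →
        TCtx TA TB false (X ++ [(x', U)]) Y ZX'Y →
        MorEq (tensorAx TA TB chA chB) ZXY ZX'Y out1 out2) ∧
    (∀ (u v : Expr B) (V : SortE B) (y' : B.Var)
        (out1 out2 : List (Expr (A.tensor B))) (ZXY ZXY' : PreCtx (A.tensor B)),
        Derivable TB (.termEq Y u v V) →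
        htCtx TA X * ht TB (.termEq Y u v V) ≤ h →
        (∀ p ∈ Y, p.1 ≠ y') →
        TSecR TA TB false X Y u V out1 →
        TSecR TA TB false X Y v V out2 →
        TCtx TA TB false X Y ZXY →
        TCtx TA TB false X (Y ++ [(y', V)]) ZXY' →
        MorEq (tensorAx TA TB chA chB) ZXY ZXY' out1 out2) := by
  refine ⟨fun u v U x' out1 out2 ZXY ZX'Y huv hh hx h1 h2 hZ hZ' => ?_,
    fun u v V y' out1 out2 ZXY ZXY' huv hh hy h1 h2 hZ hZ' => ?_⟩
  · exact tensor_secL_morEq hA hB hchA hchB hder huv hY hh hx h1 h2 hZ hZ'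
  · exact tensor_secR_morEq hA hB hchA hchB hder hX huv hh hy h1 h2 hZ hZ'

end GATPaper
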